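/- In the discharging of H defined by rules R1–R5 applied to the initial charge (every j-face charged with weight j), every minor 6-face f of H has final weight w(f) ≥ 10/3. -/

import Mathlib

open scoped Classical

noncomputable section

/-- A plane embedding (drawing) of a simple graph: vertices are mapped to distinct
points of the plane, every edge is drawn as a simple arc joining the points of its two
endvertices, arcs contain no vertex points other than their endpoints, and two distinct
arcs meet only in common endpoints. -/
structure PlaneEmbedding {V : Type*} (G : SimpleGraph V) where
  pos : V → ℝ × ℝ
  arc : V → V → Set (ℝ × ℝ)
  pos_injective : Function.Injective pos
  arc_symm : ∀ u v, arc u v = arc v u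
  arc_curve : ∀ u v, G.Adj u v → ∃ γ : ℝ → ℝ × ℝ,
      ContinuousOn γ (Set.Icc 0 1) ∧ Set.InjOn γ (Set.Icc 0 1) ∧
      γ 0 = pos u ∧ γ 1 = pos v ∧ γ '' Set.Icc 0 1 = arc u v
  arc_vertex : ∀ u v, G.Adj u v → ∀ w, pos w ∈ arc u v → w = u ∨ w = v
  arc_inter : ∀ u v x y, G.Adj u v → G.Adj x y → s(u, v) ≠ s(x, y) →
      arc u v ∩ arc x y ⊆ Set.range pos

/-- A graph is planar if it admits a plane embedding. -/
def SimpleGraph.IsPlanar {V : Type*} (G : SimpleGraph V) : Prop :=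
  Nonempty (PlaneEmbedding G)

/-- A graph is 3-connected if it has at least four vertices and deleting any set of at
most two vertices leaves a connected graph. -/
def ThreeConnected {V : Type*} [Fintype V] (G : SimpleGraph V) : Prop :=
  4 ≤ Fintype.card V ∧
    ∀ S : Finset V, S.card ≤ 2 → (G.induce ((↑S : Set V)ᶜ)).Connected

/-- `S` is a separator of `G`: deleting it leaves a disconnected graph. -/
def IsSeparator {V : Type*} [Fintype V] (G : SimpleGraph V) (S : Finset V) : Prop :=
  ¬ (G.induce ((↑S : Set V)ᶜ)).Connected

/-- A separator `S` is trivial if some component of `G - S` is a single vertex, i.e.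
some vertex outside `S` has all of its neighbours inside `S`. -/
def TrivialSeparator {V : Type*} [Fintype V] (G : SimpleGraph V) (S : Finset V) : Prop :=
  ∃ v : V, v ∉ S ∧ ∀ w : V, G.Adj v w → w ∈ S

/-- A graph is essentially 4-connected if it is 3-connected and every 3-separator is
trivial. -/
def EssentiallyFourConnected {V : Type*} [Fintype V] (G : SimpleGraph V) : Prop :=
  ThreeConnected G ∧
    ∀ S : Finset V, S.card = 3 → IsSeparator G S → TrivialSeparator G S

/-- A cycle `C` of `G` is isolating if every component of `G - V(C)` is a single vertex
of degree 3 in `G`, i.e. every vertex not on `C` has degree 3 in `G` and all of its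
neighbours on `C`. -/
def IsIsolating {V : Type*} [Fintype V] (G : SimpleGraph V) {x : V} (C : G.Walk x x) : Prop :=
  ∀ v : V, v ∉ C.support →
    (Finset.univ.filter fun w => G.Adj v w).card = 3 ∧ ∀ w : V, G.Adj v w → w ∈ C.support

/-- `C` is a longest isolating cycle of `G`. -/
def IsLongestIsolatingCycle {V : Type*} [Fintype V] (G : SimpleGraph V) {x : V}
    (C : G.Walk x x) : Prop :=
  C.IsCycle ∧ IsIsolating G C ∧
    ∀ (y : V) (C' : G.Walk y y), C'.IsCycle → IsIsolating G C' → C'.length ≤ C.length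

section PlaneSetup

variable {V : Type*} [Fintype V] {G : SimpleGraph V}

/-- The chords of the cycle `C`: edges of `G` not on `C` joining two vertices of `C`. -/
def chordSet {x : V} (C : G.Walk x x) : Set (Sym2 V) :=
  {e | e ∈ G.edgeSet ∧ e ∉ C.edges ∧ ∀ v ∈ e, v ∈ C.support}

/-- The plane graph `H` obtained from `G` by deleting all chords of `C`. -/
def Hgraph {x : V} (C : G.Walk x x) : SimpleGraph V :=
  G.deleteEdges (chordSet C)

/-- The arc drawing an edge, as a function of the unordered edge. -/
def arcSet (emb : PlaneEmbedding G) : Sym2 V → Set (ℝ × ℝ) :=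
  Sym2.lift ⟨emb.arc, emb.arc_symm⟩

/-- The point set of the drawing of the subgraph of `H'` induced on the vertex set `s`
(in the embedding `emb` of `G`). -/
def drawingOn (emb : PlaneEmbedding G) (H' : SimpleGraph V) (s : Set V) : Set (ℝ × ℝ) :=
  emb.pos '' s ∪
    ⋃ (u : V) (v : V) (_ : H'.Adj u v) (_ : u ∈ s) (_ : v ∈ s), emb.arc u v

/-- The drawing of `H`. -/
def drawingH (emb : PlaneEmbedding G) {x : V} (C : G.Walk x x) : Set (ℝ × ℝ) :=
  drawingOn emb (Hgraph C) Set.univ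

/-- `f` is a face of the drawing `D`: a connected component of its complement. -/
def IsFaceOf (D : Set (ℝ × ℝ)) (f : Set (ℝ × ℝ)) : Prop :=
  ∃ z : ℝ × ℝ, z ∉ D ∧ f = connectedComponentIn Dᶜ z

/-- The drawing of the cycle `C`. -/
def drawC (emb : PlaneEmbedding G) {x : V} (C : G.Walk x x) : Set (ℝ × ℝ) :=
  ⋃ e ∈ C.edges, arcSet emb e

/-- The open region strictly inside the closed curve given by `C`: the points off the
curve whose connected component in the complement is bounded. -/
def insideC (emb : PlaneEmbedding G) {x : V} (C : G.Walk x x) : Set (ℝ × ℝ) :=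
  {z | z ∉ drawC emb C ∧ Bornology.IsBounded (connectedComponentIn (drawC emb C)ᶜ z)}

/-- The vertices of `G` strictly inside `C`. -/
def Vminus (emb : PlaneEmbedding G) {x : V} (C : G.Walk x x) : Finset V :=
  Finset.univ.filter fun v => v ∉ C.support ∧ emb.pos v ∈ insideC emb C

/-- The vertices of `G` strictly outside `C`:  `V⁺ = V - V(C) - V⁻`. -/
def Vplus (emb : PlaneEmbedding G) {x : V} (C : G.Walk x x) : Finset V :=
  Finset.univ.filter fun v => v ∉ C.support ∧ v ∉ Vminus emb C

/-- A face `f` is incident with the vertex `v`. -/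
def incVertex (emb : PlaneEmbedding G) (f : Set (ℝ × ℝ)) (v : V) : Prop :=
  emb.pos v ∈ closure f

/-- A face `f` is incident with the edge `e` (the arc of `e` lies on the boundary). -/
def incEdge (emb : PlaneEmbedding G) (f : Set (ℝ × ℝ)) (e : Sym2 V) : Prop :=
  arcSet emb e ⊆ closure f

/-- A minor face of the drawing `D`: a face incident with exactly one vertex of
`V⁻ ∪ V⁺`. -/
def MinorFaceOf (emb : PlaneEmbedding G) {x : V} (C : G.Walk x x)
    (D : Set (ℝ × ℝ)) (f : Set (ℝ × ℝ)) : Prop :=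
  IsFaceOf D f ∧ ∃! v : V, v ∈ Vminus emb C ∪ Vplus emb C ∧ incVertex emb f v

/-- `M⁻`: the minor faces of `H⁻ = H - V⁺`. -/
def Mminus (emb : PlaneEmbedding G) {x : V} (C : G.Walk x x) : Set (Set (ℝ × ℝ)) :=
  {f | MinorFaceOf emb C (drawingOn emb (Hgraph C) ((↑(Vplus emb C) : Set V)ᶜ)) f}

/-- `M⁺`: the minor faces of `H⁺ = H - V⁻`. -/
def Mplus (emb : PlaneEmbedding G) {x : V} (C : G.Walk x x) : Set (Set (ℝ × ℝ)) :=
  {f | MinorFaceOf emb C (drawingOn emb (Hgraph C) ((↑(Vminus emb C) : Set V)ᶜ)) f}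

/-- A minor face of `H`. -/
def MinorFaceH (emb : PlaneEmbedding G) {x : V} (C : G.Walk x x) (f : Set (ℝ × ℝ)) : Prop :=
  MinorFaceOf emb C (drawingH emb C) f

/-- A major face of `H`: a face of `H` that is not minor. -/
def MajorFaceH (emb : PlaneEmbedding G) {x : V} (C : G.Walk x x) (f : Set (ℝ × ℝ)) : Prop :=
  IsFaceOf (drawingH emb C) f ∧ ¬ MinorFaceH emb C f

/-- The number of `C`-edges of a face `f` (so `f` is a `j`-face when this equals `j`). -/
def numCEdges (emb : PlaneEmbedding G) {x : V} (C : G.Walk x x) (f : Set (ℝ × ℝ)) : ℕ :=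
  (C.edges.toFinset.filter fun e => incEdge emb f e).card

/-- `m_{f,f'}`: the number of common `C`-edges of the faces `f` and `f'`. -/
def mEdges (emb : PlaneEmbedding G) {x : V} (C : G.Walk x x)
    (f f' : Set (ℝ × ℝ)) : ℕ :=
  (C.edges.toFinset.filter fun e => incEdge emb f e ∧ incEdge emb f' e).card

/-- `f'` is opposite to `f` (with respect to some `C`-edge incident with both). -/
def OppositeFaces (emb : PlaneEmbedding G) {x : V} (C : G.Walk x x)
    (f f' : Set (ℝ × ℝ)) : Prop :=
  f ≠ f' ∧ ∃ e ∈ C.edges, incEdge emb f e ∧ incEdge emb f' e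

/-- `e` is the middle `C`-edge of the face `f` (for a 3-face, the `C`-edge sharing an
endvertex with every other `C`-edge of `f`). -/
def IsMiddleCEdge (emb : PlaneEmbedding G) {x : V} (C : G.Walk x x)
    (f : Set (ℝ × ℝ)) (e : Sym2 V) : Prop :=
  e ∈ C.edges ∧ incEdge emb f e ∧
    ∀ e' ∈ C.edges, incEdge emb f e' → e' ≠ e → ∃ v : V, v ∈ e ∧ v ∈ e'

/-- The total weight sent from the face `f` to the face `f'` by the discharging rules
R1–R5 (each rule applied exactly once). -/
def sendWeight (emb : PlaneEmbedding G) {x : V} (C : G.Walk x x)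
    (f f' : Set (ℝ × ℝ)) : ℚ :=
  -- R1: a major face sends `m_{f,f'}` to every opposite minor face
  (if MajorFaceH emb C f ∧ MinorFaceH emb C f' ∧ OppositeFaces emb C f f'
    then (mEdges emb C f f' : ℚ) else 0)
  -- R2: a minor face sends `(2/3)·m_{f,f'}` to every opposite minor 2-face
  + (if MinorFaceH emb C f ∧ MinorFaceH emb C f' ∧ numCEdges emb C f' = 2 ∧
        OppositeFaces emb C f f'
    then 2 / 3 * (mEdges emb C f f' : ℚ) else 0)
  -- R3: a minor face sends 1 to every minor 3-face opposite with respect to its middle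
  -- `C`-edge
  + (if MinorFaceH emb C f ∧ MinorFaceH emb C f' ∧ numCEdges emb C f' = 3 ∧ f ≠ f' ∧
        (∃ e : Sym2 V, IsMiddleCEdge emb C f' e ∧ incEdge emb f e)
    then 1 else 0)
  -- R4
  + (if MinorFaceH emb C f ∧ 4 ≤ numCEdges emb C f ∧ MinorFaceH emb C f' ∧
        numCEdges emb C f' = 4 ∧ OppositeFaces emb C f' f ∧ mEdges emb C f' f = 2 ∧
        (∃ f₂ : Set (ℝ × ℝ), MinorFaceH emb C f₂ ∧
          (numCEdges emb C f₂ = 2 ∨ numCEdges emb C f₂ = 3) ∧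
          OppositeFaces emb C f' f₂ ∧ mEdges emb C f' f₂ = 2)
    then 2 / 3 else 0)
  -- R5
  + (if MinorFaceH emb C f ∧ 4 ≤ numCEdges emb C f ∧ MinorFaceH emb C f' ∧
        numCEdges emb C f' = 5 ∧ OppositeFaces emb C f' f ∧ mEdges emb C f' f = 2 ∧
        (∃ g₁ g₂ : Set (ℝ × ℝ), g₁ ≠ g₂ ∧
          MinorFaceH emb C g₁ ∧ numCEdges emb C g₁ = 2 ∧ OppositeFaces emb C f' g₁ ∧
          MinorFaceH emb C g₂ ∧ numCEdges emb C g₂ = 2 ∧ OppositeFaces emb C f' g₂)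
    then 1 / 3 else 0)

/-- The final weight of a face `f` after discharging: the initial charge `j` of a
`j`-face, minus everything sent, plus everything received. -/
def wFace (emb : PlaneEmbedding G) {x : V} (C : G.Walk x x) (f : Set (ℝ × ℝ)) : ℚ :=
  (numCEdges emb C f : ℚ) - (∑ᶠ f' : Set (ℝ × ℝ), sendWeight emb C f f')
    + ∑ᶠ f' : Set (ℝ × ℝ), sendWeight emb C f' f

end PlaneSetup

namespace PlaneTopology

open Set Topology Complex

/-- The map `g` has a continuous logarithm on the set `K`. -/
def HasLog {X : Type*} [TopologicalSpace X] (K : Set X) (g : X → ℂ) : Prop :=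
  ∃ φ : X → ℂ, ContinuousOn φ K ∧ ∀ z ∈ K, exp (φ z) = g z

theorem exists_log_of_simplyConnected {A : Type*} [TopologicalSpace A] [SimplyConnectedSpace A]
    [LocallyPathConnectedSpace A] (g : A → ℂ) (hg : Continuous g) (h0 : ∀ a, g a ≠ 0) :
    ∃ φ : A → ℂ, Continuous φ ∧ ∀ a, exp (φ a) = g a := by
  obtain ⟨a₀⟩ : Nonempty A := inferInstance
  obtain ⟨F, ⟨-, hF⟩, -⟩ := isCoveringMapOn_exp.existsUnique_continuousMap_lifts
    (⟨g, hg⟩ : C(A, ℂ)) (a₀ := a₀) (e₀ := log (g a₀)) (exp_log (h0 a₀)) h0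
  exact ⟨F, F.continuous, fun a => congrFun hF a⟩

theorem log_sub_const {X : Type*} [TopologicalSpace X] {S : Set X} (hS : IsPreconnected S)
    {φ ψ : X → ℂ} (hφ : ContinuousOn φ S) (hψ : ContinuousOn ψ S)
    (h : ∀ z ∈ S, exp (φ z) = exp (ψ z)) {x y : X} (hx : x ∈ S) (hy : y ∈ S) :
    φ x - ψ x = φ y - ψ y := by
  have key : ∀ z ∈ S, ∃ n : ℤ, φ z - ψ z = n * (2 * Real.pi * I) := fun z hz => by
    rw [← exp_eq_one_iff, exp_sub, h z hz, div_self (exp_ne_zero _)]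
  have hd : IsDiscrete (range ((↑) : ℤ → ℝ)) :=
    Int.isClosedEmbedding_coe_real.isInducing.isDiscrete_range
  have hπ : (2 * Real.pi : ℝ) ≠ 0 := by positivity
  have hval : ∀ z ∈ S, ∀ n : ℤ, φ z - ψ z = n * (2 * Real.pi * I) →
      (φ z - ψ z).im / (2 * Real.pi) = n := fun z hz n hn => by
    rw [hn]
    simp only [mul_im, mul_re, intCast_re, intCast_im, I_re, I_im, ofReal_re, ofReal_im,
      re_ofNat, im_ofNat]
    field_simp
    ring
  have hc := hS.constant_of_mapsTo hd (f := fun z => (φ z - ψ z).im / (2 * Real.pi))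
    ((continuous_im.comp_continuousOn (hφ.sub hψ)).div_const _)
    (fun z hz => by
      obtain ⟨n, hn⟩ := key z hz
      exact ⟨n, (hval z hz n hn).symm⟩) hx hy
  obtain ⟨n, hn⟩ := key x hx
  obtain ⟨m, hm⟩ := key y hy
  simp only [hval x hx n hn, hval y hy m hm] at hc
  rw [hn, hm]
  have : n = m := by exact_mod_cast hc
  rw [this]

theorem HasLog.mul {X : Type*} [TopologicalSpace X] {K : Set X} {g h : X → ℂ}
    (hg : HasLog K g) (hh : HasLog K h) : HasLog K (fun z => g z * h z) := by
  obtain ⟨φ, hφ, hφ'⟩ := hg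
  obtain ⟨ψ, hψ, hψ'⟩ := hh
  exact ⟨fun z => φ z + ψ z, hφ.add hψ, fun z hz => by rw [exp_add, hφ' z hz, hψ' z hz]⟩

theorem HasLog.inv {X : Type*} [TopologicalSpace X] {K : Set X} {g : X → ℂ}
    (hg : HasLog K g) : HasLog K (fun z => (g z)⁻¹) := by
  obtain ⟨φ, hφ, hφ'⟩ := hg
  exact ⟨fun z => - φ z, hφ.neg, fun z hz => by rw [exp_neg, hφ' z hz]⟩

theorem HasLog.congr {X : Type*} [TopologicalSpace X] {K : Set X} {g h : X → ℂ}
    (hg : HasLog K g) (hh : ∀ z ∈ K, g z = h z) : HasLog K h := by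
  obtain ⟨φ, hφ, hφ'⟩ := hg
  exact ⟨φ, hφ, fun z hz => (hφ' z hz).trans (hh z hz)⟩

theorem HasLog.mono {X : Type*} [TopologicalSpace X] {K L : Set X} {g : X → ℂ}
    (hg : HasLog K g) (hL : L ⊆ K) : HasLog L g := by
  obtain ⟨φ, hφ, hφ'⟩ := hg
  exact ⟨φ, hφ.mono hL, fun z hz => hφ' z (hL hz)⟩

theorem HasLog.of_slitPlane {X : Type*} [TopologicalSpace X] {K : Set X} {g : X → ℂ}
    (hg : ContinuousOn g K) (h : ∀ z ∈ K, g z ∈ slitPlane) : HasLog K g :=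
  ⟨fun z => log (g z), hg.clog h, fun z hz => exp_log (slitPlane_ne_zero (h z hz))⟩

theorem HasLog.union {X : Type*} [TopologicalSpace X] {A B : Set X} {g : X → ℂ}
    (hA : IsClosed A) (hB : IsClosed B) (hAB : IsPreconnected (A ∩ B))
    (hgA : HasLog A g) (hgB : HasLog B g) : HasLog (A ∪ B) g := by
  obtain ⟨φ, hφ, hφ'⟩ := hgA
  obtain ⟨ψ, hψ, hψ'⟩ := hgB
  obtain ⟨c, hc1, hc⟩ : ∃ c : ℂ, exp c = 1 ∧ ∀ z ∈ A ∩ B, φ z = ψ z + c := by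
    rcases (A ∩ B).eq_empty_or_nonempty with h | ⟨x, hx⟩
    · exact ⟨0, exp_zero, by simp [h]⟩
    · refine ⟨φ x - ψ x, ?_, fun z hz => ?_⟩
      · rw [exp_sub, hφ' x hx.1, hψ' x hx.2, div_self]
        rw [← hφ' x hx.1]; exact exp_ne_zero _
      · have := log_sub_const hAB (hφ.mono inter_subset_left) (hψ.mono inter_subset_right)
          (fun z hz => by rw [hφ' z hz.1, hψ' z hz.2]) hx hz
        rw [this]; ring
  have e2 : ∀ z ∈ B, A.piecewise φ (fun z => ψ z + c) z = ψ z + c := fun z hz => by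
    by_cases h : z ∈ A
    · rw [piecewise_eq_of_mem _ _ _ h, hc z ⟨h, hz⟩]
    · rw [piecewise_eq_of_notMem _ _ _ h]
  have e1 : ∀ z ∈ A, A.piecewise φ (fun z => ψ z + c) z = φ z := fun z hz =>
    piecewise_eq_of_mem _ _ _ hz
  refine ⟨A.piecewise φ (fun z => ψ z + c), ?_, ?_⟩
  · exact ContinuousOn.union_of_isClosed (hφ.congr e1)
      ((hψ.add continuousOn_const).congr e2) hA hB
  · rintro z (hz | hz)
    · rw [e1 z hz, hφ' z hz]
    · rw [e2 z hz, exp_add, hc1, mul_one, hψ' z hz]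

/-- The identification of the plane `ℝ × ℝ` with `ℂ`. -/
def toC (z : ℝ × ℝ) : ℂ := ⟨z.1, z.2⟩

theorem continuous_toC : Continuous toC := equivRealProdCLM.symm.continuous

theorem toC_injective : Function.Injective toC := fun z w h => by
  have := Complex.ext_iff.1 h
  exact Prod.ext this.1 this.2

/-- The function `(z - a) / (z - b)` on the plane. -/
def ratio (a b z : ℝ × ℝ) : ℂ := (toC z - toC a) / (toC z - toC b)

theorem sub_toC_ne_zero {a z : ℝ × ℝ} (h : z ≠ a) : toC z - toC a ≠ 0 :=
  sub_ne_zero.2 fun e => h (toC_injective e)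

theorem ratio_ne_zero {a b z : ℝ × ℝ} (ha : z ≠ a) (hb : z ≠ b) : ratio a b z ≠ 0 :=
  div_ne_zero (sub_toC_ne_zero ha) (sub_toC_ne_zero hb)

theorem continuousOn_ratio {a b : ℝ × ℝ} {S : Set (ℝ × ℝ)} (hb : b ∉ S) :
    ContinuousOn (ratio a b) S :=
  ((continuous_toC.sub continuous_const).continuousOn).div
    ((continuous_toC.sub continuous_const).continuousOn)
    fun _ hz => sub_toC_ne_zero (fun h => hb (h ▸ hz))

theorem hasLog_ratio_of_mem_component {K : Set (ℝ × ℝ)} (hK : IsCompact K) {a b : ℝ × ℝ}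
    {S : Set (ℝ × ℝ)} (hS : IsPreconnected S) (hSK : Disjoint S K) (ha : a ∈ S) (hb : b ∈ S) :
    HasLog K (ratio a b) := by
  have hSK' : ∀ {x}, x ∈ S → x ∉ K := fun hx hk => Set.disjoint_left.1 hSK hx hk
  refine hS.induction₂ (fun a b => HasLog K (ratio a b)) ?_ ?_ ?_ ha hb
  · intro x hx
    obtain ⟨δ, hδ, hδK⟩ : ∃ δ > 0, ∀ z ∈ K, δ ≤ ‖toC z - toC x‖ := by
      rcases K.eq_empty_or_nonempty with h | h
      · exact ⟨1, one_pos, by simp [h]⟩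
      · obtain ⟨z0, hz0, hmin⟩ := hK.exists_isMinOn h
          (f := fun z => ‖toC z - toC x‖) (by
            exact (continuous_toC.sub continuous_const).norm.continuousOn)
        refine ⟨‖toC z0 - toC x‖, ?_, fun z hz => hmin hz⟩
        exact norm_pos_iff.2 (sub_toC_ne_zero fun h => hSK' hx (h ▸ hz0))
    have : ∀ᶠ y in 𝓝 x, ‖toC y - toC x‖ < δ := by
      have hc : Continuous fun y => ‖toC y - toC x‖ :=
        (continuous_toC.sub continuous_const).norm
      exact hc.continuousAt.eventually_lt continuousAt_const (by simpa using hδ)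
    filter_upwards [mem_nhdsWithin_of_mem_nhds this, self_mem_nhdsWithin] with y hy hyS
    refine ((HasLog.of_slitPlane (g := ratio y x) (continuousOn_ratio (hSK' hx)) ?_).inv).congr ?_
    · intro z hz
      have hne : toC z - toC x ≠ 0 := sub_toC_ne_zero fun h => hSK' hx (h ▸ hz)
      have : ratio y x z = 1 + (toC x - toC y) / (toC z - toC x) := by
        unfold ratio; field_simp; ring
      rw [this]
      refine mem_slitPlane_of_norm_lt_one ?_
      rw [norm_div, div_lt_one (norm_pos_iff.2 hne), norm_sub_rev]
      exact hy.trans_le (hδK z hz)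
    · intro z hz
      simp [ratio]
  · intro x y z hx hy hz h1 h2
    refine (h1.mul h2).congr fun w hw => ?_
    have : toC w - toC y ≠ 0 := sub_toC_ne_zero fun h => hSK' hy (h ▸ hw)
    have : toC w - toC z ≠ 0 := sub_toC_ne_zero fun h => hSK' hz (h ▸ hw)
    unfold ratio; field_simp
  · intro x y hx hy h
    exact h.inv.congr fun z hz => by simp [ratio]

/-- Exponential polar coordinates around `b`. -/
def expPolar (b : ℝ × ℝ) (w : ℂ) : ℝ × ℝ := (b.1 + (exp w).re, b.2 + (exp w).im)

theorem continuous_expPolar (b : ℝ × ℝ) : Continuous (expPolar b) := by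
  unfold expPolar; fun_prop

theorem toC_expPolar (b : ℝ × ℝ) (w : ℂ) : toC (expPolar b w) = toC b + exp w := by
  apply Complex.ext <;> simp [toC, expPolar]

theorem expPolar_ne (b : ℝ × ℝ) (w : ℂ) : expPolar b w ≠ b := fun h => by
  have := toC_expPolar b w
  rw [h] at this
  exact exp_ne_zero w (left_eq_add.1 this)

theorem frontier_component_subset {K : Set (ℝ × ℝ)} (hK : IsClosed K) (a : ℝ × ℝ) :
    frontier (connectedComponentIn Kᶜ a) ⊆ K := by
  intro x hx
  by_contra hxK
  have ho : ∀ y, IsOpen (connectedComponentIn Kᶜ y) := fun y => hK.isOpen_compl.connectedComponentIn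
  have hxx : x ∈ connectedComponentIn Kᶜ x := mem_connectedComponentIn hxK
  obtain ⟨y, hy1, hy2⟩ := mem_closure_iff.1 hx.1 _ (ho x) hxx
  have : connectedComponentIn Kᶜ a = connectedComponentIn Kᶜ x :=
    (connectedComponentIn_eq hy2).trans (connectedComponentIn_eq hy1).symm
  rw [(ho a).frontier_eq] at hx
  exact hx.2 (this ▸ hxx)

theorem ball_of_compl_closed {K : Set (ℝ × ℝ)} (hK : IsClosed K) {b : ℝ × ℝ} (hb : b ∉ K) :
    ∃ ε > 0, ∀ z, ‖toC z - toC b‖ ≤ ε → z ∉ K := by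
  obtain ⟨δ, hδ, hsub⟩ := Metric.mem_nhds_iff.1 (hK.isOpen_compl.mem_nhds hb)
  refine ⟨δ / 2, by positivity, fun z hz => hsub ?_⟩
  rw [Metric.mem_ball, Prod.dist_eq, max_lt_iff, Real.dist_eq, Real.dist_eq]
  have h1 := (abs_re_le_norm (toC z - toC b)).trans hz
  have h2 := (abs_im_le_norm (toC z - toC b)).trans hz
  simp only [toC, sub_re, sub_im] at h1 h2
  constructor <;> linarith

theorem exists_far {U : Set (ℝ × ℝ)} (hU : Bornology.IsBounded U) (b : ℝ × ℝ) :
    ∃ R : ℝ, 0 < R ∧ ∀ z, R ≤ ‖toC z - toC b‖ → z ∉ U := by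
  obtain ⟨R, hR⟩ := hU.isCompact_closure.bddAbove_image (f := fun z => ‖toC z - toC b‖)
    ((continuous_toC.sub continuous_const).norm.continuousOn)
  refine ⟨max R 0 + 1, by positivity, fun z hz hzU => ?_⟩
  have := hR ⟨z, subset_closure hzU, rfl⟩
  simp only at this
  linarith [le_max_left R 0]

theorem isPreconnected_vertical (s : ℝ) : IsPreconnected {w : ℂ | w.re = s} := by
  have : {w : ℂ | w.re = s} = (fun t : ℝ => (s + t * I : ℂ)) '' univ := by
    ext w
    simp only [image_univ, mem_range]
    constructor
    · intro h
      have h : w.re = s := h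
      exact ⟨w.im, by rw [← h]; exact re_add_im w⟩
    · rintro ⟨t, rfl⟩
      change (_ : ℂ).re = s
      simp
  rw [this]
  exact isPreconnected_univ.image _ (by fun_prop)

/-- If `(z - x) ^ n * G z`, with `G` continuous and nowhere zero on the closure of a bounded
open set `U` around `x`, has a logarithm on the boundary of `U`, then `n = 0`. -/
theorem zpow_eq_zero_of_hasLog {U : Set (ℝ × ℝ)} (hU : IsOpen U)
    (hUb : Bornology.IsBounded U) {x : ℝ × ℝ} (hx : x ∈ U) (n : ℤ) (G : ℝ × ℝ → ℂ)
    (hG : ContinuousOn G (closure U)) (hG0 : ∀ z ∈ closure U, G z ≠ 0)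
    (hlog : HasLog (frontier U) fun z => (toC z - toC x) ^ n * G z) : n = 0 := by
  obtain ⟨φ, hφ, hφ'⟩ := hlog
  obtain ⟨Φ, hΦ⟩ := ContinuousMap.exists_restrict_eq isClosed_frontier
    ⟨(frontier U).domRestrict φ, hφ.domRestrict⟩
  have hΦ' : ∀ z ∈ frontier U, Φ z = φ z := fun z hz => DFunLike.congr_fun hΦ ⟨z, hz⟩
  set F : ℝ × ℝ → ℂ := fun z => (toC z - toC x) ^ n * G z with hF
  set h : ℝ × ℝ → ℂ := fun z => if z ∈ U then F z else exp (Φ z) with hh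
  obtain ⟨ε, hε, hεb⟩ := ball_of_compl_closed hU.isClosed_compl (b := x) (fun h => h hx)
  obtain ⟨R, hRpos, hR⟩ := exists_far hUb x
  have hxx : ∀ z, z ∈ closure U ∩ {x}ᶜ → toC z - toC x ≠ 0 := fun z hz =>
    sub_toC_ne_zero hz.2
  have hc : ContinuousOn h {x}ᶜ := by
    refine ContinuousOn.if ?_ ?_ ?_
    · rintro z ⟨-, hz⟩
      have hz : z ∈ frontier U := hz
      rw [hΦ' z hz, hφ' z hz]
    · refine ContinuousOn.mul (ContinuousOn.zpow₀
        ((continuous_toC.sub continuous_const).continuousOn) n fun z hz => Or.inl ?_)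
        (hG.mono fun z hz => hz.2)
      exact sub_toC_ne_zero hz.1
    · exact (continuous_exp.comp Φ.continuous).continuousOn
  have h0 : ∀ z, z ≠ x → h z ≠ 0 := fun z hz => by
    by_cases hzU : z ∈ U
    · simp only [hh, if_pos hzU]
      exact mul_ne_zero (zpow_ne_zero _ (sub_toC_ne_zero hz)) (hG0 z (subset_closure hzU))
    · simp only [hh, if_neg hzU]
      exact exp_ne_zero _
  obtain ⟨L, hL, hL'⟩ := exists_log_of_simplyConnected (fun w => h (expPolar x w))
    (hc.comp_continuous (continuous_expPolar x) fun w => expPolar_ne x w)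
    (fun w => h0 _ (expPolar_ne x w))
  have hnorm : ∀ w, ‖toC (expPolar x w) - toC x‖ = Real.exp w.re := fun w => by
    rw [toC_expPolar, add_sub_cancel_left, norm_exp]
  have hexp : ∀ w : ℂ, exp (w + 2 * Real.pi * I) = exp w := exp_periodic
  have hper : ∀ w : ℂ, expPolar x (w + 2 * Real.pi * I) = expPolar x w := fun w => by
    rw [expPolar, expPolar, hexp]
  have hconst : ∀ w w' : ℂ, L (w + 2 * Real.pi * I) - L w = L (w' + 2 * Real.pi * I) - L w' :=
    fun w w' => log_sub_const (S := univ) isPreconnected_univ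
      (φ := fun w => L (w + 2 * Real.pi * I)) (by fun_prop) (by fun_prop)
      (fun z _ => by rw [hL', hL', hper]) trivial trivial
  have hre : ∀ s : ℝ, ((s : ℂ) + 2 * Real.pi * I).re = s := fun s => by simp
  have hGx : G x ≠ 0 := hG0 x (subset_closure hx)
  obtain ⟨ε', hε', hball⟩ : ∃ ε' > 0, ∀ z, ‖toC z - toC x‖ ≤ ε' → G z / G x ∈ slitPlane := by
    have hcont : ContinuousAt (fun z => G z / G x) x :=
      ((hG.mono subset_closure).continuousAt (hU.mem_nhds hx)).div_const _
    have hnb : ∀ᶠ z in 𝓝 x, G z / G x ∈ slitPlane := by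
      refine hcont.eventually_mem (isOpen_slitPlane.mem_nhds ?_)
      rw [div_self hGx]
      exact one_mem_slitPlane
    obtain ⟨W, hW, hWo, hxW⟩ := eventually_nhds_iff.1 hnb
    obtain ⟨ε', hε', hb⟩ := ball_of_compl_closed hWo.isClosed_compl (b := x) (fun h => h hxW)
    exact ⟨ε', hε', fun z hz => hW z (not_not.1 (hb z hz))⟩
  set s := Real.log (min ε ε') with hs
  have hse : Real.exp s = min ε ε' := Real.exp_log (lt_min hε hε')
  have hsU : ∀ w : ℂ, w.re = s → expPolar x w ∈ U := fun w hw =>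
    not_not.1 (hεb _ (by rw [hnorm, hw, hse]; exact min_le_left _ _))
  have hsG : ∀ w : ℂ, w.re = s → G (expPolar x w) / G x ∈ slitPlane := fun w hw =>
    hball _ (by rw [hnorm, hw, hse]; exact min_le_right _ _)
  have e1 := log_sub_const (isPreconnected_vertical s) (φ := L)
    (ψ := fun w => n * w + log (G (expPolar x w) / G x) + log (G x)) hL.continuousOn
    (((by fun_prop : Continuous fun w : ℂ => n * w).continuousOn.add
      (ContinuousOn.clog (((hG.comp (continuous_expPolar x).continuousOn)
        fun w hw => subset_closure (hsU w hw)).div_const _) hsG)).add continuousOn_const)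
    (fun w hw => by
      have : h (expPolar x w) = F (expPolar x w) := if_pos (hsU w hw)
      rw [hL', this, exp_add, exp_add, exp_log (slitPlane_ne_zero (hsG w hw)), exp_log hGx, hF]
      simp only [toC_expPolar, add_sub_cancel_left]
      rw [exp_int_mul]
      field_simp) (x := s) (y := s + 2 * Real.pi * I) (by change (_ : ℂ).re = s; simp) (hre s)
  set t := Real.log R with ht
  have e2 := log_sub_const (isPreconnected_vertical t) (φ := L)
    (ψ := fun w => Φ (expPolar x w)) hL.continuousOn
    (Φ.continuous.comp (continuous_expPolar x)).continuousOn
    (fun w hw => by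
      have hw : w.re = t := hw
      have : h (expPolar x w) = exp (Φ (expPolar x w)) := if_neg (hR _ (by
        rw [hnorm, hw, ht, Real.exp_log hRpos]))
      rw [hL', this]) (x := t) (y := t + 2 * Real.pi * I) (by change (_ : ℂ).re = t; simp) (hre t)
  simp only [hper] at e1 e2
  have e3 := hconst s t
  have : (n : ℂ) * (2 * Real.pi * I) = 0 := by linear_combination e1 - e2 + e3
  exact_mod_cast (mul_eq_zero.1 this).resolve_right two_pi_I_ne_zero

theorem not_hasLog_ratio {K U : Set (ℝ × ℝ)} (hU : IsOpen U)
    (hUK : frontier U ⊆ K) (hUb : Bornology.IsBounded U) {a b : ℝ × ℝ} (haU : a ∈ U)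
    (hbU : b ∉ closure U) (hlog : HasLog K (ratio a b)) : False := by
  have hne : ∀ z ∈ closure U, toC z - toC b ≠ 0 := fun z hz =>
    sub_toC_ne_zero fun h => hbU (h ▸ hz)
  refine one_ne_zero (zpow_eq_zero_of_hasLog hU hUb haU 1 (fun z => (toC z - toC b)⁻¹)
    (((continuous_toC.sub continuous_const).continuousOn).inv₀ hne)
    (fun z hz => inv_ne_zero (hne z hz)) ((hlog.mono hUK).congr fun z hz => ?_))
  rw [zpow_one, ratio, div_eq_mul_inv]

theorem exists_unbounded_region {K : Set (ℝ × ℝ)} (hK : IsCompact K) :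
    ∃ E : Set (ℝ × ℝ), IsPreconnected E ∧ E ⊆ Kᶜ ∧ Bornology.IsBounded Eᶜ := by
  obtain ⟨R, hR⟩ := hK.bddAbove_image (f := fun z => ‖toC z - toC 0‖)
    ((continuous_toC.sub continuous_const).norm.continuousOn)
  set R' := max R 1
  have hpos : 0 < R' := lt_max_of_lt_right one_pos
  refine ⟨expPolar 0 '' {w : ℂ | Real.log R' < w.re}, ?_, ?_, ?_⟩
  · refine IsPreconnected.image ?_ _ (continuous_expPolar 0).continuousOn
    exact (convex_halfSpace_re_gt _).isPreconnected
  · rintro _ ⟨w, hw, rfl⟩ hwK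
    have h1 : ‖toC (expPolar 0 w) - toC 0‖ ≤ R := hR ⟨_, hwK, rfl⟩
    rw [toC_expPolar, add_sub_cancel_left, norm_exp] at h1
    have h2 : R' < Real.exp w.re := (Real.log_lt_iff_lt_exp hpos).1 hw
    exact absurd (h1.trans (le_max_left R 1)) (not_le.2 h2)
  · rw [Metric.isBounded_iff_subset_closedBall 0]
    refine ⟨R', fun z hz => ?_⟩
    rw [mem_closedBall_zero_iff, Prod.norm_def]
    by_contra hlt
    refine hz ⟨log (toC z), ?_, ?_⟩
    · have hn : R' < ‖toC z‖ := by
        refine (not_le.1 hlt).trans_le (max_le ?_ ?_)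
        · exact abs_re_le_norm (toC z)
        · exact abs_im_le_norm (toC z)
      simpa [log_re] using Real.log_lt_log hpos hn
    · have hne : toC z ≠ 0 := fun h0 => hlt (by
        have := toC_injective (h0.trans (show (0 : ℂ) = toC 0 from rfl))
        rw [this]; simpa using hpos.le)
      apply Prod.ext <;> simp [expPolar, exp_log hne] <;> rfl

theorem mem_component_of_hasLog {K : Set (ℝ × ℝ)} (hK : IsCompact K) {a b : ℝ × ℝ}
    (ha : a ∉ K) (hb : b ∉ K) (hlog : HasLog K (ratio a b)) :
    connectedComponentIn Kᶜ a = connectedComponentIn Kᶜ b := by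
  by_contra hne
  have ho : ∀ y, IsOpen (connectedComponentIn Kᶜ y) := fun y =>
    hK.isClosed.isOpen_compl.connectedComponentIn
  have hdis : Disjoint (connectedComponentIn Kᶜ a) (connectedComponentIn Kᶜ b) :=
    Set.disjoint_left.2 fun x h1 h2 =>
      hne ((connectedComponentIn_eq h1).trans (connectedComponentIn_eq h2).symm)
  have haa : a ∈ connectedComponentIn Kᶜ a := mem_connectedComponentIn ha
  have hbb : b ∈ connectedComponentIn Kᶜ b := mem_connectedComponentIn hb
  have h1 : b ∉ closure (connectedComponentIn Kᶜ a) := fun h =>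
    Set.disjoint_left.1 (hdis.closure_left (ho b)) h hbb
  have h2 : a ∉ closure (connectedComponentIn Kᶜ b) := fun h =>
    Set.disjoint_left.1 (hdis.symm.closure_left (ho a)) h haa
  by_cases hUb : Bornology.IsBounded (connectedComponentIn Kᶜ a)
  · exact not_hasLog_ratio (ho a) (frontier_component_subset hK.isClosed a) hUb haa h1 hlog
  by_cases hWb : Bornology.IsBounded (connectedComponentIn Kᶜ b)
  · exact not_hasLog_ratio (ho b) (frontier_component_subset hK.isClosed b) hWb hbb h2
      (hlog.inv.congr fun z _ => by simp [ratio])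
  obtain ⟨E, hE, hEK, hEb⟩ := exists_unbounded_region hK
  obtain ⟨x, hx, hxE⟩ : ∃ x ∈ connectedComponentIn Kᶜ a, x ∈ E := by
    by_contra! h
    exact hUb (hEb.subset h)
  obtain ⟨y, hy, hyE⟩ : ∃ x ∈ connectedComponentIn Kᶜ b, x ∈ E := by
    by_contra! h
    exact hWb (hEb.subset h)
  have := hE.subset_connectedComponentIn hxE hEK hyE
  exact hne (((connectedComponentIn_eq hx).trans (connectedComponentIn_eq this)).trans
    (connectedComponentIn_eq hy).symm)

/-- Janiszewski's theorem. -/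
theorem component_eq_union {A B : Set (ℝ × ℝ)} (hA : IsCompact A) (hB : IsCompact B)
    (hAB : IsPreconnected (A ∩ B)) {a b : ℝ × ℝ}
    {S T : Set (ℝ × ℝ)} (hS : IsPreconnected S) (hSA : Disjoint S A) (haS : a ∈ S) (hbS : b ∈ S)
    (hT : IsPreconnected T) (hTB : Disjoint T B) (haT : a ∈ T) (hbT : b ∈ T) :
    connectedComponentIn (A ∪ B)ᶜ a = connectedComponentIn (A ∪ B)ᶜ b := by
  have h1 := hasLog_ratio_of_mem_component hA hS hSA haS hbS
  have h2 := hasLog_ratio_of_mem_component hB hT hTB haT hbT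
  refine mem_component_of_hasLog (hA.union hB) ?_ ?_
    (HasLog.union hA.isClosed hB.isClosed hAB h1 h2)
  · rintro (h | h)
    exacts [Set.disjoint_left.1 hSA haS h, Set.disjoint_left.1 hTB haT h]
  · rintro (h | h)
    exacts [Set.disjoint_left.1 hSA hbS h, Set.disjoint_left.1 hTB hbT h]

/-- `S` is a simple arc with endpoints `p` and `q`. -/
def IsArc (S : Set (ℝ × ℝ)) (p q : ℝ × ℝ) : Prop :=
  ∃ γ : ℝ → ℝ × ℝ, ContinuousOn γ (Icc 0 1) ∧ InjOn γ (Icc 0 1) ∧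
    γ 0 = p ∧ γ 1 = q ∧ γ '' Icc 0 1 = S

theorem isArc_image {γ : ℝ → ℝ × ℝ} {a b : ℝ} (hab : a < b) (hc : ContinuousOn γ (Icc a b))
    (hi : InjOn γ (Icc a b)) : IsArc (γ '' Icc a b) (γ a) (γ b) := by
  have hba : 0 < b - a := sub_pos.2 hab
  have hm : ∀ t ∈ Icc (0 : ℝ) 1, (b - a) * t + a ∈ Icc a b := fun t ht =>
    ⟨by nlinarith [ht.1], by nlinarith [ht.2]⟩
  refine ⟨fun t => γ ((b - a) * t + a), ?_, ?_, by simp, by simp, ?_⟩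
  · exact hc.comp (by fun_prop) hm
  · intro s hs t ht h
    have := hi (hm s hs) (hm t ht) h
    exact mul_left_cancel₀ hba.ne' (by linarith)
  · have : (fun t => (b - a) * t + a) '' Icc (0 : ℝ) 1 = Icc a b := by
      rw [image_affine_Icc' hba]; simp
    rw [← this, image_image]

theorem IsArc.symm {S : Set (ℝ × ℝ)} {p q : ℝ × ℝ} (h : IsArc S p q) : IsArc S q p := by
  obtain ⟨γ, hc, hi, h0, h1, hS⟩ := h
  have hm : ∀ t ∈ Icc (0 : ℝ) 1, 1 - t ∈ Icc (0 : ℝ) 1 := fun t ht =>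
    ⟨by linarith [ht.2], by linarith [ht.1]⟩
  refine ⟨fun t => γ (1 - t), hc.comp (by fun_prop) hm, ?_, by simpa, by simpa, ?_⟩
  · intro s hs t ht h
    have := hi (hm s hs) (hm t ht) h
    linarith
  · rw [← hS]
    have : (fun t => 1 - t) '' Icc (0 : ℝ) 1 = Icc 0 1 := by simp
    conv_rhs => rw [← this, image_image]

theorem IsArc.isCompact {S : Set (ℝ × ℝ)} {p q : ℝ × ℝ} (h : IsArc S p q) : IsCompact S := by
  obtain ⟨γ, hc, -, -, -, rfl⟩ := h
  exact isCompact_Icc.image_of_continuousOn hc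

theorem IsArc.isPreconnected {S : Set (ℝ × ℝ)} {p q : ℝ × ℝ} (h : IsArc S p q) :
    IsPreconnected S := by
  obtain ⟨γ, hc, -, -, -, rfl⟩ := h
  exact isPreconnected_Icc.image _ hc

theorem IsArc.left_mem {S : Set (ℝ × ℝ)} {p q : ℝ × ℝ} (h : IsArc S p q) : p ∈ S := by
  obtain ⟨γ, hc, -, rfl, -, rfl⟩ := h
  exact mem_image_of_mem _ (by simp)

theorem IsArc.right_mem {S : Set (ℝ × ℝ)} {p q : ℝ × ℝ} (h : IsArc S p q) : q ∈ S :=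
  h.symm.left_mem

theorem IsArc.ne {S : Set (ℝ × ℝ)} {p q : ℝ × ℝ} (h : IsArc S p q) : p ≠ q := by
  obtain ⟨γ, hc, hi, rfl, rfl, rfl⟩ := h
  intro h
  exact zero_ne_one (hi (by simp) (by simp) h)

theorem IsArc.hasLog {S : Set (ℝ × ℝ)} {p q : ℝ × ℝ} (h : IsArc S p q) {g : ℝ × ℝ → ℂ}
    (hg : ContinuousOn g S) (h0 : ∀ z ∈ S, g z ≠ 0) : HasLog S g := by
  obtain ⟨γ, hc, hi, -, -, rfl⟩ := h
  have hpc : Continuous fun t : ℝ => (projIcc (0 : ℝ) 1 zero_le_one t : ℝ) :=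
    continuous_subtype_val.comp continuous_projIcc
  have hpm : ∀ t : ℝ, (projIcc (0 : ℝ) 1 zero_le_one t : ℝ) ∈ Icc (0 : ℝ) 1 := fun t =>
    (projIcc (0 : ℝ) 1 zero_le_one t).2
  obtain ⟨L, hL, hL'⟩ := exists_log_of_simplyConnected
    (fun t : ℝ => g (γ (projIcc (0 : ℝ) 1 zero_le_one t)))
    (hg.comp_continuous (hc.comp_continuous hpc hpm) fun t => mem_image_of_mem _ (hpm t))
    (fun t => h0 _ (mem_image_of_mem _ (hpm t)))
  refine ⟨fun z => L (Function.invFunOn γ (Icc 0 1) z), ?_, ?_⟩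
  · refine hL.comp_continuousOn ?_
    rw [continuousOn_iff_isClosed]
    intro t ht
    refine ⟨γ '' (Icc 0 1 ∩ t), ?_, ?_⟩
    · exact ((isCompact_Icc.inter_right ht).image_of_continuousOn
        (hc.mono inter_subset_left)).isClosed
    · ext z
      constructor
      · rintro ⟨hz, s, hs, rfl⟩
        rw [mem_preimage, hi.leftInvOn_invFunOn hs] at hz
        exact ⟨⟨s, ⟨hs, hz⟩, rfl⟩, ⟨s, hs, rfl⟩⟩
      · rintro ⟨⟨s, ⟨hs, hst⟩, rfl⟩, -⟩
        refine ⟨?_, ⟨s, hs, rfl⟩⟩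
        rw [mem_preimage, hi.leftInvOn_invFunOn hs]
        exact hst
  · rintro _ ⟨s, hs, rfl⟩
    simp only
    rw [hi.leftInvOn_invFunOn hs, hL', projIcc_of_mem _ hs]

theorem IsArc.split {S : Set (ℝ × ℝ)} {p q r : ℝ × ℝ} (h : IsArc S p q) (hr : r ∈ S)
    (hp : r ≠ p) (hq : r ≠ q) :
    ∃ A B, IsArc A p r ∧ IsArc B r q ∧ A ∪ B = S ∧ A ∩ B = {r} := by
  obtain ⟨γ, hc, hi, rfl, rfl, rfl⟩ := h
  obtain ⟨t, ht, rfl⟩ := hr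
  have h0 : 0 < t := lt_of_le_of_ne ht.1 fun h => hp (by rw [← h])
  have h1 : t < 1 := lt_of_le_of_ne ht.2 fun h => hq (by rw [← h])
  have s1 : Icc 0 t ⊆ Icc (0 : ℝ) 1 := Icc_subset_Icc_right h1.le
  have s2 : Icc t 1 ⊆ Icc (0 : ℝ) 1 := Icc_subset_Icc_left h0.le
  refine ⟨_, _, isArc_image h0 (hc.mono s1) (hi.mono s1), isArc_image h1 (hc.mono s2) (hi.mono s2),
    ?_, ?_⟩
  · rw [← image_union, Icc_union_Icc_eq_Icc h0.le h1.le]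
  · rw [← hi.image_inter s1 s2, Icc_inter_Icc_eq_singleton h0.le h1.le, image_singleton]

theorem IsArc.trans {S T : Set (ℝ × ℝ)} {p q r : ℝ × ℝ} (hS : IsArc S p r) (hT : IsArc T r q)
    (h : S ∩ T ⊆ {r}) : IsArc (S ∪ T) p q := by
  obtain ⟨γ, hc, hi, rfl, rfl, rfl⟩ := hS
  obtain ⟨δ, hc', hi', h0, rfl, rfl⟩ := hT
  set η : ℝ → ℝ × ℝ := fun t => if t ≤ 1 then γ t else δ (t - 1) with hη
  have e1 : ∀ t ∈ Icc (0 : ℝ) 1, η t = γ t := fun t ht => if_pos ht.2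
  have e2 : ∀ t ∈ Icc (1 : ℝ) 2, η t = δ (t - 1) := fun t ht => by
    rcases ht.1.eq_or_lt with rfl | h
    · simp only [hη, le_refl, if_true, sub_self, h0]
    · exact if_neg (not_le.2 h)
  have hm : ∀ t ∈ Icc (1 : ℝ) 2, t - 1 ∈ Icc (0 : ℝ) 1 := fun t ht =>
    ⟨by linarith [ht.1], by linarith [ht.2]⟩
  have hu : Icc (0 : ℝ) 2 = Icc 0 1 ∪ Icc 1 2 :=
    (Icc_union_Icc_eq_Icc zero_le_one one_le_two).symm
  have key := isArc_image (γ := η) (a := 0) (b := 2) two_pos ?_ ?_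
  · convert key using 1
    · rw [hu, image_union, EqOn.image_eq e1, EqOn.image_eq e2]
      congr 1
      rw [← image_image δ (fun t => t - 1), image_sub_const_Icc]
      norm_num
    · rw [e1 0 (by simp)]
    · rw [e2 2 (by simp)]; norm_num
  · rw [hu]
    exact (hc.congr e1).union_of_isClosed ((hc'.comp (by fun_prop) hm).congr e2)
      isClosed_Icc isClosed_Icc
  · have cross : ∀ s ∈ Icc (0 : ℝ) 1, ∀ t ∈ Icc (1 : ℝ) 2, γ s = δ (t - 1) → s = t := by
      intro s hs t ht hst
      have : γ s = γ 1 := h ⟨mem_image_of_mem _ hs, hst ▸ mem_image_of_mem _ (hm t ht)⟩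
      have hs1 := hi hs (by simp) this
      have := hi' (hm t ht) (by simp) (hst.symm.trans (this.trans h0.symm))
      linarith
    rw [hu]
    rintro s (hs | hs) t (ht | ht) hst
    · exact hi hs ht (by rwa [e1 s hs, e1 t ht] at hst)
    · exact cross s hs t ht (by rwa [e1 s hs, e2 t ht] at hst)
    · exact (cross t ht s hs (by rw [e1 t ht, e2 s hs] at hst; exact hst.symm)).symm
    · have := hi' (hm s hs) (hm t ht) (by rwa [e2 s hs, e2 t ht] at hst)
      linarith

theorem IsArc.isPreconnected_diff {S : Set (ℝ × ℝ)} {p q : ℝ × ℝ} (h : IsArc S p q) :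
    IsPreconnected (S \ {p, q}) := by
  obtain ⟨γ, hc, hi, rfl, rfl, rfl⟩ := h
  have : γ '' Icc 0 1 \ {γ 0, γ 1} = γ '' Ioo 0 1 := by
    rw [← image_pair, ← hi.image_sdiff_subset (by rintro x (rfl | rfl) <;> simp)]
    congr 1
    exact Icc_sdiff_both
  rw [this]
  exact isPreconnected_Ioo.image _ (hc.mono Ioo_subset_Icc_self)

theorem IsArc.closure_diff {S : Set (ℝ × ℝ)} {p q : ℝ × ℝ} (h : IsArc S p q) :
    closure (S \ {p, q}) = S := by
  refine subset_antisymm (closure_minimal sdiff_subset h.isCompact.isClosed) ?_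
  obtain ⟨γ, hc, hi, rfl, rfl, rfl⟩ := h
  have : γ '' Icc 0 1 \ {γ 0, γ 1} = γ '' Ioo 0 1 := by
    rw [← image_pair, ← hi.image_sdiff_subset (by rintro x (rfl | rfl) <;> simp)]
    congr 1
    exact Icc_sdiff_both
  rw [this]
  have h2 : Icc (0 : ℝ) 1 = closure (Ioo 0 1) := (closure_Ioo zero_ne_one).symm
  rw [h2] at hc ⊢
  exact hc.image_closure

theorem IsArc.nonempty_diff {S : Set (ℝ × ℝ)} {p q : ℝ × ℝ} (h : IsArc S p q) :
    (S \ {p, q}).Nonempty := by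
  by_contra hne
  have := h.closure_diff
  rw [not_nonempty_iff_eq_empty.1 hne, closure_empty] at this
  have hp := h.left_mem
  rw [← this] at hp
  exact hp

/-- Cutting off a small piece of an arc at its first endpoint. -/
theorem IsArc.exists_subarc {S : Set (ℝ × ℝ)} {p q : ℝ × ℝ} (h : IsArc S p q)
    {N : Set (ℝ × ℝ)} (hN : N ∈ 𝓝 p) :
    ∃ p' S', IsArc S' p' q ∧ S' ⊆ S ∧ S \ S' ⊆ N ∧ p ∉ S' := by
  obtain ⟨γ, hc, hi, rfl, rfl, rfl⟩ := h
  have h0 : γ ⁻¹' N ∈ 𝓝[Icc 0 1] 0 := hc 0 (by simp) hN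
  obtain ⟨ε, hε, hb⟩ := Metric.mem_nhdsWithin_iff.1 h0
  set t := min (ε / 2) (1 / 2)
  have ht0 : 0 < t := lt_min (by positivity) (by norm_num)
  have ht1 : t < 1 := (min_le_right _ _).trans_lt (by norm_num)
  have s2 : Icc t 1 ⊆ Icc (0 : ℝ) 1 := Icc_subset_Icc_left ht0.le
  refine ⟨_, _, isArc_image ht1 (hc.mono s2) (hi.mono s2), image_mono s2, ?_, ?_⟩
  · rintro _ ⟨⟨s, hs, rfl⟩, hs'⟩
    have hst : s < t := by
      by_contra hlt
      exact hs' ⟨s, ⟨not_lt.1 hlt, hs.2⟩, rfl⟩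
    refine hb ⟨?_, hs⟩
    rw [Metric.mem_ball, Real.dist_eq, sub_zero, abs_of_nonneg hs.1]
    exact (hst.trans_le (min_le_left _ _)).trans_le (by linarith)
  · rintro ⟨s, hs, hs'⟩
    have := hi (s2 hs) (by simp) hs'
    linarith [hs.1]

theorem IsFaceOf.isOpen {D f : Set (ℝ × ℝ)} (hD : IsClosed D) (hf : IsFaceOf D f) : IsOpen f := by
  obtain ⟨z, -, rfl⟩ := hf
  exact hD.isOpen_compl.connectedComponentIn

theorem IsFaceOf.subset_compl {D f : Set (ℝ × ℝ)} (hf : IsFaceOf D f) : f ⊆ Dᶜ := by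
  obtain ⟨z, -, rfl⟩ := hf
  exact connectedComponentIn_subset _ _

theorem IsFaceOf.isPreconnected {D f : Set (ℝ × ℝ)} (hf : IsFaceOf D f) : IsPreconnected f := by
  obtain ⟨z, -, rfl⟩ := hf
  exact isPreconnected_connectedComponentIn

theorem IsFaceOf.nonempty {D f : Set (ℝ × ℝ)} (hf : IsFaceOf D f) : f.Nonempty := by
  obtain ⟨z, hz, rfl⟩ := hf
  exact ⟨z, mem_connectedComponentIn hz⟩

theorem IsFaceOf.frontier_subset {D f : Set (ℝ × ℝ)} (hD : IsClosed D) (hf : IsFaceOf D f) :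
    frontier f ⊆ D := by
  obtain ⟨z, -, rfl⟩ := hf
  exact frontier_component_subset hD z

theorem IsFaceOf.closure_eq {D f : Set (ℝ × ℝ)} (hD : IsClosed D) (hf : IsFaceOf D f) :
    closure f = f ∪ frontier f := by
  rw [(IsFaceOf.isOpen hD hf).frontier_eq, union_sdiff_cancel subset_closure]

theorem IsFaceOf.subset_of_inter {D f S : Set (ℝ × ℝ)} (hf : IsFaceOf D f)
    (hS : IsPreconnected S) (hSD : S ⊆ Dᶜ) (h : (S ∩ f).Nonempty) : S ⊆ f := by
  obtain ⟨z, -, rfl⟩ := hf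
  obtain ⟨y, hyS, hy⟩ := h
  rw [connectedComponentIn_eq hy]
  exact hS.subset_connectedComponentIn hyS hSD

theorem IsFaceOf.eq_of_inter {D f g : Set (ℝ × ℝ)} (hf : IsFaceOf D f) (hg : IsFaceOf D g)
    (h : (f ∩ g).Nonempty) : f = g :=
  subset_antisymm (IsFaceOf.subset_of_inter hg (IsFaceOf.isPreconnected hf)
    (IsFaceOf.subset_compl hf) h)
    (IsFaceOf.subset_of_inter hf (IsFaceOf.isPreconnected hg) (IsFaceOf.subset_compl hg)
      (by rwa [inter_comm]))

theorem exists_face {D S : Set (ℝ × ℝ)} (hS : IsPreconnected S) (hne : S.Nonempty)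
    (hSD : S ⊆ Dᶜ) : ∃ f, IsFaceOf D f ∧ S ⊆ f := by
  obtain ⟨z, hz⟩ := hne
  exact ⟨_, ⟨z, hSD hz, rfl⟩, hS.subset_connectedComponentIn hz hSD⟩

theorem IsFaceOf.eq_of_unbounded {D f g : Set (ℝ × ℝ)} (hD : IsCompact D) (hf : IsFaceOf D f)
    (hg : IsFaceOf D g) (hfb : ¬ Bornology.IsBounded f) (hgb : ¬ Bornology.IsBounded g) :
    f = g := by
  obtain ⟨E, hE, hED, hEb⟩ := exists_unbounded_region hD
  have key : ∀ f : Set (ℝ × ℝ), IsFaceOf D f → ¬ Bornology.IsBounded f → E ⊆ f := by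
    intro f hf hfb
    refine IsFaceOf.subset_of_inter hf hE hED ?_
    by_contra h
    exact hfb (hEb.subset fun x hx hxE => h ⟨x, hxE, hx⟩)
  refine IsFaceOf.eq_of_inter hf hg ?_
  obtain ⟨x, hx⟩ : E.Nonempty := by
    by_contra h
    rw [not_nonempty_iff_eq_empty.1 h, compl_empty] at hEb
    exact hfb (hEb.subset (subset_univ _))
  exact ⟨x, key f hf hfb hx, key g hg hgb hx⟩

theorem exists_unbounded_face {D : Set (ℝ × ℝ)} (hD : IsCompact D) :
    ∃ f, IsFaceOf D f ∧ ¬ Bornology.IsBounded f := by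
  obtain ⟨E, hE, hED, hEb⟩ := exists_unbounded_region hD
  have huniv : ¬ Bornology.IsBounded (univ : Set (ℝ × ℝ)) := fun h => by
    obtain ⟨R, hR⟩ := h.subset_closedBall 0
    have := hR (mem_univ ((|R| + 1, 0) : ℝ × ℝ))
    rw [mem_closedBall_zero_iff, Prod.norm_def] at this
    have h2 := (le_max_left _ _).trans this
    simp only [Real.norm_eq_abs] at h2
    rw [abs_of_nonneg (by positivity)] at h2
    linarith [le_abs_self R]
  have hne : E.Nonempty := by
    by_contra h
    rw [not_nonempty_iff_eq_empty.1 h, compl_empty] at hEb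
    exact huniv hEb
  obtain ⟨f, hf, hEf⟩ := exists_face hE hne hED
  exact ⟨f, hf, fun h => huniv (by
    rw [← union_compl_self E]; exact (h.subset hEf).union hEb)⟩

/-- Two arcs between `p` and `q` that together form a Jordan curve. -/
def IsJordan (A B : Set (ℝ × ℝ)) (p q : ℝ × ℝ) : Prop :=
  IsArc A p q ∧ IsArc B p q ∧ A ∩ B ⊆ {p, q}

theorem IsJordan.swap {A B : Set (ℝ × ℝ)} {p q : ℝ × ℝ} (h : IsJordan A B p q) :
    IsJordan B A p q := ⟨h.2.1, h.1, by rw [inter_comm]; exact h.2.2⟩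

theorem IsJordan.symm {A B : Set (ℝ × ℝ)} {p q : ℝ × ℝ} (h : IsJordan A B p q) :
    IsJordan A B q p := ⟨h.1.symm, h.2.1.symm, by rw [pair_comm]; exact h.2.2⟩

theorem IsJordan.isCompact {A B : Set (ℝ × ℝ)} {p q : ℝ × ℝ} (h : IsJordan A B p q) :
    IsCompact (A ∪ B) := h.1.isCompact.union h.2.1.isCompact

theorem IsJordan.rebase {A B : Set (ℝ × ℝ)} {p s r : ℝ × ℝ} (h : IsJordan A B p s)
    (hr : r ∈ A ∪ B) (hrp : r ≠ p) :
    ∃ A' B', IsJordan A' B' p r ∧ A' ∪ B' = A ∪ B := by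
  wlog hA : r ∈ A generalizing A B
  · obtain ⟨A', B', h1, h2⟩ := this h.swap hr.symm (hr.resolve_left hA)
    exact ⟨A', B', h1, h2.trans (union_comm _ _)⟩
  by_cases hrs : r = s
  · subst hrs; exact ⟨A, B, h, rfl⟩
  obtain ⟨A1, A2, h1, h2, h3, h4⟩ := h.1.split hA hrp hrs
  have h4' : ∀ x, x ∈ A1 → x ∈ A2 → x = r := fun x hx hx' => by
    have : x ∈ A1 ∩ A2 := ⟨hx, hx'⟩
    rw [h4] at this; exact this
  have hAB : ∀ x, x ∈ A → x ∈ B → x = p ∨ x = s := fun x hx hx' => h.2.2 ⟨hx, hx'⟩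
  refine ⟨A1, A2 ∪ B, ⟨h1, ?_, ?_⟩, by rw [← union_assoc, h3]⟩
  · refine (h2.trans h.2.1.symm ?_).symm
    rintro x ⟨hx, hxB⟩
    rcases hAB x (h3 ▸ Or.inr hx) hxB with rfl | rfl
    · exact absurd (h4' _ h1.left_mem hx).symm hrp
    · rfl
  · rintro x ⟨hx, hx' | hx'⟩
    · exact Or.inr (h4' x hx hx')
    · rcases hAB x (h3 ▸ Or.inl hx) hx' with rfl | rfl
      · exact Or.inl rfl
      · exact absurd (h4' _ hx h2.right_mem).symm hrs

theorem IsJordan.rebase_pair {A B : Set (ℝ × ℝ)} {p q r s : ℝ × ℝ} (h : IsJordan A B p q)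
    (hr : r ∈ A ∪ B) (hs : s ∈ A ∪ B) (hrs : r ≠ s) :
    ∃ A' B', IsJordan A' B' r s ∧ A' ∪ B' = A ∪ B := by
  by_cases hrp : r = p
  · subst hrp; exact h.rebase hs hrs.symm
  · obtain ⟨A', B', h1, h2⟩ := h.rebase hr hrp
    obtain ⟨A'', B'', h3, h4⟩ := h1.symm.rebase (r := s) (h2 ▸ hs) hrs.symm
    exact ⟨A'', B'', h3, h4.trans h2⟩

theorem IsJordan.exists_jump {A B : Set (ℝ × ℝ)} {p q : ℝ × ℝ} (h : IsJordan A B p q)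
    {g : ℝ × ℝ → ℂ} (hg : ContinuousOn g (A ∪ B)) (h0 : ∀ z ∈ A ∪ B, g z ≠ 0) :
    ∃ (n : ℤ) (φ ψ : ℝ × ℝ → ℂ), ContinuousOn φ A ∧ ContinuousOn ψ B ∧
      (∀ z ∈ A, exp (φ z) = g z) ∧ (∀ z ∈ B, exp (ψ z) = g z) ∧ φ p = ψ p ∧
      φ q = ψ q + n * (2 * Real.pi * I) := by
  obtain ⟨φ, hφ, hφ'⟩ := h.1.hasLog (hg.mono subset_union_left) fun z hz => h0 z (Or.inl hz)
  obtain ⟨ψ, hψ, hψ'⟩ := h.2.1.hasLog (hg.mono subset_union_right) fun z hz => h0 z (Or.inr hz)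
  have key : ∀ z ∈ A, z ∈ B → ∃ n : ℤ, φ z - ψ z = n * (2 * Real.pi * I) := fun z hz hz' => by
    rw [← exp_eq_one_iff, exp_sub, hφ' z hz, hψ' z hz', div_self (h0 z (Or.inl hz))]
  obtain ⟨n, hn⟩ := key p h.1.left_mem h.2.1.left_mem
  obtain ⟨m, hm⟩ := key q h.1.right_mem h.2.1.right_mem
  refine ⟨m - n, φ, fun z => ψ z + n * (2 * Real.pi * I), hφ, hψ.add continuousOn_const, hφ',
    fun z hz => ?_, by linear_combination hn, ?_⟩
  · rw [exp_add, exp_int_mul_two_pi_mul_I, mul_one, hψ' z hz]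
  · push_cast
    linear_combination hm

theorem IsJordan.hasLog_of_jump {A B : Set (ℝ × ℝ)} {p q : ℝ × ℝ} (h : IsJordan A B p q)
    {g : ℝ × ℝ → ℂ} {φ ψ : ℝ × ℝ → ℂ} (hφ : ContinuousOn φ A) (hψ : ContinuousOn ψ B)
    (hφ' : ∀ z ∈ A, exp (φ z) = g z) (hψ' : ∀ z ∈ B, exp (ψ z) = g z) (hp : φ p = ψ p)
    (hq : φ q = ψ q) : HasLog (A ∪ B) g := by
  have e1 : ∀ z ∈ A, A.piecewise φ ψ z = φ z := fun z hz => piecewise_eq_of_mem _ _ _ hz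
  have e2 : ∀ z ∈ B, A.piecewise φ ψ z = ψ z := fun z hz => by
    by_cases hA : z ∈ A
    · rw [e1 z hA]
      rcases h.2.2 ⟨hA, hz⟩ with rfl | rfl
      exacts [hp, hq]
    · exact piecewise_eq_of_notMem _ _ _ hA
  refine ⟨A.piecewise φ ψ, ContinuousOn.union_of_isClosed (hφ.congr e1) (hψ.congr e2)
    h.1.isCompact.isClosed h.2.1.isCompact.isClosed, ?_⟩
  rintro z (hz | hz)
  · rw [e1 z hz, hφ' z hz]
  · rw [e2 z hz, hψ' z hz]

theorem IsJordan.bounded_unique {A B : Set (ℝ × ℝ)} {p q : ℝ × ℝ} (h : IsJordan A B p q)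
    {U W : Set (ℝ × ℝ)} (hU : IsFaceOf (A ∪ B) U) (hW : IsFaceOf (A ∪ B) W)
    (hUb : Bornology.IsBounded U) (hWb : Bornology.IsBounded W) : U = W := by
  by_contra hne
  have hJ := h.isCompact.isClosed
  obtain ⟨x, hx⟩ := IsFaceOf.nonempty hU
  obtain ⟨y, hy⟩ := IsFaceOf.nonempty hW
  have hdis : Disjoint U W := by
    rw [Set.disjoint_iff_inter_eq_empty]
    by_contra h
    exact hne (IsFaceOf.eq_of_inter hU hW (nonempty_iff_ne_empty.2 h))
  have hxJ : x ∉ A ∪ B := IsFaceOf.subset_compl hU hx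
  have hyJ : y ∉ A ∪ B := IsFaceOf.subset_compl hW hy
  have hyU : y ∉ closure U := fun h => Set.disjoint_left.1
    (hdis.closure_left (IsFaceOf.isOpen hJ hW)) h hy
  have hnz : ∀ {a : ℝ × ℝ} {S : Set (ℝ × ℝ)}, a ∉ S → ∀ z ∈ S, toC z - toC a ≠ 0 :=
    fun ha z hz => sub_toC_ne_zero fun e => ha (e ▸ hz)
  have hcont : ∀ (a : ℝ × ℝ) (S : Set (ℝ × ℝ)), ContinuousOn (fun z => toC z - toC a) S :=
    fun a S => (continuous_toC.sub continuous_const).continuousOn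
  obtain ⟨n, φ, ψ, hφ, hψ, hφ', hψ', hp, hq⟩ := h.exists_jump (hcont x _) (hnz hxJ)
  obtain ⟨m, φ₂, ψ₂, hφ₂, hψ₂, hφ₂', hψ₂', hp₂, hq₂⟩ := h.exists_jump (hcont y _) (hnz hyJ)
  have key : HasLog (A ∪ B) fun z => (toC z - toC x) ^ m * (toC z - toC y) ^ (-n) := by
    refine h.hasLog_of_jump (φ := fun z => m * φ z + (-n : ℤ) * φ₂ z)
      (ψ := fun z => m * ψ z + (-n : ℤ) * ψ₂ z)
      ((continuousOn_const.mul hφ).add (continuousOn_const.mul hφ₂))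
      ((continuousOn_const.mul hψ).add (continuousOn_const.mul hψ₂)) (fun z hz => ?_)
      (fun z hz => ?_) ?_ ?_
    · rw [exp_add, exp_int_mul, exp_int_mul, hφ' z hz, hφ₂' z hz]
    · rw [exp_add, exp_int_mul, exp_int_mul, hψ' z hz, hψ₂' z hz]
    · simp only [hp, hp₂]
    · simp only [hq, hq₂]; push_cast; ring
  have hm : m = 0 := zpow_eq_zero_of_hasLog (IsFaceOf.isOpen hJ hU) hUb hx m
    (fun z => (toC z - toC y) ^ (-n))
    ((hcont y _).zpow₀ _ fun z hz => Or.inl (hnz hyU z hz))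
    (fun z hz => zpow_ne_zero _ (hnz hyU z hz)) (key.mono (IsFaceOf.frontier_subset hJ hU))
  subst hm
  refine one_ne_zero (zpow_eq_zero_of_hasLog (IsFaceOf.isOpen hJ hW) hWb hy 1 (fun _ => 1)
    continuousOn_const (fun _ _ => one_ne_zero) (HasLog.mono (K := A ∪ B) ?_
      (IsFaceOf.frontier_subset hJ hW)))
  refine HasLog.congr (h.hasLog_of_jump hφ₂ hψ₂ hφ₂' hψ₂' hp₂ (by simpa using hq₂)) ?_
  intro z _
  simp

theorem IsJordan.frontier_eq {A B : Set (ℝ × ℝ)} {p q : ℝ × ℝ} (h : IsJordan A B p q)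
    {U W : Set (ℝ × ℝ)} (hU : IsFaceOf (A ∪ B) U) (hW : IsFaceOf (A ∪ B) W) (hne : U ≠ W) :
    frontier U = A ∪ B := by
  have hJ := h.isCompact.isClosed
  refine subset_antisymm (IsFaceOf.frontier_subset hJ hU) fun r hr => ?_
  by_contra hrU
  obtain ⟨s, hs, hsr⟩ : ∃ s ∈ A ∪ B, r ≠ s := by
    by_cases hrp : r = p
    · exact ⟨q, Or.inl h.1.right_mem, fun e => h.1.ne (hrp.symm.trans e)⟩
    · exact ⟨p, Or.inl h.1.left_mem, hrp⟩
  obtain ⟨A', B', h', hAB⟩ := h.rebase_pair hr hs hsr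
  have hN : (frontier U)ᶜ ∈ 𝓝 r := isClosed_frontier.isOpen_compl.mem_nhds hrU
  obtain ⟨a, S, hS, hSA, hSN, hrS⟩ := h'.1.exists_subarc hN
  obtain ⟨b, T, hT, hTB, hTN, hrT⟩ := h'.2.1.exists_subarc hN
  have hST : S ∩ T = {s} := by
    refine subset_antisymm ?_ (by rintro _ rfl; exact ⟨hS.right_mem, hT.right_mem⟩)
    rintro z ⟨hz, hz'⟩
    rcases h'.2.2 ⟨hSA hz, hTB hz'⟩ with rfl | rfl
    exacts [absurd hz hrS, rfl]
  have hsub : frontier U ⊆ S ∪ T := fun z hz => by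
    have hz' := IsFaceOf.frontier_subset hJ hU hz
    rw [← hAB] at hz'
    by_contra hn
    rw [mem_union, not_or] at hn
    rcases hz' with h1 | h1
    · exact hSN ⟨h1, hn.1⟩ hz
    · exact hTN ⟨h1, hn.2⟩ hz
  have hSTJ : S ∪ T ⊆ A ∪ B := by
    rw [← hAB]; exact union_subset_union hSA hTB
  obtain ⟨x, hx⟩ := IsFaceOf.nonempty hU
  obtain ⟨y, hy⟩ := IsFaceOf.nonempty hW
  have hx' : x ∉ S ∪ T := fun e => IsFaceOf.subset_compl hU hx (hSTJ e)
  have hy' : y ∉ S ∪ T := fun e => IsFaceOf.subset_compl hW hy (hSTJ e)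
  have hlog : ∀ {R a b}, IsArc R a b → R ⊆ S ∪ T → HasLog R (ratio x y) := fun hR hsub =>
    hR.hasLog (continuousOn_ratio fun e => hy' (hsub e)) fun z hz =>
      ratio_ne_zero (fun e => hx' (hsub (e ▸ hz))) (fun e => hy' (hsub (e ▸ hz)))
  have hcomp := mem_component_of_hasLog (hS.isCompact.union hT.isCompact) hx' hy'
    (HasLog.union hS.isCompact.isClosed hT.isCompact.isClosed
      (by rw [hST]; exact isPreconnected_singleton)
      (hlog hS subset_union_left) (hlog hT subset_union_right))
  have hpre : IsPreconnected (connectedComponentIn (S ∪ T)ᶜ x) :=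
    isPreconnected_connectedComponentIn
  have hcU : connectedComponentIn (S ∪ T)ᶜ x ⊆ U := by
    have hc : ∀ z ∈ connectedComponentIn (S ∪ T)ᶜ x, z ∉ frontier U := fun z hz e =>
      connectedComponentIn_subset _ _ hz (hsub e)
    refine hpre.subset_left_of_subset_union (IsFaceOf.isOpen hJ hU)
      (isClosed_closure (s := U)).isOpen_compl
      (Set.disjoint_left.2 fun z hz hz' => hz' (subset_closure hz)) (fun z hz => ?_)
      ⟨x, mem_connectedComponentIn hx', hx⟩
    by_cases hzU : z ∈ U
    · exact Or.inl hzU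
    · refine Or.inr fun hcl => hc z hz ?_
      rw [(IsFaceOf.isOpen hJ hU).frontier_eq]
      exact ⟨hcl, hzU⟩
  exact hne (IsFaceOf.eq_of_inter hU hW
    ⟨y, hcU (hcomp ▸ mem_connectedComponentIn hy'), hy⟩)

/-- A connected set from left to right below a point `N` and a connected set passing above `N`
together prevent `z - N` from having a logarithm. -/
theorem not_hasLog_of_surround {X H : Set (ℝ × ℝ)} (hX : IsPreconnected X)
    (hH : IsPreconnected H) {p q N : ℝ × ℝ} (hpX : p ∈ X) (hqX : q ∈ X) (hpH : p ∈ H)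
    (hqH : q ∈ H) (hp : p.1 < N.1) (hq : N.1 < q.1) (hXN : ∀ z ∈ X, z.2 < N.2)
    (hHN : ∀ z ∈ H, z.1 = N.1 → N.2 < z.2) : ¬ HasLog (X ∪ H) fun z => toC z - toC N := by
  rintro ⟨L, hL, hL'⟩
  have hcont : ∀ (c : ℂ) (S : Set (ℝ × ℝ)), ContinuousOn (fun z => c * (toC z - toC N)) S :=
    fun c S => (continuous_const.mul (continuous_toC.sub continuous_const)).continuousOn
  have h1 : ∀ z ∈ X, I * (toC z - toC N) ∈ slitPlane := fun z hz => by
    rw [mem_slitPlane_iff]; left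
    have := hXN z hz
    simp [toC]; linarith
  have h2 : ∀ z ∈ H, -(I * (toC z - toC N)) ∈ slitPlane := fun z hz => by
    rw [mem_slitPlane_iff]
    by_cases h : z.1 = N.1
    · left
      have := hHN z hz h
      simp [toC]; linarith
    · right
      simp only [toC, neg_im, mul_im, I_re, I_im, sub_re]
      intro h'
      exact h (by linarith)
  have hexpI : exp (Real.pi / 2 * I) = I := by simp
  have hexpI' : exp (-(Real.pi / 2 * I)) = -I := by rw [Complex.exp_neg, hexpI, inv_I]
  have e1 := log_sub_const hX (φ := fun z => log (I * (toC z - toC N)))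
    (ψ := fun z => L z + Real.pi / 2 * I)
    ((hcont I X).clog h1) ((hL.mono subset_union_left).add continuousOn_const)
    (fun z hz => by
      rw [exp_log (slitPlane_ne_zero (h1 z hz)), exp_add, hL' z (Or.inl hz), hexpI]; ring)
    hpX hqX
  have e2 := log_sub_const hH (φ := fun z => log (-(I * (toC z - toC N))))
    (ψ := fun z => L z + -(Real.pi / 2 * I))
    ((hcont I H).neg.clog h2) ((hL.mono subset_union_right).add continuousOn_const)
    (fun z hz => by
      rw [exp_log (slitPlane_ne_zero (h2 z hz)), exp_add, hL' z (Or.inr hz), hexpI']; ring)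
    hpH hqH
  have hlog : ∀ u : ℂ, log (-u) = log u + (arg (-u) - arg u : ℝ) * I := fun u => by
    rw [log, log, norm_neg]; push_cast; ring
  have a1 : arg (-(I * (toC p - toC N))) - arg (I * (toC p - toC N)) = Real.pi := by
    rw [arg_neg_eq_arg_add_pi_of_im_neg]
    · ring
    · simp [toC]; linarith
  have a2 : arg (-(I * (toC q - toC N))) - arg (I * (toC q - toC N)) = -Real.pi := by
    rw [arg_neg_eq_arg_sub_pi_of_im_pos]
    · ring
    · simp [toC]; linarith
  simp only [hlog, a1, a2] at e2
  have : (2 * Real.pi * I : ℂ) = 0 := by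
    push_cast at e2
    linear_combination e2 - e1
  exact two_pi_I_ne_zero this

theorem hasLog_sub_of_above {X : Set (ℝ × ℝ)} {S : ℝ × ℝ}
    (h : ∀ z ∈ X, z.1 = S.1 → S.2 < z.2) : HasLog X fun z => toC z - toC S := by
  have h2 : HasLog X fun z => -(I * (toC z - toC S)) := by
    refine HasLog.of_slitPlane
      (continuous_const.mul (continuous_toC.sub continuous_const)).neg.continuousOn ?_
    intro z hz
    rw [mem_slitPlane_iff]
    by_cases h' : z.1 = S.1
    · left
      have := h z hz h'
      simp [toC]; linarith
    · right
      simp only [toC, neg_im, mul_im, I_re, I_im, sub_re]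
      intro h''
      exact h' (by linarith)
  have h3 : HasLog X fun _ => I :=
    ⟨fun _ => log I, continuousOn_const, fun _ _ => exp_log I_ne_zero⟩
  refine (h3.mul h2).congr fun z _ => ?_
  linear_combination (-(toC z - toC S)) * I_mul_I

/-- The frame passing above the square of side `2 K` from `p` to `q`. -/
def frame (p q : ℝ × ℝ) (K : ℝ) : Set (ℝ × ℝ) :=
  (Icc (-K) p.1 ×ˢ {p.2}) ∪ (({-K} ×ˢ Icc p.2 K) ∪ ((Icc (-K) K ×ˢ {K}) ∪
    (({K} ×ˢ Icc q.2 K) ∪ (Icc q.1 K ×ˢ {q.2}))))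

theorem isPreconnected_frame {p q : ℝ × ℝ} {K : ℝ} (hp : |p.1| ≤ K ∧ |p.2| ≤ K)
    (hq : |q.1| ≤ K ∧ |q.2| ≤ K) : IsPreconnected (frame p q K) := by
  have h1 := abs_le.1 hp.1
  have h2 := abs_le.1 hp.2
  have h3 := abs_le.1 hq.1
  have h4 := abs_le.1 hq.2
  have h5 : 0 ≤ K := (abs_nonneg _).trans hp.1
  have hh : ∀ a b c : ℝ, IsPreconnected (Icc a b ×ˢ ({c} : Set ℝ)) := fun a b c =>
    isPreconnected_Icc.prod isPreconnected_singleton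
  have hv : ∀ a b c : ℝ, IsPreconnected (({c} : Set ℝ) ×ˢ Icc a b) := fun a b c =>
    isPreconnected_singleton.prod isPreconnected_Icc
  refine IsPreconnected.union (-K, p.2) ?_ ?_ (hh _ _ _)
    (IsPreconnected.union (-K, K) ?_ ?_ (hv _ _ _)
    (IsPreconnected.union (K, K) ?_ ?_ (hh _ _ _)
    (IsPreconnected.union (K, q.2) ?_ ?_ (hv _ _ _) (hh _ _ _))))
  all_goals simp
  all_goals first | linarith | (left; linarith)

theorem right_mem_frame {p q : ℝ × ℝ} {K : ℝ} (hq : q.1 ≤ K) : q ∈ frame p q K :=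
  Or.inr (Or.inr (Or.inr (Or.inr ⟨⟨le_refl _, hq⟩, rfl⟩)))

theorem left_mem_frame {p q : ℝ × ℝ} {K : ℝ} (hp : -K ≤ p.1) : p ∈ frame p q K :=
  Or.inl ⟨⟨hp, le_refl _⟩, rfl⟩

theorem isCompact_frame (p q : ℝ × ℝ) (K : ℝ) : IsCompact (frame p q K) := by
  have hh : ∀ a b c : ℝ, IsCompact (Icc a b ×ˢ ({c} : Set ℝ)) := fun a b c =>
    isCompact_Icc.prod isCompact_singleton
  have hv : ∀ a b c : ℝ, IsCompact (({c} : Set ℝ) ×ˢ Icc a b) := fun a b c =>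
    isCompact_singleton.prod isCompact_Icc
  exact (hh _ _ _).union ((hv _ _ _).union ((hh _ _ _).union ((hv _ _ _).union (hh _ _ _))))

theorem frame_inter {J : Set (ℝ × ℝ)} {p q : ℝ × ℝ} {K : ℝ}
    (hK : ∀ z ∈ J, |z.1| < K ∧ |z.2| < K) (hp : ∀ z ∈ J, p.1 ≤ z.1) (hq : ∀ z ∈ J, z.1 ≤ q.1) :
    ∀ z ∈ J, z ∈ frame p q K → z = p ∨ z = q := by
  rintro z hz (h | h | h | h | h)
  · exact Or.inl (Prod.ext (le_antisymm h.1.2 (hp z hz)) h.2)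
  · have := (abs_lt.1 (hK z hz).1).1
    rw [h.1] at this; exact absurd this (lt_irrefl _)
  · have := (abs_lt.1 (hK z hz).2).2
    rw [h.2] at this; exact absurd this (lt_irrefl _)
  · have := (abs_lt.1 (hK z hz).1).2
    rw [h.1] at this; exact absurd this (lt_irrefl _)
  · exact Or.inr (Prod.ext (le_antisymm (hq z hz) h.1.1) h.2)

theorem frame_above {p q : ℝ × ℝ} {K x : ℝ} (hp : p.1 < x) (hq : x < q.1) (hpK : -K ≤ p.1)
    (hqK : q.1 ≤ K) : ∀ z ∈ frame p q K, z.1 = x → z.2 = K := by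
  rintro z (h | h | h | h | h) hz
  · exact absurd h.1.2 (by rw [hz]; linarith)
  · have : z.1 = -K := h.1
    linarith
  · exact h.2
  · have : z.1 = K := h.1
    linarith
  · exact absurd h.1.1 (by rw [hz]; linarith)

theorem isPreconnected_vert (x a b : ℝ) : IsPreconnected ({x} ×ˢ Icc a b : Set (ℝ × ℝ)) :=
  isPreconnected_singleton.prod isPreconnected_Icc

theorem ratio_div {a b c z : ℝ × ℝ} (ha : z ≠ a) (hb : z ≠ b) :
    (ratio a c z)⁻¹ * ratio a b z * (toC z - toC b) = (toC z - toC c) := by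
  have h1 := sub_toC_ne_zero ha
  have h2 := sub_toC_ne_zero hb
  unfold ratio
  rw [inv_div]
  field_simp

/-- The key step of the Jordan curve theorem. -/
theorem not_sameSide {A B H : Set (ℝ × ℝ)} {p q N S z : ℝ × ℝ} (h : IsJordan A B p q)
    (hH : IsPreconnected H) (hHc : IsCompact H) (hpH : p ∈ H) (hqH : q ∈ H)
    (hHJ : ∀ z ∈ A ∪ B, z ∈ H → z = p ∨ z = q)
    (hp : p.1 < N.1) (hq : N.1 < q.1) (hXN : ∀ z ∈ A, z.2 < N.2)
    (hHN : ∀ z ∈ H, z.1 = N.1 → N.2 < z.2)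
    (hHS : ∀ z ∈ A ∪ B ∪ H, z.1 = S.1 → S.2 < z.2)
    (hzJ : z ∉ A ∪ B) (hzH : z ∉ H)
    (h1 : HasLog (B ∪ H) (ratio z N)) (h2 : HasLog (A ∪ H) (ratio z S))
    (h3 : HasLog (A ∪ B) (ratio z N)) (h4 : HasLog (A ∪ B) (ratio z S)) : False := by
  have hAc := h.1.isCompact.isClosed
  have hBc := h.2.1.isCompact.isClosed
  have i1 : (A ∪ B) ∩ (B ∪ H) = B := by
    refine subset_antisymm ?_ fun x hx => ⟨Or.inr hx, Or.inl hx⟩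
    rintro x ⟨hx, hx' | hx'⟩
    · exact hx'
    · rcases hHJ x hx hx' with rfl | rfl
      exacts [h.2.1.left_mem, h.2.1.right_mem]
  have i2 : (A ∪ B) ∩ (A ∪ H) = A := by
    refine subset_antisymm ?_ fun x hx => ⟨Or.inl hx, Or.inl hx⟩
    rintro x ⟨hx, hx' | hx'⟩
    · exact hx'
    · rcases hHJ x hx hx' with rfl | rfl
      exacts [h.1.left_mem, h.1.right_mem]
  have k1 := HasLog.union (hAc.union hBc) (hBc.union hHc.isClosed)
    (by rw [i1]; exact h.2.1.isPreconnected) h3 h1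
  have k2 := HasLog.union (hAc.union hBc) (hAc.union hHc.isClosed)
    (by rw [i2]; exact h.1.isPreconnected) h4 h2
  have sub1 : A ∪ H ⊆ A ∪ B ∪ (B ∪ H) := by
    rintro x (hx | hx)
    exacts [Or.inl (Or.inl hx), Or.inr (Or.inr hx)]
  have sub2 : A ∪ H ⊆ A ∪ B ∪ (A ∪ H) := subset_union_right
  have k3 : HasLog (A ∪ H) fun z => toC z - toC S := hasLog_sub_of_above fun z hz =>
    hHS z (by rcases hz with hz | hz; exacts [Or.inl (Or.inl hz), Or.inr hz])
  refine not_hasLog_of_surround h.1.isPreconnected hH h.1.left_mem h.1.right_mem hpH hqH hp hq hXN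
    hHN ((((k1.mono sub1).inv.mul (k2.mono sub2)).mul k3).congr fun x hx => ratio_div ?_ ?_)
  · rintro rfl
    rcases hx with hx | hx
    exacts [hzJ (Or.inl hx), hzH hx]
  · rintro rfl
    exact lt_irrefl _
      (hHS x (by rcases hx with hx | hx; exacts [Or.inl (Or.inl hx), Or.inr hx]) rfl)

theorem not_bounded_of_vertical {f : Set (ℝ × ℝ)} {x a : ℝ}
    (h : (∀ y, a ≤ y → (x, y) ∈ f) ∨ (∀ y, y ≤ a → (x, y) ∈ f)) : ¬ Bornology.IsBounded f := by
  intro hb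
  obtain ⟨R, hR⟩ := hb.subset_closedBall 0
  have key : ∀ y, (x, y) ∈ f → |y| ≤ R := fun y hy => by
    have := hR hy
    rw [mem_closedBall_zero_iff, Prod.norm_def] at this
    exact (le_max_right _ _).trans this
  rcases h with h | h
  · have := key _ (h (max a (R + 1)) (le_max_left _ _))
    linarith [le_max_right a (R + 1), le_abs_self (max a (R + 1))]
  · have := key _ (h (min a (-R - 1)) (min_le_left _ _))
    linarith [min_le_right a (-R - 1), neg_le_abs (min a (-R - 1))]

theorem isCompact_slice {X : Set (ℝ × ℝ)} (hX : IsCompact X) (x : ℝ) :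
    IsCompact {y : ℝ | (x, y) ∈ X} := by
  have hc : IsClosed {y : ℝ | (x, y) ∈ X} := hX.isClosed.preimage (by fun_prop)
  refine (hX.image continuous_snd).of_isClosed_subset hc fun y hy => ⟨(x, y), hy, rfl⟩

theorem IsJordan.exists_bounded_of_extreme {A B : Set (ℝ × ℝ)} {p q : ℝ × ℝ}
    (h : IsJordan A B p q) (hpq : p.1 < q.1) (hp : ∀ z ∈ A ∪ B, p.1 ≤ z.1)
    (hq : ∀ z ∈ A ∪ B, z.1 ≤ q.1) :
    ∃ f, IsFaceOf (A ∪ B) f ∧ Bornology.IsBounded f := by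
  obtain ⟨K, hK⟩ : ∃ K : ℝ, ∀ z ∈ A ∪ B, |z.1| < K ∧ |z.2| < K := by
    obtain ⟨R, hR⟩ := h.isCompact.isBounded.subset_closedBall 0
    refine ⟨R + 1, fun z hz => ?_⟩
    have := hR hz
    rw [mem_closedBall_zero_iff, Prod.norm_def] at this
    have h1 : |z.1| ≤ R := (le_max_left _ _).trans this
    have h2 : |z.2| ≤ R := (le_max_right _ _).trans this
    constructor <;> linarith
  have hpJ : p ∈ A ∪ B := Or.inl h.1.left_mem
  have hqJ : q ∈ A ∪ B := Or.inl h.1.right_mem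
  set x := (p.1 + q.1) / 2 with hx
  have hpx : p.1 < x := by linarith
  have hxq : x < q.1 := by linarith
  have hcross : ∀ {X : Set (ℝ × ℝ)}, IsArc X p q → {y : ℝ | (x, y) ∈ X}.Nonempty := by
    intro X hX
    obtain ⟨z, hz, hzx⟩ := hX.isPreconnected.intermediate_value hX.left_mem hX.right_mem
      continuous_fst.continuousOn ⟨hpx.le, hxq.le⟩
    exact ⟨z.2, by rw [← hzx]; exact hz⟩
  have hdisj : ∀ y, (x, y) ∈ A → (x, y) ∈ B → False := fun y hA hB => by
    rcases h.2.2 ⟨hA, hB⟩ with e | e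
    · exact hpx.ne' (congrArg Prod.fst e)
    · exact hxq.ne (congrArg Prod.fst e)
  obtain ⟨l, hl, hlmax⟩ := (isCompact_slice h.isCompact x).exists_isGreatest
    ((hcross h.1).mono fun y hy => Or.inl hy)
  wlog hlA : (x, l) ∈ A generalizing A B
  · have := this h.swap (by rwa [union_comm]) (by rwa [union_comm]) (by rwa [union_comm])
      (by rwa [union_comm]) (by rwa [union_comm]) (fun y hA hB => hdisj y hB hA)
      (by rwa [union_comm]) (by rwa [union_comm]) (hl.resolve_left hlA)
    rwa [union_comm] at this
  obtain ⟨m, hm, hmmin⟩ := (isCompact_slice h.1.isCompact x).exists_isLeast (hcross h.1)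
  have hm : (x, m) ∈ A := hm
  have habove : ∀ y, l < y → (x, y) ∉ A ∪ B := fun y hy hy' => not_lt.2 (hlmax hy') hy
  have hbelow : ∀ y, y < m → (x, y) ∉ A := fun y hy hy' => not_lt.2 (hmmin hy') hy
  have hlK := abs_lt.1 (hK _ hl).2
  have hmK := abs_lt.1 (hK _ (Or.inl hm)).2
  simp only at hlK hmK
  set H := frame p q (K + 2) with hH
  have hpK := hK p hpJ
  have hqK := hK q hqJ
  have hHpre : IsPreconnected H := isPreconnected_frame ⟨by linarith, by linarith⟩
    ⟨by linarith, by linarith⟩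
  have hHJ : ∀ z ∈ A ∪ B, z ∈ H → z = p ∨ z = q := frame_inter
    (fun z hz => ⟨by linarith [(hK z hz).1], by linarith [(hK z hz).2]⟩) hp hq
  have hHline : ∀ z ∈ H, z.1 = x → z.2 = K + 2 := frame_above hpx hxq
    (by linarith [(abs_lt.1 hpK.1).1]) (by linarith [(abs_lt.1 hqK.1).2])
  have hHvert : ∀ y, y < K + 2 → (x, y) ∉ H := fun y hy hy' =>
    hy.ne (hHline _ hy' rfl)
  have hpH : p ∈ H := left_mem_frame (by linarith [(abs_lt.1 hpK.1).1])
  have hqH : q ∈ H := right_mem_frame (by linarith [(abs_lt.1 hqK.1).2])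
  have hHc : IsCompact H := isCompact_frame _ _ _
  set N : ℝ × ℝ := (x, K + 1) with hN
  set S : ℝ × ℝ := (x, -(K + 1)) with hS
  have hAN : ∀ z ∈ A ∪ B, z.2 < N.2 := fun z hz => by
    have := (abs_lt.1 (hK z hz).2).2
    simp only [hN]; linarith
  have hHN : ∀ z ∈ H, z.1 = N.1 → N.2 < z.2 := fun z hz hzx => by
    rw [hHline z hz hzx]; simp [hN]
  have hHS : ∀ z ∈ A ∪ B ∪ H, z.1 = S.1 → S.2 < z.2 := by
    rintro z (hz | hz) hzx
    · have := (abs_lt.1 (hK z hz).2).1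
      simp only [hS]; linarith
    · rw [hHline z hz hzx]; simp only [hS]; linarith
  -- the part of `A` joined upwards to `N`
  have hA1 : (x, l) ∈ A \ {p, q} := ⟨hlA, by
    rintro (e | e)
    exacts [hpx.ne' (congrArg Prod.fst e), hxq.ne (congrArg Prod.fst e)]⟩
  have hA2 : (x, m) ∈ A \ {p, q} := ⟨hm, by
    rintro (e | e)
    exacts [hpx.ne' (congrArg Prod.fst e), hxq.ne (congrArg Prod.fst e)]⟩
  set P : Set (ℝ × ℝ) := (A \ {p, q}) ∪ {x} ×ˢ Icc l (K + 1) with hP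
  have hPpre : IsPreconnected P := IsPreconnected.union (x, l) hA1
    ⟨rfl, le_refl _, by linarith⟩ h.1.isPreconnected_diff (isPreconnected_vert _ _ _)
  have hPdis : ∀ z ∈ P, z ∉ B ∪ H := by
    rintro ⟨z1, z2⟩ (hz | ⟨hz1, hz⟩)
    · rintro (h' | h')
      · exact hz.2 (h.2.2 ⟨hz.1, h'⟩)
      · exact hz.2 (hHJ _ (Or.inl hz.1) h')
    · obtain rfl : z1 = x := hz1
      rintro (h' | h')
      · rcases hz.1.eq_or_lt with e | e
        · simp only at e
          subst e
          exact hdisj _ hlA h'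
        · exact habove _ e (Or.inr h')
      · exact hHvert _ (by linarith [hz.2]) h'
  have hNP : N ∈ P := Or.inr ⟨rfl, by linarith, le_refl _⟩
  have hmP : (x, m) ∈ P := Or.inl hA2
  by_cases hB : ({y : ℝ | (x, y) ∈ B} ∩ Iic m).Nonempty
  · obtain ⟨m', ⟨hm'B, hm'm⟩, hm'max⟩ := ((isCompact_slice h.2.1.isCompact x).inter_right
      isClosed_Iic).exists_isGreatest hB
    have hm'lt : m' < m := lt_of_le_of_ne hm'm (by rintro rfl; exact hdisj _ hm hm'B)
    have hm'K := abs_lt.1 (hK _ (Or.inr hm'B)).2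
    simp only at hm'K
    have hbetween : ∀ y, m' < y → y ≤ m → (x, y) ∉ B := fun y h1 h2 h3 =>
      not_lt.2 (hm'max ⟨h3, h2⟩) h1
    set z : ℝ × ℝ := (x, (m + m') / 2) with hz
    have hzJ : z ∉ A ∪ B := by
      rintro (h' | h')
      exacts [hbelow _ (by linarith) h', hbetween _ (by linarith) (by linarith) h']
    refine ⟨_, ⟨z, hzJ, rfl⟩, ?_⟩
    by_contra hunb
    have hf : IsFaceOf (A ∪ B) (connectedComponentIn (A ∪ B)ᶜ z) := ⟨z, hzJ, rfl⟩
    have hzf := mem_connectedComponentIn (F := (A ∪ B)ᶜ) hzJ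
    have hside : ∀ w : ℝ × ℝ, w ∉ A ∪ B →
        ¬ Bornology.IsBounded (connectedComponentIn (A ∪ B)ᶜ w) →
        HasLog (A ∪ B) (ratio z w) := fun w hw hwb => by
      have hg : IsFaceOf (A ∪ B) (connectedComponentIn (A ∪ B)ᶜ w) := ⟨w, hw, rfl⟩
      have e := IsFaceOf.eq_of_unbounded h.isCompact hf hg hunb hwb
      exact hasLog_ratio_of_mem_component h.isCompact (IsFaceOf.isPreconnected hf)
        (subset_compl_iff_disjoint_right.1 (IsFaceOf.subset_compl hf)) hzf
        (e ▸ mem_connectedComponentIn hw)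
    have hNJ : ∀ y, K + 1 ≤ y → (x, y) ∉ A ∪ B := fun y hy hy' => by
      have := (abs_lt.1 (hK _ hy').2).2
      simp only at this; linarith
    have hSJ : ∀ y, y ≤ -(K + 1) → (x, y) ∉ A ∪ B := fun y hy hy' => by
      have := (abs_lt.1 (hK _ hy').2).1
      simp only at this; linarith
    refine not_sameSide h hHpre hHc hpH hqH hHJ hpx hxq (fun w hw => hAN w (Or.inl hw)) hHN hHS hzJ
      (hHvert _ (by linarith)) ?_ ?_ (hside N (hNJ _ le_rfl) ?_) (hside S (hSJ _ le_rfl) ?_)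
    · have hQ : IsPreconnected ({x} ×ˢ Icc ((m + m') / 2) m ∪ P) :=
        IsPreconnected.union (x, m) ⟨rfl, by linarith, le_refl _⟩ hmP
          (isPreconnected_vert x ((m + m') / 2) m) hPpre
      refine hasLog_ratio_of_mem_component (h.2.1.isCompact.union hHc) hQ ?_
        (Or.inl ⟨rfl, le_refl _, by simp only [hz]; linarith⟩) (Or.inr hNP)
      refine Set.disjoint_left.2 ?_
      rintro ⟨w1, w2⟩ (⟨hw1, hw⟩ | hw)
      · obtain rfl : w1 = x := hw1
        rintro (h' | h')
        · exact hbetween _ (by linarith [hw.1]) hw.2 h'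
        · exact hHvert _ (by linarith [hw.2]) h'
      · exact hPdis _ hw
    · refine hasLog_ratio_of_mem_component (h.1.isCompact.union hHc)
        (isPreconnected_vert x (-(K + 1)) ((m + m') / 2)) ?_
        ⟨rfl, by simp only [hz]; linarith, le_refl _⟩ ⟨rfl, le_refl _, by simp only [hS]; linarith⟩
      refine Set.disjoint_left.2 ?_
      rintro ⟨w1, w2⟩ ⟨hw1, hw⟩
      obtain rfl : w1 = x := hw1
      rintro (h' | h')
      · exact hbelow _ (by linarith [hw.2]) h'
      · exact hHvert _ (by linarith [hw.2]) h'
    · refine not_bounded_of_vertical (x := x) (a := K + 1) (Or.inl fun y hy => ?_)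
      have hray : IsPreconnected ({x} ×ˢ Ici (K + 1) : Set (ℝ × ℝ)) :=
        isPreconnected_singleton.prod isPreconnected_Ici
      refine hray.subset_connectedComponentIn (x := N) ⟨rfl, le_refl (K + 1)⟩ ?_ ⟨rfl, hy⟩
      rintro ⟨w1, w2⟩ ⟨hw1, hw⟩
      obtain rfl : w1 = x := hw1
      exact hNJ _ hw
    · refine not_bounded_of_vertical (x := x) (a := -(K + 1)) (Or.inr fun y hy => ?_)
      have hray : IsPreconnected ({x} ×ˢ Iic (-(K + 1)) : Set (ℝ × ℝ)) :=
        isPreconnected_singleton.prod isPreconnected_Iic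
      refine hray.subset_connectedComponentIn (x := S) ⟨rfl, le_refl (-(K + 1))⟩ ?_ ⟨rfl, hy⟩
      rintro ⟨w1, w2⟩ ⟨hw1, hw⟩
      obtain rfl : w1 = x := hw1
      exact hSJ _ hw
  · exfalso
    have hlog : HasLog (B ∪ H) (ratio S N) := by
      have hQ : IsPreconnected ({x} ×ˢ Icc (-(K + 1)) m ∪ P) :=
        IsPreconnected.union (x, m) ⟨rfl, by linarith, le_refl _⟩ hmP
          (isPreconnected_vert x (-(K + 1)) m) hPpre
      refine hasLog_ratio_of_mem_component (h.2.1.isCompact.union hHc) hQ ?_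
        (Or.inl ⟨rfl, le_refl _, by simp only [hS]; linarith⟩) (Or.inr hNP)
      refine Set.disjoint_left.2 ?_
      rintro ⟨w1, w2⟩ (⟨hw1, hw⟩ | hw)
      · obtain rfl : w1 = x := hw1
        rintro (h' | h')
        · exact hB ⟨_, h', hw.2⟩
        · exact hHvert _ (by linarith [hw.2]) h'
      · exact hPdis _ hw
    have k3 : HasLog (B ∪ H) fun z => toC z - toC S := hasLog_sub_of_above fun z hz =>
      hHS z (by rcases hz with hz | hz; exacts [Or.inl (Or.inr hz), Or.inr hz])
    refine not_hasLog_of_surround h.2.1.isPreconnected hHpre h.2.1.left_mem h.2.1.right_mem hpH hqH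
      hpx hxq (fun w hw => hAN w (Or.inr hw)) hHN ((hlog.inv.mul k3).congr fun w hw => ?_)
    have hwS : w ≠ S := by
      rintro rfl
      exact lt_irrefl _ (hHS S
        (by rcases hw with hw | hw; exacts [Or.inl (Or.inr hw), Or.inr hw]) rfl)
    have := sub_toC_ne_zero hwS
    rw [ratio, inv_div, div_mul_cancel₀ _ this]

theorem IsJordan.exists_bounded {A B : Set (ℝ × ℝ)} {p q : ℝ × ℝ} (h : IsJordan A B p q) :
    ∃ f, IsFaceOf (A ∪ B) f ∧ Bornology.IsBounded f := by
  obtain ⟨a, ha, hamin⟩ := h.isCompact.exists_isMinOn ⟨p, Or.inl h.1.left_mem⟩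
    continuous_fst.continuousOn
  obtain ⟨b, hb, hbmax⟩ := h.isCompact.exists_isMaxOn ⟨p, Or.inl h.1.left_mem⟩
    continuous_fst.continuousOn
  have hle : a.1 ≤ b.1 := hamin hb
  rcases hle.lt_or_eq with hlt | heq
  · obtain ⟨A', B', h', hAB⟩ := h.rebase_pair ha hb fun e => hlt.ne (congrArg Prod.fst e)
    rw [← hAB] at hamin hbmax ⊢
    exact h'.exists_bounded_of_extreme hlt (fun z hz => hamin hz) fun z hz => hbmax hz
  · exfalso
    have hx : ∀ z ∈ A ∪ B, z.1 = p.1 := fun z hz => by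
      have h1 : a.1 ≤ z.1 := hamin hz
      have h2 : z.1 ≤ b.1 := hbmax hz
      have h3 : a.1 ≤ p.1 := hamin (Or.inl h.1.left_mem)
      have h4 : p.1 ≤ b.1 := hbmax (Or.inl h.1.left_mem)
      linarith
    have key : ∀ {X}, IsArc X p q → X ⊆ A ∪ B → (p.1, (p.2 + q.2) / 2) ∈ X := by
      intro X hX hsub
      have hmem : (p.2 + q.2) / 2 ∈ Prod.snd '' X := by
        have hc := (hX.isPreconnected.image _ continuous_snd.continuousOn).ordConnected
        rcases le_total p.2 q.2 with hle | hle
        · exact hc.out (mem_image_of_mem _ hX.left_mem) (mem_image_of_mem _ hX.right_mem)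
            ⟨by linarith, by linarith⟩
        · exact hc.out (mem_image_of_mem _ hX.right_mem) (mem_image_of_mem _ hX.left_mem)
            ⟨by linarith, by linarith⟩
      obtain ⟨z, hz, hz2⟩ := hmem
      rwa [← hz2, ← hx z (hsub hz)]
    have hne : p.2 ≠ q.2 := fun e => h.1.ne (Prod.ext (hx q (Or.inl h.1.right_mem)).symm e)
    rcases h.2.2 ⟨key h.1 subset_union_left, key h.2.1 subset_union_right⟩ with e | e
    · have := congrArg Prod.snd e
      simp only at this
      exact hne (by linarith)
    · have := congrArg Prod.snd e
      simp only at this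
      exact hne (by linarith)

theorem isFaceOf_of_frontier {D U : Set (ℝ × ℝ)} (hU : IsPreconnected U) (hne : U.Nonempty)
    (hUD : U ⊆ Dᶜ) (hfr : frontier U ⊆ D) : IsFaceOf D U := by
  obtain ⟨z, hz⟩ := hne
  refine ⟨z, hUD hz, subset_antisymm (hU.subset_connectedComponentIn hz hUD) fun y hy => ?_⟩
  have hc : IsPreconnected (connectedComponentIn Dᶜ z) := isPreconnected_connectedComponentIn
  have hzc := mem_connectedComponentIn (hUD hz)
  refine interior_subset (hc.subset_left_of_subset_union isOpen_interior
    isClosed_closure.isOpen_compl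
    (disjoint_compl_right.mono_left (interior_subset.trans subset_closure)) ?_
    ⟨z, hzc, ?_⟩ hy)
  · intro w hw
    by_contra h
    rw [mem_union, not_or, mem_compl_iff, not_not] at h
    exact connectedComponentIn_subset _ _ hw (hfr ⟨h.2, h.1⟩)
  · by_contra h
    exact hUD hz (hfr ⟨subset_closure hz, h⟩)

theorem mem_face {D : Set (ℝ × ℝ)} {z : ℝ × ℝ} (hz : z ∉ D) :
    IsFaceOf D (connectedComponentIn Dᶜ z) ∧ z ∈ connectedComponentIn Dᶜ z :=
  ⟨⟨z, hz, rfl⟩, mem_connectedComponentIn hz⟩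

/-- The Jordan curve theorem. -/
theorem IsJordan.exists_two_faces {A B : Set (ℝ × ℝ)} {p q : ℝ × ℝ} (h : IsJordan A B p q) :
    ∃ I E, IsFaceOf (A ∪ B) I ∧ IsFaceOf (A ∪ B) E ∧ I ≠ E ∧ Bornology.IsBounded I ∧
      ¬ Bornology.IsBounded E ∧ frontier I = A ∪ B ∧ frontier E = A ∪ B ∧
      ∀ W, IsFaceOf (A ∪ B) W → W = I ∨ W = E := by
  obtain ⟨I, hI, hIb⟩ := h.exists_bounded
  obtain ⟨E, hE, hEb⟩ := exists_unbounded_face h.isCompact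
  have hne : I ≠ E := fun h => hEb (h ▸ hIb)
  refine ⟨I, E, hI, hE, hne, hIb, hEb, h.frontier_eq hI hE hne, h.frontier_eq hE hI hne.symm,
    fun W hW => ?_⟩
  by_cases hb : Bornology.IsBounded W
  · exact Or.inl (h.bounded_unique hW hI hb hIb)
  · exact Or.inr (IsFaceOf.eq_of_unbounded h.isCompact hW hE hb hEb)

theorem IsJordan.exists_other_face {A B : Set (ℝ × ℝ)} {p q : ℝ × ℝ} (h : IsJordan A B p q)
    {U : Set (ℝ × ℝ)} (hU : IsFaceOf (A ∪ B) U) :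
    ∃ W, IsFaceOf (A ∪ B) W ∧ U ≠ W ∧ frontier U = A ∪ B ∧ frontier W = A ∪ B ∧
      ∀ Y, IsFaceOf (A ∪ B) Y → Y = U ∨ Y = W := by
  obtain ⟨I, E, hI, hE, hne, -, -, h1, h2, hall⟩ := h.exists_two_faces
  rcases hall U hU with rfl | rfl
  · exact ⟨E, hE, hne, h1, h2, hall⟩
  · exact ⟨I, hI, hne.symm, h2, h1, fun Y hY => (hall Y hY).symm⟩

theorem theta_half {Z₁ Z₂ P O X : Set (ℝ × ℝ)} {p q : ℝ × ℝ} (hZ : IsJordan Z₁ Z₂ p q)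
    (hP : IsArc P p q) (hPO : P \ {p, q} ⊆ O) (hO : IsFaceOf (Z₁ ∪ Z₂) O)
    (hX : IsFaceOf (Z₁ ∪ Z₂) X) (hXO : O ≠ X) (hXf : frontier X = Z₁ ∪ Z₂)
    (hall : ∀ Y, IsFaceOf (Z₁ ∪ Z₂) Y → Y = O ∨ Y = X) :
    IsJordan Z₁ P p q ∧ ∃ I E, IsFaceOf (Z₁ ∪ P) I ∧ IsFaceOf (Z₁ ∪ P) E ∧
      frontier I = Z₁ ∪ P ∧ X ⊆ E ∧ I ⊆ O \ P ∧ ∀ Y, IsFaceOf (Z₁ ∪ P) Y → Y = E ∨ Y = I := by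
  have hOZ := IsFaceOf.subset_compl hO
  have hXZ := IsFaceOf.subset_compl hX
  have hOX : ∀ z, z ∈ O → z ∉ X := fun z h1 h2 => hXO (IsFaceOf.eq_of_inter hO hX ⟨z, h1, h2⟩)
  have hJ : IsJordan Z₁ P p q := by
    refine ⟨hZ.1, hP, fun z hz => ?_⟩
    by_contra hzn
    exact hOZ (hPO ⟨hz.2, hzn⟩) (Or.inl hz.1)
  have hpq : ∀ z, z = p ∨ z = q → z ∈ Z₁ ∧ z ∈ Z₂ ∧ z ∈ P := by
    rintro z (rfl | rfl)
    · exact ⟨hZ.1.left_mem, hZ.2.1.left_mem, hP.left_mem⟩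
    · exact ⟨hZ.1.right_mem, hZ.2.1.right_mem, hP.right_mem⟩
  have hXP : ∀ z ∈ X, z ∉ P := fun z hz hzP => by
    by_cases h : z = p ∨ z = q
    · exact hXZ hz (Or.inl (hpq z h).1)
    · exact hOX z (hPO ⟨hzP, h⟩) hz
  have hS : IsPreconnected (X ∪ Z₂ \ {p, q}) := by
    refine (IsFaceOf.isPreconnected hX).subset_closure subset_union_left
      (union_subset subset_closure ?_)
    intro z hz
    exact frontier_subset_closure (hXf ▸ Or.inr hz.1)
  have hSJ : X ∪ Z₂ \ {p, q} ⊆ (Z₁ ∪ P)ᶜ := by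
    rintro z (hz | hz) (h | h)
    · exact hXZ hz (Or.inl h)
    · exact hXP z hz h
    · exact hz.2 (hZ.2.2 ⟨h, hz.1⟩)
    · exact hOZ (hPO ⟨h, hz.2⟩) (Or.inr hz.1)
  obtain ⟨E, hE, hXE⟩ := exists_face hS ((IsFaceOf.nonempty hX).mono subset_union_left) hSJ
  obtain ⟨I, hI, hEI, -, hIf, hall'⟩ := hJ.exists_other_face hE
  have hEI' : ∀ z, z ∈ E → z ∉ I := fun z h1 h2 => hEI (IsFaceOf.eq_of_inter hE hI ⟨z, h1, h2⟩)
  refine ⟨hJ, I, E, hI, hE, hIf, subset_union_left.trans hXE, fun z hz => ?_, hall'⟩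
  have hzJ := IsFaceOf.subset_compl hI hz
  have hz2 : z ∉ Z₁ ∪ Z₂ := by
    rintro (h | h)
    · exact hzJ (Or.inl h)
    · by_cases hpq' : z = p ∨ z = q
      · exact hzJ (Or.inl (hpq z hpq').1)
      · exact hEI' z (hXE (Or.inr ⟨h, hpq'⟩)) hz
  obtain ⟨hf, hzf⟩ := mem_face hz2
  refine ⟨?_, fun h => hzJ (Or.inr h)⟩
  rcases hall _ hf with h | h
  · exact h ▸ hzf
  · exact absurd hz (hEI' z (hXE (Or.inl (h ▸ hzf))))

/-- The three faces of a theta graph. -/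
theorem theta {Z₁ Z₂ P O : Set (ℝ × ℝ)} {p q : ℝ × ℝ} (hZ : IsJordan Z₁ Z₂ p q)
    (hP : IsArc P p q) (hPO : P \ {p, q} ⊆ O) (hO : IsFaceOf (Z₁ ∪ Z₂) O) :
    ∃ I₁ I₂, IsFaceOf (Z₁ ∪ P) I₁ ∧ IsFaceOf (Z₂ ∪ P) I₂ ∧ I₁ ≠ I₂ ∧ frontier I₁ = Z₁ ∪ P ∧
      frontier I₂ = Z₂ ∪ P ∧ I₁ ∪ I₂ = O \ P := by
  obtain ⟨X, hX, hXO, hOf, hXf, hall⟩ := hZ.exists_other_face hO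
  have hOZ := IsFaceOf.subset_compl hO
  have hXZ := IsFaceOf.subset_compl hX
  obtain ⟨hJ₁, I₁, E₁, hI₁, hE₁, hf₁, hXE₁, hIO₁, hall₁⟩ := theta_half hZ hP hPO hO hX hXO hXf hall
  obtain ⟨hJ₂, I₂, E₂, hI₂, hE₂, hf₂, hXE₂, hIO₂, hall₂⟩ :=
    theta_half hZ.swap hP hPO (by rwa [union_comm]) (by rwa [union_comm]) hXO
      (by rwa [union_comm]) (by rwa [union_comm])
  refine ⟨I₁, I₂, hI₁, hI₂, ?_, hf₁, hf₂, subset_antisymm (union_subset hIO₁ hIO₂) ?_⟩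
  · rintro rfl
    obtain ⟨z, hz, hzpq⟩ := hZ.1.nonempty_diff
    have : z ∈ Z₂ ∪ P := by rw [← hf₂, hf₁]; exact Or.inl hz
    rcases this with h | h
    · exact hzpq (hZ.2.2 ⟨hz, h⟩)
    · exact hzpq (hJ₁.2.2 ⟨hz, h⟩)
  · rintro z ⟨hzO, hzP⟩
    by_contra hzI
    rw [mem_union, not_or] at hzI
    obtain ⟨x, hx⟩ := IsFaceOf.nonempty hX
    have hz1 : z ∈ E₁ := by
      obtain ⟨hf, hzf⟩ := mem_face (D := Z₁ ∪ P) (z := z)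
        (by rintro (h | h); exacts [hOZ hzO (Or.inl h), hzP h])
      rcases hall₁ _ hf with h | h
      · exact h ▸ hzf
      · exact absurd (h ▸ hzf) hzI.1
    have hz2 : z ∈ E₂ := by
      obtain ⟨hf, hzf⟩ := mem_face (D := Z₂ ∪ P) (z := z)
        (by rintro (h | h); exacts [hOZ hzO (Or.inr h), hzP h])
      rcases hall₂ _ hf with h | h
      · exact h ▸ hzf
      · exact absurd (h ▸ hzf) hzI.2
    have hPc : (Z₁ ∪ P) ∩ (Z₂ ∪ P) = P := by
      refine subset_antisymm ?_ (subset_inter subset_union_right subset_union_right)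
      rintro w ⟨h1 | h1, h2 | h2⟩
      · rcases hZ.2.2 ⟨h1, h2⟩ with rfl | rfl
        exacts [hP.left_mem, hP.right_mem]
      all_goals assumption
    have key := component_eq_union hJ₁.isCompact hJ₂.isCompact (a := z) (b := x)
      (by rw [hPc]; exact hP.isPreconnected)
      (IsFaceOf.isPreconnected hE₁) (disjoint_left.2 fun w hw => IsFaceOf.subset_compl hE₁ hw)
      hz1 (hXE₁ hx)
      (IsFaceOf.isPreconnected hE₂) (disjoint_left.2 fun w hw => IsFaceOf.subset_compl hE₂ hw)
      hz2 (hXE₂ hx)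
    have hXf' : IsFaceOf ((Z₁ ∪ P) ∪ (Z₂ ∪ P)) X := by
      refine isFaceOf_of_frontier (IsFaceOf.isPreconnected hX) (IsFaceOf.nonempty hX) ?_ ?_
      · rintro w hw (h | h)
        · exact IsFaceOf.subset_compl hE₁ (hXE₁ hw) h
        · exact IsFaceOf.subset_compl hE₂ (hXE₂ hw) h
      · rw [hXf]
        exact union_subset_union subset_union_left subset_union_left
    have hzU : z ∉ (Z₁ ∪ P) ∪ (Z₂ ∪ P) := by
      rintro (h | h)
      · exact IsFaceOf.subset_compl hE₁ hz1 h
      · exact IsFaceOf.subset_compl hE₂ hz2 h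
    obtain ⟨hf, hzf⟩ := mem_face hzU
    have hxz : x ∈ connectedComponentIn ((Z₁ ∪ P) ∪ (Z₂ ∪ P))ᶜ z := by
      rw [key]
      exact mem_connectedComponentIn (IsFaceOf.subset_compl hXf' hx)
    have := IsFaceOf.eq_of_inter hf hXf' ⟨x, hxz, hx⟩
    rw [this] at hzf
    exact hXO (IsFaceOf.eq_of_inter hO hX ⟨z, hzO, hzf⟩)

/-- Adding an arc across a face whose boundary is a closed curve. -/
theorem faces_add_arc {D Z₁ Z₂ P O : Set (ℝ × ℝ)} {p q : ℝ × ℝ} (hD : IsClosed D)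
    (hO : IsFaceOf D O) (hOf : frontier O = Z₁ ∪ Z₂) (hZ : IsJordan Z₁ Z₂ p q)
    (hP : IsArc P p q) (hPO : P \ {p, q} ⊆ O) :
    ∃ I₁ I₂, I₁ ≠ I₂ ∧ frontier I₁ = Z₁ ∪ P ∧ frontier I₂ = Z₂ ∪ P ∧ I₁ ∪ I₂ = O \ P ∧
      ∀ g, IsFaceOf (D ∪ P) g ↔ g = I₁ ∨ g = I₂ ∨ (IsFaceOf D g ∧ g ≠ O) := by
  have hZD : Z₁ ∪ Z₂ ⊆ D := hOf ▸ IsFaceOf.frontier_subset hD hO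
  have hOZ : IsFaceOf (Z₁ ∪ Z₂) O :=
    isFaceOf_of_frontier (IsFaceOf.isPreconnected hO) (IsFaceOf.nonempty hO)
      ((IsFaceOf.subset_compl hO).trans (compl_subset_compl.2 hZD)) hOf.subset
  obtain ⟨I₁, I₂, hI₁, hI₂, hne, hf₁, hf₂, hu⟩ := theta hZ hP hPO hOZ
  have hOD := IsFaceOf.subset_compl hO
  have hI : ∀ I, I ⊆ O \ P → I ⊆ (D ∪ P)ᶜ := fun I hI z hz => by
    rintro (h | h)
    exacts [hOD (hI hz).1 h, (hI hz).2 h]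
  have hF₁ : IsFaceOf (D ∪ P) I₁ :=
    isFaceOf_of_frontier (IsFaceOf.isPreconnected hI₁) (IsFaceOf.nonempty hI₁)
      (hI _ (hu ▸ subset_union_left))
      (hf₁ ▸ union_subset_union_left _ (subset_union_left.trans hZD))
  have hF₂ : IsFaceOf (D ∪ P) I₂ :=
    isFaceOf_of_frontier (IsFaceOf.isPreconnected hI₂) (IsFaceOf.nonempty hI₂)
      (hI _ (hu ▸ subset_union_right))
      (hf₂ ▸ union_subset_union_left _ (subset_union_right.trans hZD))
  refine ⟨I₁, I₂, hne, hf₁, hf₂, hu, fun g => ⟨fun hg => ?_, ?_⟩⟩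
  · obtain ⟨f, hf, hgf⟩ := exists_face (IsFaceOf.isPreconnected hg) (IsFaceOf.nonempty hg)
      ((IsFaceOf.subset_compl hg).trans (compl_subset_compl.2 subset_union_left))
    by_cases hfO : f = O
    · subst hfO
      obtain ⟨z, hz⟩ := IsFaceOf.nonempty hg
      have : z ∈ I₁ ∪ I₂ := hu ▸ ⟨hgf hz, fun h => IsFaceOf.subset_compl hg hz (Or.inr h)⟩
      rcases this with h | h
      · exact Or.inl (IsFaceOf.eq_of_inter hg hF₁ ⟨z, hz, h⟩)
      · exact Or.inr (Or.inl (IsFaceOf.eq_of_inter hg hF₂ ⟨z, hz, h⟩))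
    · refine Or.inr (Or.inr ?_)
      have hfP : f ⊆ (D ∪ P)ᶜ := by
        rintro z hz (h | h)
        · exact IsFaceOf.subset_compl hf hz h
        · by_cases h' : z = p ∨ z = q
          · refine IsFaceOf.subset_compl hf hz (hZD (Or.inl ?_))
            rcases h' with rfl | rfl
            exacts [hZ.1.left_mem, hZ.1.right_mem]
          · exact hfO (IsFaceOf.eq_of_inter hf hO ⟨z, hz, hPO ⟨h, h'⟩⟩)
      have hfF : IsFaceOf (D ∪ P) f :=
        isFaceOf_of_frontier (IsFaceOf.isPreconnected hf) (IsFaceOf.nonempty hf) hfP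
          ((IsFaceOf.frontier_subset hD hf).trans subset_union_left)
      obtain ⟨z, hz⟩ := IsFaceOf.nonempty hg
      have := IsFaceOf.eq_of_inter hg hfF ⟨z, hz, hgf hz⟩
      rw [this]
      exact ⟨hf, hfO⟩
  · rintro (rfl | rfl | ⟨hf, hfO⟩)
    · exact hF₁
    · exact hF₂
    · refine isFaceOf_of_frontier (IsFaceOf.isPreconnected hf) (IsFaceOf.nonempty hf) ?_
          ((IsFaceOf.frontier_subset hD hf).trans subset_union_left)
      rintro z hz (h | h)
      · exact IsFaceOf.subset_compl hf hz h
      · by_cases h' : z = p ∨ z = q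
        · refine IsFaceOf.subset_compl hf hz (hZD (Or.inl ?_))
          rcases h' with rfl | rfl
          exacts [hZ.1.left_mem, hZ.1.right_mem]
        · exact hfO (IsFaceOf.eq_of_inter hf hO ⟨z, hz, hPO ⟨h, h'⟩⟩)

section Drawing

variable {V : Type*} {G : SimpleGraph V} (emb : PlaneEmbedding G)

/-- The point set of a set of edges. -/
def drawE (F : Set (Sym2 V)) : Set (ℝ × ℝ) := ⋃ e ∈ F, arcSet emb e

/-- The relative interior of the arc of an edge. -/
def inner (e : Sym2 V) : Set (ℝ × ℝ) := arcSet emb e \ emb.pos '' {v | v ∈ e}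

theorem isArc_arcSet {u v : V} (h : G.Adj u v) :
    IsArc (arcSet emb s(u, v)) (emb.pos u) (emb.pos v) := emb.arc_curve u v h

theorem inner_mk (u v : V) : inner emb s(u, v) = arcSet emb s(u, v) \ {emb.pos u, emb.pos v} := by
  have : {w | w ∈ s(u, v)} = {u, v} := by ext w; simp
  rw [inner, this, image_pair]

theorem pos_mem_arcSet {e : Sym2 V} (he : e ∈ G.edgeSet) {v : V} :
    emb.pos v ∈ arcSet emb e ↔ v ∈ e := by
  induction e with | _ a b =>
  refine ⟨fun h => by simpa using emb.arc_vertex a b he v h, fun h => ?_⟩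
  rcases Sym2.mem_iff.1 h with rfl | rfl
  exacts [(isArc_arcSet emb he).left_mem, (isArc_arcSet emb he).right_mem]

theorem arcSet_inter {e e' : Sym2 V} (he : e ∈ G.edgeSet) (he' : e' ∈ G.edgeSet) (hne : e ≠ e')
    {z : ℝ × ℝ} (hz : z ∈ arcSet emb e) (hz' : z ∈ arcSet emb e') :
    ∃ v, v ∈ e ∧ v ∈ e' ∧ z = emb.pos v := by
  obtain ⟨v, rfl⟩ : z ∈ range emb.pos := by
    induction e with | _ a b =>
    induction e' with | _ a' b' =>
    exact emb.arc_inter a b a' b' he he' hne ⟨hz, hz'⟩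
  exact ⟨v, (pos_mem_arcSet emb he).1 hz, (pos_mem_arcSet emb he').1 hz', rfl⟩

theorem isPreconnected_inner {e : Sym2 V} (he : e ∈ G.edgeSet) : IsPreconnected (inner emb e) := by
  induction e with | _ a b =>
  rw [inner_mk]
  exact (isArc_arcSet emb he).isPreconnected_diff

theorem closure_inner {e : Sym2 V} (he : e ∈ G.edgeSet) :
    closure (inner emb e) = arcSet emb e := by
  induction e with | _ a b =>
  rw [inner_mk]
  exact (isArc_arcSet emb he).closure_diff

theorem inner_nonempty {e : Sym2 V} (he : e ∈ G.edgeSet) : (inner emb e).Nonempty := by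
  induction e with | _ a b =>
  rw [inner_mk]
  exact (isArc_arcSet emb he).nonempty_diff

theorem pos_notMem_inner {e : Sym2 V} (he : e ∈ G.edgeSet) (v : V) :
    emb.pos v ∉ inner emb e := fun h =>
  h.2 ⟨v, (pos_mem_arcSet emb he).1 h.1, rfl⟩

theorem mem_of_inner {e : Sym2 V} (he : e ∈ G.edgeSet) {F : Set (Sym2 V)} (hF : F ⊆ G.edgeSet)
    {z : ℝ × ℝ} (hz : z ∈ inner emb e) (hzF : z ∈ drawE emb F) : e ∈ F := by
  obtain ⟨e', he', hz'⟩ := mem_iUnion₂.1 hzF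
  by_contra h
  obtain ⟨v, h1, -, rfl⟩ := arcSet_inter emb he (hF he') (by rintro rfl; exact h he') hz.1 hz'
  exact pos_notMem_inner emb he v hz

theorem pos_mem_drawE {F : Set (Sym2 V)} (hF : F ⊆ G.edgeSet) {v : V} :
    emb.pos v ∈ drawE emb F ↔ ∃ e ∈ F, v ∈ e := by
  refine ⟨fun h => ?_, fun ⟨e, he, hv⟩ => mem_iUnion₂.2 ⟨e, he, (pos_mem_arcSet emb (hF he)).2 hv⟩⟩
  obtain ⟨e', he', hz'⟩ := mem_iUnion₂.1 h
  exact ⟨e', he', (pos_mem_arcSet emb (hF he')).1 hz'⟩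

theorem drawE_union (F F' : Set (Sym2 V)) : drawE emb (F ∪ F') = drawE emb F ∪ drawE emb F' :=
  biUnion_union _ _ _

theorem drawE_mono {F F' : Set (Sym2 V)} (h : F ⊆ F') : drawE emb F ⊆ drawE emb F' :=
  biUnion_mono h fun _ _ => subset_rfl

theorem arcSet_subset_drawE {F : Set (Sym2 V)} {e : Sym2 V} (h : e ∈ F) :
    arcSet emb e ⊆ drawE emb F := subset_biUnion_of_mem (u := fun e => arcSet emb e) h

theorem arcSet_subset_drawE_iff {F : Set (Sym2 V)} (hF : F ⊆ G.edgeSet) {e : Sym2 V}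
    (he : e ∈ G.edgeSet) : arcSet emb e ⊆ drawE emb F ↔ e ∈ F := by
  refine ⟨fun h => ?_, arcSet_subset_drawE emb⟩
  obtain ⟨z, hz⟩ := inner_nonempty emb he
  exact mem_of_inner emb he hF hz (h hz.1)

theorem isCompact_arcSet {e : Sym2 V} (he : e ∈ G.edgeSet) : IsCompact (arcSet emb e) := by
  induction e with | _ a b => exact (isArc_arcSet emb he).isCompact

theorem isCompact_drawE [Finite V] {F : Set (Sym2 V)} (hF : F ⊆ G.edgeSet) :
    IsCompact (drawE emb F) :=
  (toFinite F).isCompact_biUnion fun _ he => isCompact_arcSet emb (hF he)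

theorem drawE_inter {F F' : Set (Sym2 V)} (hF : F ⊆ G.edgeSet) (hF' : F' ⊆ G.edgeSet)
    (hd : Disjoint F F') {z : ℝ × ℝ} (hz : z ∈ drawE emb F) (hz' : z ∈ drawE emb F') :
    ∃ v, (∃ e ∈ F, v ∈ e) ∧ (∃ e ∈ F', v ∈ e) ∧ z = emb.pos v := by
  obtain ⟨e, he, hz⟩ := mem_iUnion₂.1 hz
  obtain ⟨e', he', hz'⟩ := mem_iUnion₂.1 hz'
  obtain ⟨v, h1, h2, rfl⟩ := arcSet_inter emb (hF he) (hF' he')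
    (by rintro rfl; exact disjoint_left.1 hd he he') hz hz'
  exact ⟨v, ⟨e, he, h1⟩, ⟨e', he', h2⟩, rfl⟩

/-- The edge set of a walk. -/
def wEdges {u v : V} (p : G.Walk u v) : Set (Sym2 V) := {e | e ∈ p.edges}

theorem wEdges_subset {u v : V} (p : G.Walk u v) : wEdges p ⊆ G.edgeSet :=
  fun _ he => p.edges_subset_edgeSet he

theorem mem_support_of_wEdges {u v : V} {p : G.Walk u v} {w : V} (h : ∃ e ∈ wEdges p, w ∈ e) :
    w ∈ p.support := by
  obtain ⟨e, he, hw⟩ := h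
  exact SimpleGraph.Walk.mem_support_of_mem_edges he hw

theorem isArc_path : ∀ {u v : V} (p : G.Walk u v), p.IsPath → u ≠ v →
    IsArc (drawE emb (wEdges p)) (emb.pos u) (emb.pos v)
  | _, _, .nil, _, h => absurd rfl h
  | u, v, .cons (v := w) h p, hp, _ => by
    rw [SimpleGraph.Walk.cons_isPath_iff] at hp
    have he : drawE emb (wEdges (SimpleGraph.Walk.cons h p)) =
        arcSet emb s(u, w) ∪ drawE emb (wEdges p) := by
      have : wEdges (SimpleGraph.Walk.cons h p) = {s(u, w)} ∪ wEdges p := by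
        ext e; simp [wEdges]
      rw [this, drawE_union]
      simp [drawE]
    rw [he]
    by_cases hwv : w = v
    · subst hwv
      obtain rfl := (SimpleGraph.Walk.isPath_iff_nil.1 hp.1).eq_nil
      simpa [wEdges, drawE] using isArc_arcSet emb h
    · refine (isArc_arcSet emb h).trans (isArc_path p hp.1 hwv) fun z hz => ?_
      have h1 : s(u, w) ∉ wEdges p := fun h' =>
        hp.2 (SimpleGraph.Walk.fst_mem_support_of_mem_edges p h')
      obtain ⟨x, hx, hx', rfl⟩ := drawE_inter emb (F := {s(u, w)}) (F' := wEdges p)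
        (by simpa using h) (wEdges_subset p) (by simpa using h1)
        (by simpa [drawE] using hz.1) hz.2
      have hx2 := mem_support_of_wEdges hx'
      simp only [mem_singleton_iff, exists_eq_left, Sym2.mem_iff] at hx
      rcases hx with rfl | rfl
      · exact absurd hx2 hp.2
      · rfl

theorem isJordan_paths {u v : V} {p q : G.Walk u v} (hp : p.IsPath) (hq : q.IsPath) (huv : u ≠ v)
    (hd : Disjoint (wEdges p) (wEdges q))
    (hs : ∀ w, w ∈ p.support → w ∈ q.support → w = u ∨ w = v) :
    IsJordan (drawE emb (wEdges p)) (drawE emb (wEdges q)) (emb.pos u) (emb.pos v) := by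
  refine ⟨isArc_path emb p hp huv, isArc_path emb q hq huv, fun z hz => ?_⟩
  obtain ⟨x, hx, hx', rfl⟩ := drawE_inter emb (wEdges_subset p) (wEdges_subset q) hd hz.1 hz.2
  rcases hs x (mem_support_of_wEdges hx) (mem_support_of_wEdges hx') with rfl | rfl <;> simp

end Drawing

section CycleSet

variable {V : Type*} {G : SimpleGraph V}

/-- An edge set of a cycle. -/
def IsCycleSet (G : SimpleGraph V) (Z : Set (Sym2 V)) : Prop :=
  ∃ (u : V) (W : G.Walk u u), W.IsCycle ∧ Z = wEdges W

end CycleSet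

section CycleSplit

variable {V : Type*} {G : SimpleGraph V}

theorem wEdges_append {u v w : V} (p : G.Walk u v) (q : G.Walk v w) :
    wEdges (p.append q) = wEdges p ∪ wEdges q := by
  ext e; simp [wEdges]

theorem wEdges_reverse {u v : V} (p : G.Walk u v) : wEdges p.reverse = wEdges p := by
  ext e; simp [wEdges]

theorem wEdges_cons {u v w : V} (h : G.Adj u v) (p : G.Walk v w) :
    wEdges (SimpleGraph.Walk.cons h p) = insert s(u, v) (wEdges p) := by
  ext e; simp [wEdges]

theorem mem_support_iff_wEdges {u v : V} {p : G.Walk u v} (hp : ¬ p.Nil) {w : V} :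
    w ∈ p.support ↔ ∃ e ∈ wEdges p, w ∈ e := by
  exact SimpleGraph.Walk.mem_support_iff_exists_mem_edges_of_not_nil hp

theorem tail_support_append {u v w : V} (p : G.Walk u v) (q : G.Walk v w) :
    (p.append q).support.tail = p.support.tail ++ q.support.tail := by
  rw [SimpleGraph.Walk.support_append, List.tail_append_of_ne_nil (by simp)]

theorem isPath_append {u v w : V} {p : G.Walk u v} {q : G.Walk v w} (hp : p.IsPath)
    (hq : q.IsPath) (h : ∀ x ∈ p.support, x ∈ q.support → x = v) : (p.append q).IsPath := by
  rw [SimpleGraph.Walk.isPath_def, SimpleGraph.Walk.support_append]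
  have hq' := hq.support_nodup
  rw [← SimpleGraph.Walk.cons_tail_support, List.nodup_cons] at hq'
  refine List.nodup_append'.2 ⟨hp.support_nodup, hq'.2, fun x hx hx' => ?_⟩
  obtain rfl := h x hx (List.mem_of_mem_tail hx')
  exact hq'.1 hx'

theorem IsCycleSet.of_paths {a b : V} {p q : G.Walk a b} (hp : p.IsPath) (hq : q.IsPath)
    (hab : a ≠ b) (hd : Disjoint (wEdges p) (wEdges q))
    (hs : ∀ w, w ∈ p.support → w ∈ q.support → w = a ∨ w = b) :
    IsCycleSet G (wEdges p ∪ wEdges q) := by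
  refine ⟨a, p.append q.reverse, ?_, by rw [wEdges_append, wEdges_reverse]⟩
  rw [SimpleGraph.Walk.isCycle_def]
  refine ⟨?_, ?_, ?_⟩
  · rw [SimpleGraph.Walk.isTrail_def, SimpleGraph.Walk.edges_append]
    refine List.nodup_append'.2 ⟨hp.isTrail.edges_nodup, ?_, fun e he he' => ?_⟩
    · simpa using hq.isTrail.edges_nodup
    · exact disjoint_left.1 hd he (by simpa [wEdges] using he')
  · intro h
    have := congrArg SimpleGraph.Walk.length h
    rw [SimpleGraph.Walk.length_append, SimpleGraph.Walk.length_nil] at this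
    exact hab (SimpleGraph.Walk.eq_of_length_eq_zero (p := p) (by omega))
  · rw [tail_support_append]
    have h1 := hp.support_nodup
    have h2 := hq.reverse.support_nodup
    rw [← SimpleGraph.Walk.cons_tail_support, List.nodup_cons] at h1 h2
    refine List.nodup_append'.2 ⟨h1.2, h2.2, fun x hx hx' => ?_⟩
    have hx2 : x ∈ q.support := by simpa using List.mem_of_mem_tail hx'
    rcases hs x (List.mem_of_mem_tail hx) hx2 with rfl | rfl
    · exact h1.1 hx
    · exact h2.1 hx'

theorem IsCycleSet.split {Z : Set (Sym2 V)} (hZ : IsCycleSet G Z) {a b : V} (hab : a ≠ b)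
    (ha : ∃ e ∈ Z, a ∈ e) (hb : ∃ e ∈ Z, b ∈ e) :
    ∃ p q : G.Walk a b, p.IsPath ∧ q.IsPath ∧ Disjoint (wEdges p) (wEdges q) ∧
      (∀ w, w ∈ p.support → w ∈ q.support → w = a ∨ w = b) ∧ Z = wEdges p ∪ wEdges q := by
  obtain ⟨u, W, hW, rfl⟩ := hZ
  have ha' := mem_support_of_wEdges ha
  have hb' := mem_support_of_wEdges hb
  set W' := W.rotate a ha' with hW'
  have hc : W'.IsCycle := (SimpleGraph.Walk.isCycle_rotate ha').2 hW
  have hbW : b ∈ W'.support := (SimpleGraph.Walk.mem_support_rotate_iff W a ha').2 hb'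
  have hE : wEdges W = wEdges W' := by
    ext e
    exact ((SimpleGraph.Walk.rotate_edges W a ha').mem_iff).symm
  have hspec := SimpleGraph.Walk.take_spec W' hbW
  have hpn : ¬ (W'.takeUntil b hbW).Nil := SimpleGraph.Walk.not_nil_of_ne hab
  have hq : (W'.dropUntil b hbW).IsPath :=
    SimpleGraph.Walk.IsCycle.isPath_of_append_right hpn (by rw [hspec]; exact hc)
  have hnd := hc.support_nodup
  rw [← hspec, tail_support_append, List.nodup_append'] at hnd
  refine ⟨W'.takeUntil b hbW, (W'.dropUntil b hbW).reverse, hc.isPath_takeUntil hbW, hq.reverse,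
    ?_, fun w hw hw' => ?_, ?_⟩
  · rw [wEdges_reverse]
    exact disjoint_left.2 fun e he he' =>
      hc.isTrail.disjoint_edges_takeUntil_dropUntil hbW he he'
  · rw [SimpleGraph.Walk.support_reverse, List.mem_reverse] at hw'
    rw [SimpleGraph.Walk.mem_support_iff] at hw hw'
    rcases hw with rfl | hw
    · exact Or.inl rfl
    rcases hw' with rfl | hw'
    · exact Or.inr rfl
    · exact absurd hw' (hnd.2.2 hw)
  · rw [hE, wEdges_reverse, ← wEdges_append, hspec]

end CycleSplit

section Ears

variable {V : Type*} {G : SimpleGraph V} (emb : PlaneEmbedding G)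

theorem inner_path_subset_compl {F : Set (Sym2 V)} (hF : F ⊆ G.edgeSet) {a b : V}
    {P : G.Walk a b} (hd : Disjoint (wEdges P) F)
    (hs : ∀ w ∈ P.support, (∃ e ∈ F, w ∈ e) → w = a ∨ w = b) :
    drawE emb (wEdges P) \ {emb.pos a, emb.pos b} ⊆ (drawE emb F)ᶜ := by
  rintro z ⟨hz, hzn⟩ hzF
  obtain ⟨v, h1, h2, rfl⟩ := drawE_inter emb (wEdges_subset P) hF hd hz hzF
  rcases hs v (mem_support_of_wEdges h1) h2 with rfl | rfl <;> exact hzn (by simp)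

theorem mem_frontier_of_face {D f : Set (ℝ × ℝ)} (hD : IsClosed D) (hf : IsFaceOf D f)
    {z : ℝ × ℝ} (hz : z ∈ closure f) (hzD : z ∈ D) : z ∈ frontier f := by
  rw [IsFaceOf.closure_eq hD hf] at hz
  exact hz.resolve_left fun h => IsFaceOf.subset_compl hf h hzD

theorem IsCycleSet.exists_jordan {Z : Set (Sym2 V)} (hZ : IsCycleSet G Z) :
    ∃ A B p q, IsJordan A B p q ∧ A ∪ B = drawE emb Z := by
  obtain ⟨a, b, hab, e, he, hae, hbe⟩ : ∃ a b, a ≠ b ∧ ∃ e ∈ Z, a ∈ e ∧ b ∈ e := by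
    obtain ⟨u, W, hW, rfl⟩ := hZ
    cases W with
    | nil => exact absurd hW SimpleGraph.Walk.not_isCycle_nil
    | @cons _ w _ h p => exact ⟨u, w, h.ne, s(u, w), by simp [wEdges], by simp, by simp⟩
  obtain ⟨p, q, hp, hq, hpq, hpqs, rfl⟩ := hZ.split hab ⟨e, he, hae⟩ ⟨e, he, hbe⟩
  exact ⟨_, _, _, _, isJordan_paths emb hp hq hab hpq hpqs, by rw [drawE_union]⟩

/-- The plane subgraph with edge set `F` has finitely many faces, each bounded by a cycle. -/
def CycleBounded (F : Set (Sym2 V)) : Prop :=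
  F ⊆ G.edgeSet ∧ {g | IsFaceOf (drawE emb F) g}.Finite ∧
    ∀ g, IsFaceOf (drawE emb F) g → ∃ Z ⊆ F, IsCycleSet G Z ∧ frontier g = drawE emb Z

theorem CycleBounded.of_cycle {x : V} {C : G.Walk x x} (hC : C.IsCycle) :
    CycleBounded emb (wEdges C) := by
  obtain ⟨A, B, p, q, hJ, hAB⟩ := IsCycleSet.exists_jordan emb ⟨x, C, hC, rfl⟩
  obtain ⟨I, E, -, -, -, -, -, h1, h2, hall⟩ := hJ.exists_two_faces
  rw [hAB] at h1 h2 hall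
  refine ⟨wEdges_subset C, (toFinite {I, E}).subset hall, fun g hg =>
    ⟨wEdges C, subset_rfl, ⟨x, C, hC, rfl⟩, ?_⟩⟩
  rcases hall g hg with rfl | rfl
  exacts [h1, h2]

variable [Fintype V]

theorem CycleBounded.add_path {F : Set (Sym2 V)} (hF : CycleBounded emb F) {a b : V}
    {P : G.Walk a b} (hP : P.IsPath) (hab : a ≠ b) (hd : Disjoint (wEdges P) F)
    (ha : ∃ e ∈ F, a ∈ e) (hb : ∃ e ∈ F, b ∈ e)
    (hs : ∀ w ∈ P.support, (∃ e ∈ F, w ∈ e) → w = a ∨ w = b) :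
    CycleBounded emb (F ∪ wEdges P) := by
  obtain ⟨hFE, hfin, hcyc⟩ := hF
  have hD : IsClosed (drawE emb F) := (isCompact_drawE emb hFE).isClosed
  have hA := isArc_path emb P hP hab
  obtain ⟨O, hO, hPO⟩ := exists_face hA.isPreconnected_diff hA.nonempty_diff
    (inner_path_subset_compl emb hFE hd hs)
  obtain ⟨Z, hZF, hZ, hfr⟩ := hcyc O hO
  have hcl : drawE emb (wEdges P) ⊆ closure O := by
    rw [← hA.closure_diff]
    exact closure_mono hPO
  have haZ : ∃ e ∈ Z, a ∈ e := by
    rw [← pos_mem_drawE emb (hZF.trans hFE), ← hfr]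
    exact mem_frontier_of_face hD hO (hcl hA.left_mem) ((pos_mem_drawE emb hFE).2 ha)
  have hbZ : ∃ e ∈ Z, b ∈ e := by
    rw [← pos_mem_drawE emb (hZF.trans hFE), ← hfr]
    exact mem_frontier_of_face hD hO (hcl hA.right_mem) ((pos_mem_drawE emb hFE).2 hb)
  obtain ⟨p, q, hp, hq, hpq, hpqs, rfl⟩ := hZ.split hab haZ hbZ
  have hJ := isJordan_paths emb hp hq hab hpq hpqs
  rw [drawE_union] at hfr
  obtain ⟨I₁, I₂, -, hf₁, hf₂, -, hall⟩ := faces_add_arc hD hO hfr hJ hA hPO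
  have hcs : ∀ r : G.Walk a b, r.IsPath → wEdges r ⊆ F → IsCycleSet G (wEdges r ∪ wEdges P) := by
    intro r hr hrF
    refine IsCycleSet.of_paths hr hP hab (hd.symm.mono_left hrF) fun w hw hwP => ?_
    rw [mem_support_iff_wEdges (SimpleGraph.Walk.not_nil_of_ne hab)] at hw
    obtain ⟨e, he, hwe⟩ := hw
    exact hs w hwP ⟨e, hrF he, hwe⟩
  refine ⟨union_subset hFE (wEdges_subset P), ?_, fun g hg => ?_⟩
  · refine ((hfin.insert I₂).insert I₁).subset fun g hg => ?_
    rw [mem_ofPred_eq, drawE_union] at hg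
    rcases (hall g).1 hg with h | h | h
    · exact Or.inl h
    · exact Or.inr (Or.inl h)
    · exact Or.inr (Or.inr h.1)
  · rw [drawE_union] at hg
    rcases (hall g).1 hg with rfl | rfl | ⟨h, -⟩
    · exact ⟨_, union_subset_union_left _ (subset_union_left.trans hZF),
        hcs p hp (subset_union_left.trans hZF), by rw [hf₁, drawE_union]⟩
    · exact ⟨_, union_subset_union_left _ (subset_union_right.trans hZF),
        hcs q hq (subset_union_right.trans hZF), by rw [hf₂, drawE_union]⟩
    · obtain ⟨Z, h1, h2⟩ := hcyc g h
      exact ⟨Z, h1.trans subset_union_left, h2⟩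

/-- The edges of `C` together with all edges at the vertices of `S`. -/
def legs {x : V} (C : G.Walk x x) (S : Finset V) : Set (Sym2 V) :=
  wEdges C ∪ {e | e ∈ G.edgeSet ∧ ∃ w ∈ S, w ∈ e}

theorem CycleBounded.legs {x : V} {C : G.Walk x x} (hC : C.IsCycle) (hI : IsIsolating G C)
    (S : Finset V) (hS : ∀ w ∈ S, w ∉ C.support) : CycleBounded emb (legs C S) := by
  induction S using Finset.induction_on with
  | empty => simpa [PlaneTopology.legs] using CycleBounded.of_cycle emb hC
  | insert w S hw ih =>
    have ih := ih fun v hv => hS v (Finset.mem_insert_of_mem hv)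
    have hwC := hS w (Finset.mem_insert_self _ _)
    obtain ⟨h3, hN⟩ := hI w hwC
    obtain ⟨a, b, c, hab, hac, hbc, habc⟩ := Finset.card_eq_three.1 h3
    have hadj : ∀ v, G.Adj w v ↔ v = a ∨ v = b ∨ v = c := fun v => by
      have := Finset.ext_iff.1 habc v
      simpa using this
    have ha := (hadj a).2 (by simp)
    have hb := (hadj b).2 (by simp)
    have hc := (hadj c).2 (by simp)
    have hmem : ∀ v ∈ C.support, ∀ T, ∃ e ∈ PlaneTopology.legs C T, v ∈ e := by
      intro v hv T
      obtain ⟨e, he, hve⟩ := (mem_support_iff_wEdges hC.not_nil).1 hv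
      exact ⟨e, Or.inl he, hve⟩
    have hwn : ∀ e ∈ PlaneTopology.legs C S, w ∉ e := by
      rintro e (he | ⟨he, v, hv, hve⟩) hwe
      · exact hwC (SimpleGraph.Walk.mem_support_of_mem_edges he hwe)
      · have hne : w ≠ v := by rintro rfl; exact hw hv
        obtain rfl := (Sym2.mem_and_mem_iff hne).1 ⟨hwe, hve⟩
        exact hS v (Finset.mem_insert_of_mem hv) (hN v he)
    have h1 : CycleBounded emb (PlaneTopology.legs C S ∪ wEdges
        (SimpleGraph.Walk.cons ha.symm (SimpleGraph.Walk.cons hb SimpleGraph.Walk.nil))) := by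
      refine ih.add_path emb ?_ hab ?_ (hmem a (hN a ha) S) (hmem b (hN b hb) S) ?_
      · simp [SimpleGraph.Walk.cons_isPath_iff, ha.ne', hb.ne, hab]
      · rw [wEdges_cons, wEdges_cons]
        refine disjoint_left.2 fun e he heF => hwn e heF ?_
        rcases he with rfl | rfl | he
        · simp
        · simp
        · simp [wEdges] at he
      · intro v hv ⟨e, he, hve⟩
        simp only [SimpleGraph.Walk.support_cons, SimpleGraph.Walk.support_nil, List.mem_cons,
          List.not_mem_nil, or_false] at hv
        rcases hv with rfl | rfl | rfl
        · exact Or.inl rfl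
        · exact absurd hve (hwn e he)
        · exact Or.inr rfl
    have h2 := h1.add_path emb (P := SimpleGraph.Walk.cons hc SimpleGraph.Walk.nil)
      (by simp [SimpleGraph.Walk.cons_isPath_iff, hc.ne]) hc.ne ?_
      ⟨s(w, b), Or.inr (by simp [wEdges]), by simp⟩
      (by
        obtain ⟨e, he, h⟩ := hmem c (hN c hc) S
        exact ⟨e, Or.inl he, h⟩)
      (by simp)
    · convert h2 using 1
      ext e
      simp only [PlaneTopology.legs, wEdges_cons, mem_union, mem_insert_iff, mem_ofPred_eq,
        Finset.mem_insert]
      constructor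
      · rintro (h | ⟨he, v, rfl | hv, hve⟩)
        · exact Or.inl (Or.inl (Or.inl h))
        · obtain ⟨u, rfl⟩ := hve
          rcases (hadj u).1 he with rfl | rfl | rfl
          · exact Or.inl (Or.inr (Or.inl Sym2.eq_swap))
          · exact Or.inl (Or.inr (Or.inr (Or.inl rfl)))
          · exact Or.inr (Or.inl rfl)
        · exact Or.inl (Or.inl (Or.inr ⟨he, v, hv, hve⟩))
      · rintro (((h | ⟨he, v, hv, hve⟩) | (rfl | rfl | h)) | (rfl | h))
        · exact Or.inl h
        · exact Or.inr ⟨he, v, Or.inr hv, hve⟩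
        · exact Or.inr ⟨ha.symm, w, Or.inl rfl, by simp⟩
        · exact Or.inr ⟨hb, w, Or.inl rfl, by simp⟩
        · simp [wEdges] at h
        · exact Or.inr ⟨hc, w, Or.inl rfl, by simp⟩
        · simp [wEdges] at h
    · rw [wEdges_cons]
      refine disjoint_left.2 fun e he heF => ?_
      rcases he with rfl | he
      · rw [wEdges_cons, wEdges_cons] at heF
        rcases heF with h | h | h | h
        · exact hwn _ h (by simp)
        · rw [Sym2.eq_iff] at h
          rcases h with ⟨h, -⟩ | ⟨-, h⟩
          · exact ha.ne h
          · exact hac h.symm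
        · rw [Sym2.eq_iff] at h
          rcases h with ⟨-, h⟩ | ⟨h, -⟩
          · exact hbc h.symm
          · exact hb.ne h
        · simp [wEdges] at h
      · simp [wEdges] at he

/-- The off-cycle vertices. -/
def offC {x : V} (C : G.Walk x x) : Finset V := Finset.univ.filter fun v => v ∉ C.support

/-- The edge set of `H`. -/
def hEdges {x : V} (C : G.Walk x x) : Set (Sym2 V) := legs C (offC C)

theorem mem_hEdges {x : V} {C : G.Walk x x} {e : Sym2 V} :
    e ∈ hEdges C ↔ e ∈ (Hgraph C).edgeSet := by
  rw [Hgraph, SimpleGraph.edgeSet_deleteEdges]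
  simp only [hEdges, legs, offC, chordSet, mem_union, mem_ofPred_eq, mem_sdiff, Finset.mem_filter,
    Finset.mem_univ, true_and, not_and, not_forall]
  constructor
  · rintro (h | ⟨he, w, hw, hwe⟩)
    · exact ⟨wEdges_subset C h, fun _ h' => absurd h h'⟩
    · exact ⟨he, fun _ _ => ⟨w, hwe, hw⟩⟩
  · rintro ⟨he, h⟩
    by_cases hC : e ∈ C.edges
    · exact Or.inl hC
    · obtain ⟨w, hwe, hw⟩ := h he hC
      exact Or.inr ⟨he, w, hw, hwe⟩

theorem drawingH_eq {x : V} {C : G.Walk x x} (hC : C.IsCycle) (hI : IsIsolating G C) :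
    drawingH emb C = drawE emb (hEdges C) := by
  have hsub : hEdges C ⊆ G.edgeSet := fun e he =>
    SimpleGraph.edgeSet_mono (SimpleGraph.deleteEdges_le _) (mem_hEdges.1 he)
  ext z
  simp only [drawingH, drawingOn, mem_union, mem_iUnion, mem_univ, exists_prop, image_univ,
    true_and]
  constructor
  · rintro (⟨v, rfl⟩ | ⟨u, v, huv, hz⟩)
    · rw [pos_mem_drawE emb hsub]
      by_cases hv : v ∈ C.support
      · obtain ⟨e, he, hve⟩ := (mem_support_iff_wEdges hC.not_nil).1 hv
        exact ⟨e, Or.inl he, hve⟩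
      · obtain ⟨u, hu⟩ := Finset.card_pos.1 (by rw [(hI v hv).1]; norm_num :
          0 < (Finset.univ.filter fun w => G.Adj v w).card)
        exact ⟨s(v, u), Or.inr ⟨by simpa using hu, v, by simp [offC, hv], by simp⟩, by simp⟩
    · exact mem_iUnion₂.2 ⟨s(u, v), mem_hEdges.2 huv, hz⟩
  · intro hz
    obtain ⟨e, he, hz⟩ := mem_iUnion₂.1 hz
    induction e with | _ u v => exact Or.inr ⟨u, v, mem_hEdges.1 he, hz⟩

theorem cycleBounded_hEdges {x : V} {C : G.Walk x x} (hC : C.IsCycle) (hI : IsIsolating G C) :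
    CycleBounded emb (hEdges C) :=
  CycleBounded.legs emb hC hI _ fun w hw => by simpa [offC] using hw

end Ears

section Cyclic

variable {V : Type*} {G : SimpleGraph V}

/-- A periodic enumeration of the vertices of a cycle. -/
structure CyclicEnum {x : V} (C : G.Walk x x) (y : ℤ → V) : Prop where
  adj : ∀ i, G.Adj (y i) (y (i + 1))
  eq_iff : ∀ i j, y i = y j ↔ (C.length : ℤ) ∣ i - j
  mem_support : ∀ v, v ∈ C.support ↔ ∃ i, v = y i
  mem_edges : ∀ e, e ∈ C.edges ↔ ∃ i, e = s(y i, y (i + 1))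

theorem exists_cyclicEnum {x : V} {C : G.Walk x x} (hC : C.IsCycle) : ∃ y, CyclicEnum C y := by
  have hc : (0 : ℤ) < C.length := by
    have := hC.three_le_length
    omega
  obtain ⟨n, hn⟩ : ∃ n : ℤ, n = C.length := ⟨_, rfl⟩
  rw [← hn] at hc
  have hm : ∀ i : ℤ, 0 ≤ i % n ∧ i % n < n := fun i =>
    ⟨Int.emod_nonneg _ hc.ne', Int.emod_lt_of_pos _ hc⟩
  have hsucc : ∀ i : ℤ, C.getVert ((i + 1) % n).toNat = C.getVert ((i % n).toNat + 1) := by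
    intro i
    by_cases h : i % n + 1 = n
    · have h1 : (i + 1) % n = 0 := by
        rw [Int.add_emod, ← Int.emod_add_emod, Int.emod_emod_of_dvd _ dvd_rfl]
        simp [h]
      have h2 : (i % n).toNat + 1 = C.length := by have := hm i; omega
      rw [h1, h2]
      simp
    · have h1 : (i + 1) % n = i % n + 1 := by
        rw [← Int.emod_add_emod]
        exact Int.emod_eq_of_lt (by have := hm i; omega) (by have := hm i; omega)
      rw [h1]
      congr 1
      have := hm i
      omega
  have hlt : ∀ i : ℤ, (i % n).toNat < C.length := fun i => by have := hm i; omega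
  refine ⟨fun i => C.getVert (i % n).toNat, fun i => ?_, fun i j => ?_, fun v => ?_, fun e => ?_⟩
  · rw [hsucc]
    exact C.adj_getVert_succ (hlt i)
  · rw [← hn, ← Int.modEq_iff_dvd, Int.ModEq]
    constructor
    · intro h
      have := hC.getVert_injOn' (by have := hlt i; simp; omega) (by have := hlt j; simp; omega) h
      have := hm i
      have := hm j
      omega
    · intro h
      simp [h]
  · rw [SimpleGraph.Walk.mem_support_iff_exists_getVert]
    constructor
    · rintro ⟨k, rfl, hk⟩
      rcases hk.eq_or_lt with rfl | hk
      · exact ⟨0, by simp⟩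
      · refine ⟨k, ?_⟩
        rw [Int.emod_eq_of_lt (by omega) (by omega)]
        simp
    · rintro ⟨i, rfl⟩
      exact ⟨_, rfl, (hlt i).le⟩
  · constructor
    · intro h
      induction e with | _ u v =>
      obtain ⟨k, hk, h⟩ := (SimpleGraph.Walk.mk_mem_edges_iff_exists C).1 h
      refine ⟨k, ?_⟩
      rw [hsucc, Int.emod_eq_of_lt (by omega) (by omega)]
      simpa using h.symm
    · rintro ⟨i, rfl⟩
      rw [SimpleGraph.Walk.mk_mem_edges_iff_exists]
      exact ⟨(i % n).toNat, hlt i, by rw [hsucc]⟩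

/-- The edges `y t y (t + 1)` with `i ≤ t < j`. -/
def segE (y : ℤ → V) (i j : ℤ) : Set (Sym2 V) := {e | ∃ t, i ≤ t ∧ t < j ∧ e = s(y t, y (t + 1))}

variable {x : V} {C : G.Walk x x} {y : ℤ → V}

theorem CyclicEnum.edge_eq_iff (hy : CyclicEnum C y) (hc : 3 ≤ C.length) (i j : ℤ) :
    s(y i, y (i + 1)) = s(y j, y (j + 1)) ↔ (C.length : ℤ) ∣ i - j := by
  rw [Sym2.eq_iff, hy.eq_iff, hy.eq_iff, hy.eq_iff, hy.eq_iff]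
  constructor
  · rintro (⟨h, -⟩ | ⟨h1, h2⟩)
    · exact h
    · have : (C.length : ℤ) ∣ 2 := by
        have := dvd_sub h2 h1
        ring_nf at this
        exact this
      have := Int.le_of_dvd (by norm_num) this
      omega
  · intro h
    exact Or.inl ⟨h, by ring_nf at h ⊢; exact h⟩

theorem CyclicEnum.eq_of_lt (hy : CyclicEnum C y) {i j : ℤ} (h : y i = y j)
    (h1 : i - j < C.length) (h2 : j - i < C.length) : i = j := by
  have h3 := (hy.eq_iff i j).1 h
  have := Int.eq_zero_of_abs_lt_dvd h3 (abs_lt.2 ⟨by omega, by omega⟩)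
  omega

theorem CyclicEnum.segE_subset (hy : CyclicEnum C y) (i j : ℤ) : segE y i j ⊆ wEdges C := by
  rintro e ⟨t, -, -, rfl⟩
  exact (hy.mem_edges _).2 ⟨t, rfl⟩

theorem CyclicEnum.exists_walk (hy : CyclicEnum C y) {i j : ℤ} (hij : i ≤ j) :
    ∃ p : G.Walk (y i) (y j), wEdges p = segE y i j ∧
      (∀ v, v ∈ p.support ↔ ∃ t, i ≤ t ∧ t ≤ j ∧ v = y t) ∧ (j - i < C.length → p.IsPath) := by
  induction i, hij using Int.leInductionDown with
  | base =>
    refine ⟨SimpleGraph.Walk.nil, ?_, ?_, fun _ => by simp⟩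
    · ext e
      simp only [wEdges, segE, SimpleGraph.Walk.edges_nil, List.not_mem_nil, mem_ofPred_eq,
        false_iff]
      rintro ⟨t, h1, h2, -⟩
      omega
    · intro v
      simp only [SimpleGraph.Walk.support_nil, List.mem_singleton]
      constructor
      · rintro rfl
        exact ⟨j, le_rfl, le_rfl, rfl⟩
      · rintro ⟨t, h1, h2, rfl⟩
        rw [le_antisymm h2 h1]
  | pred i hi ih =>
    obtain ⟨p, h1, h2, h3⟩ := ih
    have hadj : G.Adj (y (i - 1)) (y i) := by simpa using hy.adj (i - 1)
    refine ⟨SimpleGraph.Walk.cons hadj p, ?_, ?_, fun hlt => ?_⟩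
    · rw [wEdges_cons, h1]
      ext e
      constructor
      · rintro (rfl | ⟨t, a, b, rfl⟩)
        · exact ⟨i - 1, le_rfl, by omega, by simp⟩
        · exact ⟨t, by omega, b, rfl⟩
      · rintro ⟨t, a, b, rfl⟩
        by_cases ht : t = i - 1
        · subst ht
          exact Or.inl (by simp)
        · exact Or.inr ⟨t, by omega, b, rfl⟩
    · intro v
      rw [SimpleGraph.Walk.support_cons, List.mem_cons, h2]
      constructor
      · rintro (rfl | ⟨t, a, b, rfl⟩)
        · exact ⟨i - 1, le_rfl, by omega, rfl⟩
        · exact ⟨t, by omega, b, rfl⟩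
      · rintro ⟨t, a, b, rfl⟩
        by_cases ht : t = i - 1
        · subst ht
          exact Or.inl rfl
        · exact Or.inr ⟨t, by omega, b, rfl⟩
    · rw [SimpleGraph.Walk.cons_isPath_iff]
      refine ⟨h3 (by omega), fun h => ?_⟩
      obtain ⟨t, a, b, h⟩ := (h2 _).1 h
      have := hy.eq_of_lt h (by omega) (by omega)
      omega

theorem CyclicEnum.path_eq_segE (hy : CyclicEnum C y) (hc : 3 ≤ C.length) :
    ∀ {b a : V} (q : G.Walk b a), q.IsPath → wEdges q ⊆ wEdges C → b ∈ C.support →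
      ∃ s k : ℤ, 0 ≤ k ∧ k < C.length ∧ wEdges q = segE y s (s + k) ∧
        (∀ v, v ∈ q.support ↔ ∃ t, s ≤ t ∧ t ≤ s + k ∧ v = y t) ∧
        ((b = y s ∧ a = y (s + k)) ∨ (a = y s ∧ b = y (s + k)))
  | b, _, .nil, _, _, hb => by
    obtain ⟨i, rfl⟩ := (hy.mem_support b).1 hb
    obtain ⟨p, h1, h2, h3⟩ := hy.exists_walk (le_refl i)
    have hp := h3 (by omega)
    obtain rfl := (SimpleGraph.Walk.isPath_iff_nil.1 hp).eq_nil
    exact ⟨i, 0, le_rfl, by omega, by simpa using h1, by simpa using h2, by simp⟩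
  | b, a, .cons (v := b') h q, hp, hsub, hb => by
    rw [SimpleGraph.Walk.cons_isPath_iff] at hp
    rw [wEdges_cons] at hsub
    have hbe := hsub (mem_insert _ _)
    obtain ⟨s, k, hk0, hkc, hE, hS, hends⟩ := hy.path_eq_segE hc q hp.1
      ((subset_insert _ _).trans hsub) (SimpleGraph.Walk.snd_mem_support_of_mem_edges C hbe)
    obtain ⟨t, ht⟩ := (hy.mem_edges _).1 hbe
    have hbS : ∀ u, s ≤ u → u ≤ s + k → b ≠ y u := fun u h1 h2 h3 => hp.2 ((hS b).2 ⟨u, h1, h2, h3⟩)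
    have hper : ∀ u v : ℤ, y u = y v → y (u + 1) = y (v + 1) ∧ y (u - 1) = y (v - 1) := by
      intro u v huv
      rw [hy.eq_iff] at huv
      constructor <;> rw [hy.eq_iff] <;> ring_nf at huv ⊢ <;> exact huv
    have hk2 : k + 1 < C.length := by
      by_contra hcon
      obtain ⟨i, rfl⟩ := (hy.mem_support b).1 hb
      have hpos : (0 : ℤ) < C.length := by omega
      refine hbS (s + (i - s) % C.length) (by have := Int.emod_nonneg (i - s) hpos.ne'; omega)
        (by have := Int.emod_lt_of_pos (i - s) hpos; omega) ?_
      rw [hy.eq_iff]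
      have := Int.emod_add_mul_ediv (i - s) C.length
      exact ⟨(i - s) / C.length, by linarith⟩
    have hcase : (b' = y s ∧ b = y (s - 1) ∧ a = y (s + k)) ∨
        (b' = y (s + k) ∧ b = y (s + k + 1) ∧ a = y s) := by
      rcases Sym2.eq_iff.1 ht with ⟨h1, h2⟩ | ⟨h1, h2⟩
      · rcases hends with ⟨h3, h4⟩ | ⟨h3, h4⟩
        · refine Or.inl ⟨h3, ?_, h4⟩
          have := (hper (t + 1) s (h2.symm.trans h3)).2
          rw [h1, ← this]; simp
        · by_cases hk : k = 0
          · subst hk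
            rw [add_zero] at h4 ⊢
            refine Or.inl ⟨h4, ?_, h3⟩
            have := (hper (t + 1) s (h2.symm.trans h4)).2
            rw [h1, ← this]; simp
          · exfalso
            have := (hper (t + 1) (s + k) (h2.symm.trans h4)).2
            refine hbS (s + k - 1) (by omega) (by omega) ?_
            rw [h1, ← this]; simp
      · rcases hends with ⟨h3, h4⟩ | ⟨h3, h4⟩
        · by_cases hk : k = 0
          · subst hk
            rw [add_zero] at h4 ⊢
            refine Or.inr ⟨h3, ?_, h4⟩
            have := (hper t s (h2.symm.trans h3)).1
            rw [h1, ← this]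
          · exfalso
            have := (hper t s (h2.symm.trans h3)).1
            exact hbS (s + 1) (by omega) (by omega) (by rw [h1, ← this])
        · refine Or.inr ⟨h4, ?_, h3⟩
          have := (hper t (s + k) (h2.symm.trans h4)).1
          rw [h1, ← this]
    rcases hcase with ⟨rfl, rfl, rfl⟩ | ⟨rfl, rfl, rfl⟩
    · refine ⟨s - 1, k + 1, by omega, hk2, ?_, fun v => ?_, Or.inl ⟨rfl, by ring_nf⟩⟩
      · rw [wEdges_cons, hE]
        ext e
        constructor
        · rintro (rfl | ⟨u, a, b, rfl⟩)
          · exact ⟨s - 1, le_rfl, by omega, by simp⟩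
          · exact ⟨u, by omega, by omega, rfl⟩
        · rintro ⟨u, a, b, rfl⟩
          by_cases hu : u = s - 1
          · subst hu
            exact Or.inl (by simp)
          · exact Or.inr ⟨u, by omega, by omega, rfl⟩
      · rw [SimpleGraph.Walk.support_cons, List.mem_cons, hS]
        constructor
        · rintro (rfl | ⟨u, a, b, rfl⟩)
          · exact ⟨s - 1, le_rfl, by omega, rfl⟩
          · exact ⟨u, by omega, by omega, rfl⟩
        · rintro ⟨u, a, b, rfl⟩
          by_cases hu : u = s - 1
          · subst hu
            exact Or.inl rfl
          · exact Or.inr ⟨u, by omega, by omega, rfl⟩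
    · refine ⟨s, k + 1, by omega, hk2, ?_, fun v => ?_, Or.inr ⟨rfl, by ring_nf⟩⟩
      · rw [wEdges_cons, hE]
        ext e
        constructor
        · rintro (rfl | ⟨u, a, b, rfl⟩)
          · exact ⟨s + k, by omega, by omega, Sym2.eq_swap⟩
          · exact ⟨u, by omega, by omega, rfl⟩
        · rintro ⟨u, a, b, rfl⟩
          by_cases hu : u = s + k
          · subst hu
            exact Or.inl Sym2.eq_swap
          · exact Or.inr ⟨u, by omega, by omega, rfl⟩
      · rw [SimpleGraph.Walk.support_cons, List.mem_cons, hS]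
        constructor
        · rintro (rfl | ⟨u, a, b, rfl⟩)
          · exact ⟨s + k + 1, by omega, by omega, rfl⟩
          · exact ⟨u, by omega, by omega, rfl⟩
        · rintro ⟨u, a, b, rfl⟩
          by_cases hu : u = s + k + 1
          · subst hu
            exact Or.inl rfl
          · exact Or.inr ⟨u, by omega, by omega, rfl⟩

end Cyclic

section MinorFaces

variable {V : Type*} [Fintype V] {G : SimpleGraph V} (emb : PlaneEmbedding G)

theorem closure_face_eq {F : Set (Sym2 V)} (hF : F ⊆ G.edgeSet) {Z : Set (Sym2 V)}
    {g : Set (ℝ × ℝ)} (hg : IsFaceOf (drawE emb F) g) (hZ : frontier g = drawE emb Z) :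
    closure g = g ∪ drawE emb Z := by
  rw [IsFaceOf.closure_eq (isCompact_drawE emb hF).isClosed hg, hZ]

theorem arcSet_subset_closure_iff {F : Set (Sym2 V)} (hF : F ⊆ G.edgeSet) {Z : Set (Sym2 V)}
    (hZF : Z ⊆ F) {g : Set (ℝ × ℝ)} (hg : IsFaceOf (drawE emb F) g)
    (hZ : frontier g = drawE emb Z) {e : Sym2 V} (he : e ∈ F) :
    arcSet emb e ⊆ closure g ↔ e ∈ Z := by
  rw [closure_face_eq emb hF hg hZ, ← arcSet_subset_drawE_iff emb (hZF.trans hF) (hF he)]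
  refine ⟨fun h z hz => (h hz).resolve_left fun hzg => ?_, fun h z hz => Or.inr (h hz)⟩
  exact IsFaceOf.subset_compl hg hzg (arcSet_subset_drawE emb he hz)

theorem pos_mem_closure_iff {F : Set (Sym2 V)} (hF : F ⊆ G.edgeSet) {Z : Set (Sym2 V)}
    (hZF : Z ⊆ F) {g : Set (ℝ × ℝ)} (hg : IsFaceOf (drawE emb F) g)
    (hZ : frontier g = drawE emb Z) {v : V} (hv : ∃ e ∈ F, v ∈ e) :
    emb.pos v ∈ closure g ↔ ∃ e ∈ Z, v ∈ e := by
  rw [closure_face_eq emb hF hg hZ, ← pos_mem_drawE emb (hZF.trans hF)]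
  refine ⟨fun h => h.resolve_left fun hzg => ?_, Or.inr⟩
  exact IsFaceOf.subset_compl hg hzg ((pos_mem_drawE emb hF).2 hv)

variable {x : V} {C : G.Walk x x} {y : ℤ → V}

theorem hEdges_subset : hEdges C ⊆ G.edgeSet := fun _ he =>
  SimpleGraph.edgeSet_mono (SimpleGraph.deleteEdges_le _) (mem_hEdges.1 he)

theorem mem_hEdges_of_notMem {e : Sym2 V} (he : e ∈ G.edgeSet) {v : V} (hve : v ∈ e)
    (hv : v ∉ C.support) : e ∈ hEdges C :=
  Or.inr ⟨he, v, by simpa [offC] using hv, hve⟩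

theorem wEdges_subset_hEdges : wEdges C ⊆ hEdges C := subset_union_left

theorem mem_support_of_mem_hEdges {e : Sym2 V} (he : e ∈ hEdges C)
    (hC : ∀ w ∈ e, w ∈ C.support) : e ∈ wEdges C := by
  rcases he with he | ⟨-, w, hw, hwe⟩
  · exact he
  · exact absurd (hC w hwe) (by simpa [offC] using hw)

theorem exists_hEdges (hC : C.IsCycle) (hI : IsIsolating G C) (v : V) :
    ∃ e ∈ hEdges C, v ∈ e := by
  by_cases hv : v ∈ C.support
  · obtain ⟨e, he, hve⟩ := (mem_support_iff_wEdges hC.not_nil).1 hv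
    exact ⟨e, Or.inl he, hve⟩
  · obtain ⟨u, hu⟩ := Finset.card_pos.1 (by rw [(hI v hv).1]; norm_num :
      0 < (Finset.univ.filter fun w => G.Adj v w).card)
    exact ⟨s(v, u), mem_hEdges_of_notMem (by simpa using hu) (by simp) hv, by simp⟩

theorem mem_Vminus_union_Vplus {v : V} : v ∈ Vminus emb C ∪ Vplus emb C ↔ v ∉ C.support := by
  by_cases h : v ∈ C.support <;> simp [Vminus, Vplus, h, em]

variable (C y) in
/-- The boundary of `f` runs along the cycle from `y s` to `y (s + k)` and returns
through the vertex `v` off the cycle. -/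
structure IsSeg (f : Set (ℝ × ℝ)) (s k : ℤ) (v : V) : Prop where
  face : IsFaceOf (drawE emb (hEdges C)) f
  off : v ∉ C.support
  k_pos : 1 ≤ k
  k_lt : k < C.length
  adj_left : G.Adj (y s) v
  adj_right : G.Adj v (y (s + k))
  frontier_eq : frontier f = drawE emb (segE y s (s + k) ∪ {s(y s, v), s(v, y (s + k))})

theorem exists_isSeg (hC : C.IsCycle) (hI : IsIsolating G C) (hy : CyclicEnum C y)
    {f : Set (ℝ × ℝ)} (hf : MinorFaceH emb C f) : ∃ s k v, IsSeg emb C y f s k v := by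
  obtain ⟨hface, v, ⟨hv, hvf⟩, huniq⟩ := hf
  rw [drawingH_eq emb hC hI] at hface
  rw [mem_Vminus_union_Vplus] at hv
  obtain ⟨Z, hZF, hZ, hfr⟩ := (cycleBounded_hEdges emb hC hI).2.2 f hface
  have hinc : ∀ w, incVertex emb f w ↔ ∃ e ∈ Z, w ∈ e := fun w =>
    pos_mem_closure_iff emb hEdges_subset hZF hface hfr (exists_hEdges hC hI w)
  have hoff : ∀ w, w ∉ C.support → (∃ e ∈ Z, w ∈ e) → w = v := fun w hw h =>
    huniq w ⟨(mem_Vminus_union_Vplus emb).2 hw, (hinc w).2 h⟩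
  obtain ⟨u, W, hW, rfl⟩ := hZ
  have hvW := mem_support_of_wEdges ((hinc v).1 hvf)
  have hW' : (W.rotate v hvW).IsCycle := (SimpleGraph.Walk.isCycle_rotate hvW).2 hW
  have hE : wEdges W = wEdges (W.rotate v hvW) := by
    ext e
    exact ((SimpleGraph.Walk.rotate_edges W v hvW).mem_iff).symm
  rw [hE] at hZF hfr hoff
  generalize W.rotate v hvW = W' at *
  cases W' with
  | nil => exact absurd hW' SimpleGraph.Walk.not_isCycle_nil
  | @cons _ a _ h p =>
    rw [SimpleGraph.Walk.cons_isCycle_iff] at hW'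
    obtain ⟨hp, hn⟩ := hW'
    have hpr := hp.reverse
    rw [← List.mem_reverse, ← SimpleGraph.Walk.edges_reverse] at hn
    rw [wEdges_cons, ← wEdges_reverse p] at hZF hfr hoff
    generalize p.reverse = P at *
    cases P with
    | nil => exact absurd rfl h.ne
    | @cons _ b _ h' q =>
      rw [wEdges_cons] at hZF hfr hoff
      rw [SimpleGraph.Walk.cons_isPath_iff] at hpr
      have hbC := (hI v hv).2 b h'
      have hqC : wEdges q ⊆ wEdges C := by
        intro e he
        refine mem_support_of_mem_hEdges (hZF (Or.inr (Or.inr he))) fun w hw => ?_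
        by_contra hcon
        obtain rfl := hoff w hcon ⟨e, Or.inr (Or.inr he), hw⟩
        exact hpr.2 (mem_support_of_wEdges ⟨e, he, hw⟩)
      have hab : a ≠ b := by
        rintro rfl
        exact hn (by simp)
      obtain ⟨s, k, hk0, hkc, hseg, -, hends⟩ := hy.path_eq_segE hC.three_le_length q hpr.1 hqC hbC
      have hk : 1 ≤ k := by
        by_contra hcon
        obtain rfl : k = 0 := by omega
        rw [add_zero] at hends
        rcases hends with ⟨rfl, rfl⟩ | ⟨rfl, rfl⟩ <;> exact hab rfl
      rcases hends with ⟨rfl, rfl⟩ | ⟨rfl, rfl⟩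
      · refine ⟨s, k, v, hface, hv, hk, hkc, h'.symm, h, ?_⟩
        rw [hfr, hseg, Sym2.eq_swap (a := v) (b := y s)]
        congr 1
        ext e
        simp only [mem_insert_iff, mem_union, mem_singleton_iff]
        tauto
      · refine ⟨s, k, v, hface, hv, hk, hkc, h.symm, h', ?_⟩
        rw [hfr, hseg, Sym2.eq_swap (a := v) (b := y s)]
        congr 1
        ext e
        simp only [mem_insert_iff, mem_union, mem_singleton_iff]
        tauto

end MinorFaces

section Sides

variable {V : Type*} {G : SimpleGraph V} (emb : PlaneEmbedding G)
variable {x : V} {C : G.Walk x x} {y : ℤ → V}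

theorem CyclicEnum.segE_full (hy : CyclicEnum C y) (hc : 3 ≤ C.length) (s : ℤ) :
    segE y s (s + C.length) = wEdges C := by
  refine subset_antisymm (hy.segE_subset _ _) fun e he => ?_
  obtain ⟨i, rfl⟩ := (hy.mem_edges e).1 he
  have hpos : (0 : ℤ) < C.length := by omega
  have h1 := Int.emod_nonneg (i - s) hpos.ne'
  have h2 := Int.emod_lt_of_pos (i - s) hpos
  refine ⟨s + (i - s) % C.length, by omega, by omega, ?_⟩
  rw [hy.edge_eq_iff hc]
  have := Int.emod_add_mul_ediv (i - s) C.length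
  exact ⟨(i - s) / C.length, by linarith⟩

theorem segE_union (y : ℤ → V) {a b c : ℤ} (h1 : a ≤ b) (h2 : b ≤ c) :
    segE y a b ∪ segE y b c = segE y a c := by
  ext e
  constructor
  · rintro (⟨t, h, h', rfl⟩ | ⟨t, h, h', rfl⟩)
    · exact ⟨t, h, by omega, rfl⟩
    · exact ⟨t, by omega, h', rfl⟩
  · rintro ⟨t, h, h', rfl⟩
    by_cases ht : t < b
    · exact Or.inl ⟨t, h, ht, rfl⟩
    · exact Or.inr ⟨t, by omega, h', rfl⟩

theorem mem_of_mem_segE {i j : ℤ} {w : V} (h : ∃ e ∈ segE y i j, w ∈ e) :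
    ∃ t, i ≤ t ∧ t ≤ j ∧ w = y t := by
  obtain ⟨e, ⟨t, h1, h2, rfl⟩, hw⟩ := h
  rcases Sym2.mem_iff.1 hw with rfl | rfl
  exacts [⟨t, h1, h2.le, rfl⟩, ⟨t + 1, by omega, by omega, rfl⟩]

theorem CyclicEnum.disjoint_segE (hy : CyclicEnum C y) (hc : 3 ≤ C.length) {a b b' c : ℤ}
    (hb : b ≤ b') (hac : c - a ≤ C.length) : Disjoint (segE y a b) (segE y b' c) := by
  rw [disjoint_left]
  rintro e ⟨t, h1, h2, rfl⟩ ⟨t', h3, h4, h⟩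
  rw [hy.edge_eq_iff hc] at h
  have := Int.eq_zero_of_abs_lt_dvd h (abs_lt.2 ⟨by omega, by omega⟩)
  omega

/-- A path of length two. -/
def twoPath {a v b : V} (h : G.Adj a v) (h' : G.Adj v b) : G.Walk a b :=
  SimpleGraph.Walk.cons h (SimpleGraph.Walk.cons h' SimpleGraph.Walk.nil)

theorem wEdges_twoPath {a v b : V} (h : G.Adj a v) (h' : G.Adj v b) :
    wEdges (twoPath h h') = {s(a, v), s(v, b)} := by
  ext e
  simp [wEdges, twoPath]

theorem isPath_twoPath {a v b : V} (h : G.Adj a v) (h' : G.Adj v b) (hab : a ≠ b) :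
    (twoPath h h').IsPath := by
  simp [twoPath, h.ne, h'.ne, hab]

theorem support_twoPath {a v b w : V} (h : G.Adj a v) (h' : G.Adj v b) :
    w ∈ (twoPath h h').support ↔ w = a ∨ w = v ∨ w = b := by
  simp [twoPath]

theorem CyclicEnum.exists_jordan (hy : CyclicEnum C y) (hc : 3 ≤ C.length) {s k : ℤ} (hk : 1 ≤ k)
    (hkc : k < C.length) :
    IsJordan (drawE emb (segE y s (s + k))) (drawE emb (segE y (s + k) (s + C.length)))
      (emb.pos (y s)) (emb.pos (y (s + k))) := by
  obtain ⟨p, hpE, hpS, hp⟩ := hy.exists_walk (i := s) (j := s + k) (by omega)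
  obtain ⟨q, hqE, hqS, hq⟩ := hy.exists_walk (i := s + k) (j := s + C.length) (by omega)
  have hcl : y (s + C.length) = y s := by
    rw [hy.eq_iff]
    simp
  have hne : y s ≠ y (s + k) := fun h => by
    have := hy.eq_of_lt h (by omega) (by omega)
    omega
  have := isJordan_paths emb (p := p) (q := q.reverse.copy hcl rfl) (hp (by omega))
    (by simpa using hq (by omega)) hne
    (by
      have : wEdges (q.reverse.copy hcl rfl) = wEdges q := by
        ext e; simp [wEdges]
      rw [this, hpE, hqE]
      exact hy.disjoint_segE hc le_rfl (by omega))
    (by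
      intro w hw hw'
      simp only [SimpleGraph.Walk.support_copy, SimpleGraph.Walk.support_reverse,
        List.mem_reverse] at hw'
      obtain ⟨t, h1, h2, rfl⟩ := (hpS w).1 hw
      obtain ⟨t', h3, h4, h⟩ := (hqS _).1 hw'
      have h5 := (hy.eq_iff _ _).1 h
      by_cases ht : t' - t < C.length
      · have := hy.eq_of_lt h (by omega) (by omega)
        obtain rfl : t = s + k := by omega
        exact Or.inr rfl
      · obtain rfl : t = s := by omega
        exact Or.inl rfl)
  have h2 : wEdges (q.reverse.copy hcl rfl) = wEdges q := by
    ext e; simp [wEdges]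
  rwa [h2, hpE, hqE] at this

variable [Fintype V]

variable {emb} in
theorem IsSeg.theta {f : Set (ℝ × ℝ)} {s k : ℤ} {v : V} (hf : IsSeg emb C y f s k v)
    (hy : CyclicEnum C y) (hc : 3 ≤ C.length) {O : Set (ℝ × ℝ)}
    (hO : IsFaceOf (drawE emb (wEdges C)) O) (hfO : f ⊆ O) :
    ∃ I, IsFaceOf (drawE emb (segE y (s + k) (s + C.length) ∪ {s(y s, v), s(v, y (s + k))})) I ∧
      frontier I = drawE emb (segE y (s + k) (s + C.length) ∪ {s(y s, v), s(v, y (s + k))}) ∧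
      f ∪ I = O \ drawE emb {s(y s, v), s(v, y (s + k))} ∧ Disjoint f I := by
  have hJ := hy.exists_jordan emb hc (s := s) hf.k_pos hf.k_lt
  have hk0 := hf.k_pos
  have hkc := hf.k_lt
  have hne : y s ≠ y (s + k) := fun h => by
    have := hy.eq_of_lt h (by omega) (by omega)
    omega
  have hC : wEdges C = segE y s (s + k) ∪ segE y (s + k) (s + C.length) := by
    rw [segE_union y (by omega) (by omega), hy.segE_full hc]
  have hleg : ∀ e ∈ ({s(y s, v), s(v, y (s + k))} : Set (Sym2 V)), e ∈ G.edgeSet ∧ v ∈ e := by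
    rintro e (rfl | rfl)
    exacts [⟨hf.adj_left, by simp⟩, ⟨hf.adj_right, by simp⟩]
  have hP := isArc_path emb _ (isPath_twoPath hf.adj_left hf.adj_right hne) hne
  have hPE := wEdges_twoPath hf.adj_left hf.adj_right
  have hd : Disjoint (wEdges (twoPath hf.adj_left hf.adj_right)) (wEdges C) := by
    rw [hPE, disjoint_left]
    intro e he he'
    exact hf.off (mem_support_of_wEdges ⟨e, he', (hleg e he).2⟩)
  have hPc := inner_path_subset_compl emb (wEdges_subset C) hd (by
    intro w hw ⟨e, he, hwe⟩
    rcases (support_twoPath _ _).1 hw with h | rfl | h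
    · exact Or.inl h
    · exact absurd (mem_support_of_wEdges ⟨e, he, hwe⟩) hf.off
    · exact Or.inr h)
  rw [hPE] at hP hPc
  set P := drawE emb {s(y s, v), s(v, y (s + k))} with hPdef
  have hDC : IsClosed (drawE emb (wEdges C)) := (isCompact_drawE emb (wEdges_subset C)).isClosed
  have hPO : P \ {emb.pos (y s), emb.pos (y (s + k))} ⊆ O := by
    intro z hz
    have h1 : z ∈ closure O := by
      apply closure_mono hfO
      apply frontier_subset_closure
      rw [hf.frontier_eq, drawE_union]
      exact Or.inr hz.1
    rw [IsFaceOf.closure_eq hDC hO] at h1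
    exact h1.resolve_right fun h => hPc hz (IsFaceOf.frontier_subset hDC hO h)
  rw [hC, drawE_union] at hO
  obtain ⟨I₁, I₂, hI₁, hI₂, hne', hfr₁, hfr₂, hU⟩ := PlaneTopology.theta hJ hP hPO hO
  have hffr := hf.frontier_eq
  rw [drawE_union] at hffr
  have hfH := IsFaceOf.subset_compl hf.face
  have hPH : P ⊆ drawE emb (hEdges C) := by
    apply drawE_mono
    intro e he
    exact mem_hEdges_of_notMem (hleg e he).1 (hleg e he).2 hf.off
  have hZC : ∀ i j, drawE emb (segE y i j) ⊆ drawE emb (wEdges C) := fun i j =>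
    drawE_mono emb (hy.segE_subset i j)
  have hZH : ∀ i j, drawE emb (segE y i j) ⊆ drawE emb (hEdges C) := fun i j =>
    (hZC i j).trans (drawE_mono emb wEdges_subset_hEdges)
  have hfpre := IsFaceOf.isPreconnected hf.face
  have hfI : f ⊆ I₁ ∪ I₂ := by
    rw [hU]
    exact fun z hz => ⟨hfO hz, fun h => hfH hz (hPH h)⟩
  have hOc := IsFaceOf.subset_compl hO
  have hff : IsFaceOf (drawE emb (segE y s (s + k)) ∪ P) f := by
    refine isFaceOf_of_frontier hfpre (IsFaceOf.nonempty hf.face) ?_ hffr.le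
    rintro z hz (h | h)
    exacts [hfH hz (hZH _ _ h), hfH hz (hPH h)]
  have hcl2 : closure I₂ = I₂ ∪ (drawE emb (segE y (s + k) (s + C.length)) ∪ P) := by
    rw [IsFaceOf.closure_eq _ hI₂, hfr₂]
    refine IsClosed.union (isCompact_drawE emb ?_).isClosed hP.isCompact.isClosed
    exact (hy.segE_subset _ _).trans (wEdges_subset C)
  have hnot : ¬ f ⊆ I₂ := by
    intro h
    have he : s(y s, y (s + 1)) ∈ segE y s (s + k) := ⟨s, le_rfl, by omega, rfl⟩
    have heG := wEdges_subset C (hy.segE_subset _ _ he)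
    obtain ⟨z, hz⟩ := inner_nonempty emb heG
    have hz1 : z ∈ drawE emb (segE y s (s + k)) := arcSet_subset_drawE emb he hz.1
    have hz2 : z ∈ closure I₂ := by
      apply closure_mono h
      apply frontier_subset_closure
      rw [hffr]
      exact Or.inl hz1
    rw [hcl2] at hz2
    rcases hz2 with hz2 | hz2 | hz2
    · have : z ∈ O := ((hU ▸ Or.inr hz2 : z ∈ O \ P)).1
      exact hOc this (Or.inl hz1)
    · exact disjoint_left.1 (hy.disjoint_segE hc (b := s + k) le_rfl (by omega)) he
        (mem_of_inner emb heG ((hy.segE_subset _ _).trans (wEdges_subset C)) hz hz2)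
    · have := mem_of_inner emb heG (fun e he => (hleg e he).1) hz hz2
      exact hf.off (mem_support_of_wEdges ⟨_, hy.segE_subset _ _ he, (hleg _ this).2⟩)
  have hfI₁ : f = I₁ := by
    by_contra hcon
    apply hnot
    intro z hz
    exact (hfI hz).resolve_left fun h => hcon (IsFaceOf.eq_of_inter hff hI₁ ⟨z, hz, h⟩)
  subst hfI₁
  refine ⟨I₂, by rwa [drawE_union], by rwa [drawE_union], hU, disjoint_left.2 fun z hz hz' => ?_⟩
  have : f ⊆ I₂ := by
    refine IsFaceOf.subset_of_inter hI₂ hfpre ?_ ⟨z, hz, hz'⟩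
    rintro w hw (h | h)
    exacts [hfH hw (hZH _ _ h), hfH hw (hPH h)]
  exact hnot this

end Sides

section SegFacts

variable {V : Type*} {G : SimpleGraph V} {emb : PlaneEmbedding G}
variable {x : V} {C : G.Walk x x} {y : ℤ → V}
variable {f f' : Set (ℝ × ℝ)} {s k s' k' : ℤ} {v v' : V}

theorem mem_of_mem_legs {e : Sym2 V}
    (he : e ∈ ({s(y s, v), s(v, y (s + k))} : Set (Sym2 V))) : v ∈ e := by
  rcases he with rfl | rfl <;> simp

theorem CyclicEnum.period (hy : CyclicEnum C y) (i : ℤ) : y (i + C.length) = y i := by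
  rw [hy.eq_iff]
  simp

theorem IsCycleSet.exists_other_side {Z : Set (Sym2 V)} (hZ : IsCycleSet G Z) {O : Set (ℝ × ℝ)}
    (hO : IsFaceOf (drawE emb Z) O) :
    ∃ O', IsFaceOf (drawE emb Z) O' ∧ O ≠ O' ∧ frontier O = drawE emb Z ∧
      frontier O' = drawE emb Z ∧ ∀ W, IsFaceOf (drawE emb Z) W → W = O ∨ W = O' := by
  obtain ⟨A, B, p, q, hJ, h⟩ := hZ.exists_jordan emb
  rw [← h] at hO ⊢
  exact hJ.exists_other_face hO

variable [Fintype V]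

theorem IsSeg.legs_subset (hf : IsSeg emb C y f s k v) :
    ({s(y s, v), s(v, y (s + k))} : Set (Sym2 V)) ⊆ G.edgeSet := by
  rintro e (rfl | rfl)
  exacts [hf.adj_left, hf.adj_right]

theorem IsSeg.notMem_legs (hf : IsSeg emb C y f s k v) {e : Sym2 V} (he : e ∈ wEdges C) :
    e ∉ ({s(y s, v), s(v, y (s + k))} : Set (Sym2 V)) := fun h =>
  hf.off (mem_support_of_wEdges ⟨e, he, mem_of_mem_legs h⟩)

theorem IsSeg.boundary_subset (hf : IsSeg emb C y f s k v) (hy : CyclicEnum C y) (i j : ℤ) :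
    segE y i j ∪ {s(y s, v), s(v, y (s + k))} ⊆ hEdges C :=
  union_subset ((hy.segE_subset _ _).trans wEdges_subset_hEdges) fun _ he =>
    mem_hEdges_of_notMem (hf.legs_subset he) (mem_of_mem_legs he) hf.off

theorem IsSeg.incEdge_iff (hf : IsSeg emb C y f s k v) (hy : CyclicEnum C y) {e : Sym2 V}
    (he : e ∈ C.edges) : incEdge emb f e ↔ e ∈ segE y s (s + k) := by
  rw [incEdge, arcSet_subset_closure_iff emb hEdges_subset (hf.boundary_subset hy _ _) hf.face
    hf.frontier_eq (wEdges_subset_hEdges he)]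
  exact ⟨fun h => h.resolve_right (hf.notMem_legs he), Or.inl⟩

theorem IsSeg.mem_boundary_vertex (hf : IsSeg emb C y f s k v) {w : V} {i j : ℤ}
    (h1 : i ≤ s ∧ s ≤ j ∨ y s = y j) (h2 : i ≤ s + k ∧ s + k ≤ j)
    (h : ∃ e ∈ segE y i j ∪ {s(y s, v), s(v, y (s + k))}, w ∈ e) (hw : w ∈ C.support) :
    ∃ t, i ≤ t ∧ t ≤ j ∧ w = y t := by
  obtain ⟨e, he | he, hwe⟩ := h
  · exact mem_of_mem_segE ⟨e, he, hwe⟩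
  · have hwv : w ≠ v := fun h => hf.off (h ▸ hw)
    rcases he with rfl | rfl
    · rcases Sym2.mem_iff.1 hwe with rfl | rfl
      · rcases h1 with ⟨a, b⟩ | h1
        · exact ⟨s, a, b, rfl⟩
        · exact ⟨j, by omega, le_rfl, h1⟩
      · exact absurd rfl hwv
    · rcases Sym2.mem_iff.1 hwe with rfl | rfl
      · exact absurd rfl hwv
      · exact ⟨s + k, h2.1, h2.2, rfl⟩

theorem exists_side (hf : IsFaceOf (drawE emb (hEdges C)) f) :
    ∃ O, IsFaceOf (drawE emb (wEdges C)) O ∧ f ⊆ O :=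
  exists_face (IsFaceOf.isPreconnected hf) (IsFaceOf.nonempty hf)
    ((IsFaceOf.subset_compl hf).trans
      (compl_subset_compl.2 (drawE_mono emb wEdges_subset_hEdges)))

/-- An edge drawn on the side of `f` and starting at an inner vertex of the segment of `f`
is drawn inside `f`. -/
theorem IsSeg.inner_subset (hf : IsSeg emb C y f s k v) (hy : CyclicEnum C y) (hc : 3 ≤ C.length)
    {O : Set (ℝ × ℝ)} (hO : IsFaceOf (drawE emb (wEdges C)) O) (hfO : f ⊆ O) {e : Sym2 V}
    (he : e ∈ G.edgeSet) (heO : inner emb e ⊆ O) {i : ℤ} (hi : y i ∈ e) (h1 : s < i)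
    (h2 : i < s + k) : inner emb e ⊆ f := by
  obtain ⟨I, hI, hIfr, hU, hdis⟩ := hf.theta hy hc hO hfO
  have hkc := hf.k_lt
  have hbG := (hf.boundary_subset hy (s + k) (s + C.length)).trans hEdges_subset
  have hiP : ¬ ∃ e ∈ segE y (s + k) (s + C.length) ∪ {s(y s, v), s(v, y (s + k))}, y i ∈ e := by
    intro h
    obtain ⟨t, a, b, h⟩ := hf.mem_boundary_vertex (Or.inr (hy.period s).symm)
      ⟨by omega, by omega⟩ h ((hy.mem_support _).2 ⟨i, rfl⟩)
    have := hy.eq_of_lt h (by omega) (by omega)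
    omega
  have hsub : inner emb e ⊆ f ∪ I := by
    rw [hU]
    refine fun z hz => ⟨heO hz, fun h => hiP ⟨e, Or.inr ?_, hi⟩⟩
    exact mem_of_inner emb he hf.legs_subset hz h
  have hfo : IsOpen f := IsFaceOf.isOpen (isCompact_drawE emb hEdges_subset).isClosed hf.face
  have hIo : IsOpen I := IsFaceOf.isOpen (isCompact_drawE emb hbG).isClosed hI
  rcases (isPreconnected_inner emb he).subset_or_subset hfo hIo hdis hsub with h | h
  · exact h
  · exfalso
    have h3 : emb.pos (y i) ∈ closure I := by
      have := closure_mono h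
      rw [closure_inner emb he] at this
      exact this ((pos_mem_arcSet emb he).2 hi)
    rw [IsFaceOf.closure_eq (isCompact_drawE emb hbG).isClosed hI, hIfr, mem_union,
      pos_mem_drawE emb hbG] at h3
    refine h3.elim (fun h3 => ?_) hiP
    have h4 : emb.pos (y i) ∈ O := (hU.subset (Or.inr h3)).1
    refine IsFaceOf.subset_compl hO h4 ((pos_mem_drawE emb (wEdges_subset C)).2 ?_)
    exact ⟨s(y i, y (i + 1)), (hy.mem_edges _).2 ⟨i, rfl⟩, by simp⟩

/-- Two distinct minor faces with a common cycle edge lie on different sides of the cycle. -/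
theorem IsSeg.side_ne (hf : IsSeg emb C y f s k v) (hf' : IsFaceOf (drawE emb (hEdges C)) f')
    (hy : CyclicEnum C y) (hc : 3 ≤ C.length) (hne : f ≠ f') {O O' : Set (ℝ × ℝ)}
    (hO : IsFaceOf (drawE emb (wEdges C)) O) (hfO : f ⊆ O) (hfO' : f' ⊆ O')
    {e : Sym2 V} (he : e ∈ C.edges) (h : incEdge emb f e) (h' : incEdge emb f' e) : O ≠ O' := by
  rintro rfl
  obtain ⟨I, hI, hIfr, hU, hdis⟩ := hf.theta hy hc hO hfO
  have hbG := (hf.boundary_subset hy (s + k) (s + C.length)).trans hEdges_subset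
  have hPH : drawE emb {s(y s, v), s(v, y (s + k))} ⊆ drawE emb (hEdges C) :=
    drawE_mono emb (subset_union_right.trans (hf.boundary_subset hy s s))
  have hsub : f' ⊆ I := by
    intro z hz
    have : z ∈ f ∪ I := by
      rw [hU]
      exact ⟨hfO' hz, fun h => IsFaceOf.subset_compl hf' hz (hPH h)⟩
    exact this.resolve_left fun h => hne (IsFaceOf.eq_of_inter hf.face hf' ⟨z, h, hz⟩)
  have heG : e ∈ G.edgeSet := wEdges_subset C he
  obtain ⟨z, hz⟩ := inner_nonempty emb heG
  have hzI : z ∈ closure I := closure_mono hsub (h' hz.1)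
  rw [IsFaceOf.closure_eq (isCompact_drawE emb hbG).isClosed hI, hIfr] at hzI
  rcases hzI with hzI | hzI
  · have h4 : z ∈ O := (hU.subset (Or.inr hzI)).1
    exact IsFaceOf.subset_compl hO h4 (arcSet_subset_drawE emb he hz.1)
  · rcases mem_of_inner emb heG hbG hz hzI with h5 | h5
    · exact disjoint_left.1 (hy.disjoint_segE hc (b := s + k) le_rfl (by omega))
        ((hf.incEdge_iff hy he).1 h) h5
    · exact hf.notMem_legs he h5

/-- Every cycle edge on the boundary of `f` lies on the boundary of another face. -/
theorem exists_opposite_face (hC : C.IsCycle) (hI : IsIsolating G C)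
    (hf : IsFaceOf (drawE emb (hEdges C)) f) {e : Sym2 V} (he : e ∈ C.edges) :
    ∃ g, IsFaceOf (drawE emb (hEdges C)) g ∧ g ≠ f ∧ incEdge emb g e := by
  by_contra! hcon
  obtain ⟨O, hO, hfO⟩ := exists_side hf
  obtain ⟨O', hO', hne, -, hfr, -⟩ := IsCycleSet.exists_other_side (⟨x, C, hC, rfl⟩) hO
  obtain ⟨hsub, hfin, hcyc⟩ := cycleBounded_hEdges emb hC hI
  have heH : e ∈ hEdges C := wEdges_subset_hEdges he
  obtain ⟨z, hz⟩ := inner_nonempty emb (hsub heH)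
  set K : Set (ℝ × ℝ) := (⋃ g ∈ {g | IsFaceOf (drawE emb (hEdges C)) g ∧ g ≠ f}, closure g) ∪
    drawE emb (hEdges C \ {e}) with hK
  have hKc : IsClosed K := by
    refine IsClosed.union ?_ (isCompact_drawE emb (sdiff_subset.trans hsub)).isClosed
    exact (hfin.subset fun g hg => hg.1).isClosed_biUnion fun g _ => isClosed_closure
  have hzK : z ∉ K := by
    rintro (h | h)
    · obtain ⟨g, ⟨hg, hgf⟩, hzg⟩ := mem_iUnion₂.1 h
      obtain ⟨Z, hZF, -, hZ⟩ := hcyc g hg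
      rw [closure_face_eq emb hsub hg hZ] at hzg
      rcases hzg with hzg | hzg
      · exact IsFaceOf.subset_compl hg hzg (arcSet_subset_drawE emb heH hz.1)
      · exact hcon g hg hgf ((arcSet_subset_closure_iff emb hsub hZF hg hZ heH).2
          (mem_of_inner emb (hsub heH) (hZF.trans hsub) hz hzg))
    · exact (mem_of_inner emb (hsub heH) (sdiff_subset.trans hsub) hz h).2 rfl
  have hzO : z ∈ closure O' := by
    apply frontier_subset_closure
    rw [hfr]
    exact arcSet_subset_drawE emb he hz.1
  obtain ⟨w, hwK, hwO⟩ := mem_closure_iff.1 hzO _ hKc.isOpen_compl hzK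
  have hwC := IsFaceOf.subset_compl hO' hwO
  have hwH : w ∉ drawE emb (hEdges C) := by
    intro h
    obtain ⟨e', he', hw⟩ := mem_iUnion₂.1 h
    by_cases hee : e' = e
    · exact hwC (arcSet_subset_drawE emb he (hee ▸ hw))
    · exact hwK (Or.inr (mem_iUnion₂.2 ⟨e', ⟨he', hee⟩, hw⟩))
  obtain ⟨hg, hwg⟩ := mem_face hwH
  by_cases hgf : connectedComponentIn (drawE emb (hEdges C))ᶜ w = f
  · exact hne (IsFaceOf.eq_of_inter hO hO' ⟨w, hfO (hgf ▸ hwg), hwO⟩)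
  · exact hwK (Or.inl (mem_iUnion₂.2 ⟨_, ⟨hg, hgf⟩, subset_closure hwg⟩))

/-- Both ends of an edge drawn inside `f` lie on the segment of `f`. -/
theorem IsSeg.mem_seg_of_inner_subset (hf : IsSeg emb C y f s k v) (hC : C.IsCycle)
    (hI : IsIsolating G C) (hy : CyclicEnum C y) {e : Sym2 V} (he : e ∈ G.edgeSet)
    (hef : inner emb e ⊆ f) {w : V} (hw : w ∈ e) :
    w ∈ C.support ∧ ∃ t, s ≤ t ∧ t ≤ s + k ∧ w = y t := by
  have hk := hf.k_pos
  have hwC : w ∈ C.support := by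
    by_contra h
    obtain ⟨z, hz⟩ := inner_nonempty emb he
    exact IsFaceOf.subset_compl hf.face (hef hz)
      (arcSet_subset_drawE emb (mem_hEdges_of_notMem he hw h) hz.1)
  refine ⟨hwC, hf.mem_boundary_vertex (Or.inl ⟨le_rfl, by omega⟩) ⟨by omega, le_rfl⟩ ?_ hwC⟩
  rw [← pos_mem_closure_iff emb hEdges_subset (hf.boundary_subset hy _ _) hf.face hf.frontier_eq
    (exists_hEdges hC hI w)]
  have := closure_mono hef
  rw [closure_inner emb he] at this
  exact this ((pos_mem_arcSet emb he).2 hw)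

end SegFacts

section Chords

variable {V : Type*} [Fintype V] {G : SimpleGraph V} {emb : PlaneEmbedding G}
variable {x : V} {C : G.Walk x x} {y : ℤ → V}
variable {f f' : Set (ℝ × ℝ)} {s k s' k' : ℤ} {v v' : V}

/-- The complementary path of the boundary of a minor face. -/
theorem IsSeg.exists_walk (hf : IsSeg emb C y f s k v) (hy : CyclicEnum C y) {a c : ℤ}
    (h1 : s ≤ a) (h2 : a < c) (h3 : c ≤ s + k) :
    ∃ q : G.Walk (y a) (y c), q.IsPath ∧
      wEdges q = segE y s a ∪ segE y c (s + k) ∪ {s(y s, v), s(v, y (s + k))} ∧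
      ∀ w, w ∈ q.support ↔ w = v ∨ (∃ t, s ≤ t ∧ t ≤ a ∧ w = y t) ∨
        ∃ t, c ≤ t ∧ t ≤ s + k ∧ w = y t := by
  have hkc := hf.k_lt
  obtain ⟨p₁, hE₁, hS₁, hp₁⟩ := hy.exists_walk h1
  obtain ⟨p₂, hE₂, hS₂, hp₂⟩ := hy.exists_walk h3
  have hne : y s ≠ y (s + k) := fun h => by
    have := hy.eq_of_lt h (by omega) (by omega)
    omega
  have hv : ∀ t, v ≠ y t := fun t h => hf.off (h ▸ (hy.mem_support _).2 ⟨t, rfl⟩)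
  have hA : (p₁.reverse.append (twoPath hf.adj_left hf.adj_right)).IsPath := by
    refine isPath_append (hp₁ (by omega)).reverse (isPath_twoPath _ _ hne) fun w hw hw' => ?_
    rw [SimpleGraph.Walk.support_reverse, List.mem_reverse, hS₁] at hw
    obtain ⟨t, ht1, ht2, rfl⟩ := hw
    rcases (support_twoPath _ _).1 hw' with h | h | h
    · exact h
    · exact absurd h.symm (hv t)
    · have := hy.eq_of_lt h (by omega) (by omega)
      omega
  refine ⟨(p₁.reverse.append (twoPath hf.adj_left hf.adj_right)).append p₂.reverse,
    isPath_append hA (hp₂ (by omega)).reverse fun w hw hw' => ?_, ?_, fun w => ?_⟩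
  · rw [SimpleGraph.Walk.support_reverse, List.mem_reverse, hS₂] at hw'
    obtain ⟨t, ht1, ht2, rfl⟩ := hw'
    rw [SimpleGraph.Walk.mem_support_append_iff, SimpleGraph.Walk.support_reverse,
      List.mem_reverse, hS₁, support_twoPath] at hw
    rcases hw with ⟨t', ht3, ht4, h⟩ | h | h | h
    · have := hy.eq_of_lt h (by omega) (by omega)
      omega
    · have := hy.eq_of_lt h (by omega) (by omega)
      omega
    · exact absurd h.symm (hv t)
    · exact h
  · rw [wEdges_append, wEdges_append, wEdges_reverse, wEdges_reverse, wEdges_twoPath, hE₁, hE₂,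
      union_right_comm]
  · rw [SimpleGraph.Walk.mem_support_append_iff, SimpleGraph.Walk.mem_support_append_iff,
      SimpleGraph.Walk.support_reverse, List.mem_reverse, SimpleGraph.Walk.support_reverse,
      List.mem_reverse, hS₁, hS₂, support_twoPath]
    constructor
    · rintro ((h | rfl | rfl | rfl) | h)
      exacts [Or.inr (Or.inl h), Or.inr (Or.inl ⟨s, le_rfl, h1, rfl⟩), Or.inl rfl,
        Or.inr (Or.inr ⟨_, h3, le_rfl, rfl⟩), Or.inr (Or.inr h)]
    · rintro (h | h | h)
      exacts [Or.inl (Or.inr (Or.inr (Or.inl h))), Or.inl (Or.inl h), Or.inr h]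

/-- Two chords drawn inside a minor face do not cross. -/
theorem IsSeg.not_crossing (hf : IsSeg emb C y f s k v) (hy : CyclicEnum C y) (hlen : 3 ≤ C.length)
    {a b c d : ℤ} (h1 : s ≤ a) (h2 : a < b) (h3 : b < c) (h4 : c < d) (h5 : d ≤ s + k)
    (hac : G.Adj (y a) (y c)) (hbd : G.Adj (y b) (y d)) (hacf : inner emb s(y a, y c) ⊆ f)
    (hbdf : inner emb s(y b, y d) ⊆ f) : False := by
  have hkc := hf.k_lt
  obtain ⟨p, hpE, hpS, hp⟩ := hy.exists_walk (i := a) (j := c) (by omega)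
  obtain ⟨q, hq, hqE, hqS⟩ := hf.exists_walk hy h1 (by omega : a < c) (by omega)
  have hv : ∀ t, v ≠ y t := fun t h => hf.off (h ▸ (hy.mem_support _).2 ⟨t, rfl⟩)
  have hpq : Disjoint (wEdges p) (wEdges q) := by
    rw [hpE, hqE, disjoint_union_right, disjoint_union_right]
    refine ⟨⟨(hy.disjoint_segE hlen le_rfl (by omega)).symm,
      hy.disjoint_segE hlen le_rfl (by omega)⟩, disjoint_left.2 fun e he he' => ?_⟩
    exact hf.notMem_legs (hy.segE_subset _ _ he) he'
  have hJ := isJordan_paths emb (hp (by omega)) hq hac.ne hpq (by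
    intro w hw hw'
    obtain ⟨t, ht1, ht2, rfl⟩ := (hpS w).1 hw
    rcases (hqS _).1 hw' with h | ⟨t', ht3, ht4, h⟩ | ⟨t', ht3, ht4, h⟩
    · exact absurd h.symm (hv t)
    · have := hy.eq_of_lt h (by omega) (by omega)
      exact Or.inl (by congr 1; omega)
    · have := hy.eq_of_lt h (by omega) (by omega)
      exact Or.inr (by congr 1; omega))
  have hZ : wEdges p ∪ wEdges q = segE y s (s + k) ∪ {s(y s, v), s(v, y (s + k))} := by
    rw [hpE, hqE, ← union_assoc, ← union_assoc, union_comm (segE y a c),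
      segE_union y h1 (by omega), segE_union y (by omega) (by omega)]
  have hZH := hf.boundary_subset hy s (s + k)
  have hff : IsFaceOf (drawE emb (wEdges p) ∪ drawE emb (wEdges q)) f := by
    rw [← drawE_union, hZ]
    refine isFaceOf_of_frontier (IsFaceOf.isPreconnected hf.face) (IsFaceOf.nonempty hf.face) ?_
      hf.frontier_eq.le
    exact (IsFaceOf.subset_compl hf.face).trans (compl_subset_compl.2 (drawE_mono emb hZH))
  have hin := inner_mk emb (y a) (y c)
  have hsac : arcSet emb s(y a, y c) = emb.arc (y a) (y c) := rfl
  obtain ⟨I, J, hI, hJf, hIJ, hIfr, hJfr, hU⟩ :=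
    PlaneTopology.theta hJ (isArc_arcSet emb hac) (by rwa [← hin]) hff
  have hsing : ∀ q' : Set (Sym2 V), drawE emb q' ∪ arcSet emb s(y a, y c) =
      drawE emb (q' ∪ {s(y a, y c)}) := by
    intro q'
    rw [drawE_union]
    simp [drawE]
  rw [hsing] at hI hJf hIfr hJfr
  have hGp : wEdges p ∪ {s(y a, y c)} ⊆ G.edgeSet :=
    union_subset (wEdges_subset p) (by rintro e rfl; exact hac)
  have hGq : wEdges q ∪ {s(y a, y c)} ⊆ G.edgeSet :=
    union_subset (wEdges_subset q) (by rintro e rfl; exact hac)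
  have hne : s(y b, y d) ≠ s(y a, y c) := by
    intro h
    rcases Sym2.eq_iff.1 h with ⟨h, -⟩ | ⟨h, -⟩
    all_goals
      have := hy.eq_of_lt h (by omega) (by omega)
      omega
  have hsub : inner emb s(y b, y d) ⊆ I ∪ J := by
    rw [hU]
    intro z hz
    refine ⟨hbdf hz, fun h => hne ?_⟩
    have := mem_of_inner emb hbd (F := {s(y a, y c)}) (by rintro e rfl; exact hac) hz
      (arcSet_subset_drawE emb (mem_singleton _) h)
    exact this
  have hIo : IsOpen I := IsFaceOf.isOpen (isCompact_drawE emb hGp).isClosed hI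
  have hJo : IsOpen J := IsFaceOf.isOpen (isCompact_drawE emb hGq).isClosed hJf
  have hyf : ∀ t, emb.pos (y t) ∉ f := fun t h => by
    refine IsFaceOf.subset_compl hf.face h ((pos_mem_drawE emb hEdges_subset).2 ?_)
    exact ⟨s(y t, y (t + 1)), wEdges_subset_hEdges ((hy.mem_edges _).2 ⟨t, rfl⟩), by simp⟩
  obtain ⟨z, hz⟩ := inner_nonempty emb (e := s(y b, y d)) hbd
  have hclI : emb.pos (y d) ∉ closure I := by
    rw [IsFaceOf.closure_eq (isCompact_drawE emb hGp).isClosed hI, hIfr, mem_union,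
      pos_mem_drawE emb hGp]
    rintro (h | ⟨e, he | rfl, hde⟩)
    · exact hyf d (hU.subset (Or.inl h)).1
    · obtain ⟨t, ht1, ht2, h⟩ := (hpS _).1 (mem_support_of_wEdges ⟨e, he, hde⟩)
      have := hy.eq_of_lt h (by omega) (by omega)
      omega
    · rcases Sym2.mem_iff.1 hde with h | h
      all_goals
        have := hy.eq_of_lt h (by omega) (by omega)
        omega
  have hclJ : emb.pos (y b) ∉ closure J := by
    rw [IsFaceOf.closure_eq (isCompact_drawE emb hGq).isClosed hJf, hJfr, mem_union,
      pos_mem_drawE emb hGq]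
    rintro (h | ⟨e, he | rfl, hde⟩)
    · exact hyf b (hU.subset (Or.inr h)).1
    · rcases (hqS _).1 (mem_support_of_wEdges ⟨e, he, hde⟩) with h | ⟨t, ht1, ht2, h⟩ |
        ⟨t, ht1, ht2, h⟩
      · exact hv _ h.symm
      all_goals
        have := hy.eq_of_lt h (by omega) (by omega)
        omega
    · rcases Sym2.mem_iff.1 hde with h | h
      all_goals
        have := hy.eq_of_lt h (by omega) (by omega)
        omega
  have hmem : ∀ w, w ∈ s(y b, y d) → ∀ X, inner emb s(y b, y d) ⊆ X → emb.pos w ∈ closure X := by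
    intro w hw X hX
    have := closure_mono hX
    rw [closure_inner emb hbd] at this
    exact this ((pos_mem_arcSet emb hbd).2 hw)
  have hdis : Disjoint I J := by
    have hsub' : I ∪ J ⊆ (drawE emb (wEdges p ∪ wEdges q ∪ {s(y a, y c)}))ᶜ := by
      rw [hU, ← hsing, drawE_union]
      rintro z hz (h | h)
      exacts [IsFaceOf.subset_compl hff hz.1 h, hz.2 h]
    have hI' : IsFaceOf (drawE emb (wEdges p ∪ wEdges q ∪ {s(y a, y c)})) I :=
      isFaceOf_of_frontier (IsFaceOf.isPreconnected hI) (IsFaceOf.nonempty hI)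
        (subset_union_left.trans hsub')
        (hIfr.le.trans (drawE_mono emb (union_subset_union_left _ subset_union_left)))
    have hJ' : IsFaceOf (drawE emb (wEdges p ∪ wEdges q ∪ {s(y a, y c)})) J :=
      isFaceOf_of_frontier (IsFaceOf.isPreconnected hJf) (IsFaceOf.nonempty hJf)
        (subset_union_right.trans hsub')
        (hJfr.le.trans (drawE_mono emb (union_subset_union_left _ subset_union_right)))
    exact disjoint_left.2 fun z hz hz' => hIJ (IsFaceOf.eq_of_inter hI' hJ' ⟨z, hz, hz'⟩)
  rcases (isPreconnected_inner emb hbd).subset_or_subset hIo hJo hdis hsub with h | h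
  · exact hclI (hmem _ (by simp) _ h)
  · exact hclJ (hmem _ (by simp) _ h)

end Chords

section Connectivity

variable {V : Type*} {G : SimpleGraph V}

theorem card_support_of_isCycle {a : V} {W : G.Walk a a} (hW : W.IsCycle) :
    W.support.toFinset.card = W.length := by
  have h1 : W.support.toFinset = W.support.tail.toFinset := by
    ext w
    rw [List.mem_toFinset, List.mem_toFinset]
    refine ⟨fun hw => ?_, List.mem_of_mem_tail⟩
    rw [← SimpleGraph.Walk.cons_tail_support, List.mem_cons] at hw
    rcases hw with rfl | hw
    · exact SimpleGraph.Walk.end_mem_tail_support hW.not_nil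
    · exact hw
  rw [h1, List.toFinset_card_of_nodup hW.support_nodup]
  simp

theorem exists_walk_of_isChain (y : ℤ → V) (l : List ℤ) : ∀ i j : ℤ,
    List.IsChain (fun s t => G.Adj (y s) (y t)) (i :: l) → (i :: l).getLast? = some j →
      ∃ p : G.Walk (y i) (y j), p.support = (i :: l).map y := by
  induction l with
  | nil =>
    intro i j _ hj
    obtain rfl : i = j := by simpa using hj
    exact ⟨SimpleGraph.Walk.nil, rfl⟩
  | cons t l ih =>
    intro i j h hj
    rw [List.isChain_cons_cons] at h
    obtain ⟨p, hp⟩ := ih t j h.2 (by simpa using hj)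
    exact ⟨SimpleGraph.Walk.cons h.1 p, by rw [SimpleGraph.Walk.support_cons, hp]; rfl⟩

variable [Fintype V]

/-- In a 3-connected graph no proper vertex set is cut off by at most two vertices. -/
theorem not_cutOff (h3 : ThreeConnected G) {S : Finset V} (hS : S.card ≤ 2) {T : Set V}
    {a b : V} (ha : a ∈ T) (haS : a ∉ S) (hb : b ∉ T) (hbS : b ∉ S)
    (hT : ∀ v ∈ T, ∀ w, G.Adj v w → w ∈ T ∨ w ∈ S) : False := by
  have hconn := (h3.2 S hS).preconnected ⟨a, by simpa using haS⟩ ⟨b, by simpa using hbS⟩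
  obtain ⟨p⟩ := hconn
  have key : ∀ {u w : ((↑S : Set V)ᶜ : Set V)} (p : (G.induce ((↑S : Set V)ᶜ)).Walk u w),
      (u : V) ∈ T → (w : V) ∈ T := by
    intro u w p
    induction p with
    | nil => exact id
    | cons h p ih =>
      intro hu
      refine ih ((hT _ hu _ (by simpa using h)).resolve_right ?_)
      exact fun h' => (Subtype.prop _ : _ ∈ ((↑S : Set V)ᶜ : Set V)) (Finset.mem_coe.2 h')
  exact hb (key p ha)

theorem not_isCycle_of_support {x a : V} {C : G.Walk x x} (hC : IsLongestIsolatingCycle G C)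
    {W : G.Walk a a} (hW : W.IsCycle) (h : ∀ w ∈ C.support, w ∈ W.support) {u : V}
    (hu : u ∉ C.support) (huW : u ∈ W.support) : False := by
  have hiso : IsIsolating G W := fun v hv =>
    ⟨(hC.2.1 v fun h' => hv (h v h')).1, fun w hw => h w ((hC.2.1 v fun h' => hv (h v h')).2 w hw)⟩
  have hle := hC.2.2 a W hW hiso
  rw [← card_support_of_isCycle hW, ← card_support_of_isCycle hC.1] at hle
  refine absurd (Finset.card_lt_card (Finset.ssubset_iff_subset_ne.2 ⟨?_, ?_⟩)) hle.not_gt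
  · intro w hw
    rw [List.mem_toFinset] at hw ⊢
    exact h w hw
  · intro heq
    rw [Finset.ext_iff] at heq
    exact hu (by simpa [huW] using heq u)

end Connectivity

section Extension

variable {V : Type*} [Fintype V] {G : SimpleGraph V} {x : V} {C : G.Walk x x} {y : ℤ → V}

/-- A longest isolating cycle in a 3-connected graph, enumerated cyclically. -/
structure Frame (C : G.Walk x x) (y : ℤ → V) : Prop where
  long : IsLongestIsolatingCycle G C
  conn : ThreeConnected G
  len : 8 ≤ C.length
  enum : CyclicEnum C y

/-- A segment of a longest isolating cycle cannot be rerouted through a further vertex. -/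
theorem Frame.not_reroute (F : Frame C y) {a p q b : ℤ} {l₁ l₂ : List ℤ} {u : V}
    (hu : u ∉ C.support) (hlt : b - a < C.length)
    (hp : (a :: l₁).getLast? = some p) (hb : (q :: l₂).getLast? = some b)
    (hc₁ : List.IsChain (fun s t => G.Adj (y s) (y t)) (a :: l₁))
    (hc₂ : List.IsChain (fun s t => G.Adj (y s) (y t)) (q :: l₂))
    (hpu : G.Adj (y p) u) (huq : G.Adj u (y q))
    (hnd : ((a :: l₁) ++ (q :: l₂)).Nodup)
    (hmem : ∀ t, t ∈ (a :: l₁) ++ (q :: l₂) ↔ a ≤ t ∧ t ≤ b) : False := by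
  have hy := F.enum
  obtain ⟨P₁, hP₁⟩ := exists_walk_of_isChain y l₁ a p hc₁ hp
  obtain ⟨P₂, hP₂⟩ := exists_walk_of_isChain y l₂ q b hc₂ hb
  obtain ⟨hn1, hn2, hdis⟩ := List.nodup_append.1 hnd
  have hm1 : ∀ t ∈ a :: l₁, a ≤ t ∧ t ≤ b := fun t ht => (hmem t).1 (List.mem_append_left _ ht)
  have hm2 : ∀ t ∈ q :: l₂, a ≤ t ∧ t ≤ b := fun t ht => (hmem t).1 (List.mem_append_right _ ht)
  have hinj : ∀ s t, a ≤ s → s < a + C.length → a ≤ t → t < a + C.length → y s = y t → s = t :=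
    fun s t h1 h2 h3 h4 h => hy.eq_of_lt h (by omega) (by omega)
  have hpath : ∀ l : List ℤ, l.Nodup → (∀ t ∈ l, a ≤ t ∧ t ≤ b) → (l.map y).Nodup := by
    intro l hl h
    refine hl.map_on fun s hs t ht hst => hinj _ _ ?_ ?_ ?_ ?_ hst
    all_goals
      have := h s hs
      have := h t ht
      omega
  have hP₁p : P₁.IsPath := by
    rw [SimpleGraph.Walk.isPath_def, hP₁]
    exact hpath _ hn1 hm1
  have hP₂p : P₂.IsPath := by
    rw [SimpleGraph.Walk.isPath_def, hP₂]
    exact hpath _ hn2 hm2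
  have hqm := hm2 q (by simp)
  have hab : q ≠ a := fun h => hdis a (by simp) q (by simp) h.symm
  have hbm : b ∈ q :: l₂ := List.mem_of_getLast? hb
  have hpm : p ∈ a :: l₁ := List.mem_of_getLast? hp
  obtain ⟨Q, -, hQ, hQp⟩ := hy.exists_walk (i := b) (j := a + C.length) (by omega)
  obtain ⟨Q', hQ', hQ'p⟩ : ∃ Q' : G.Walk (y b) (y a), Q'.support = Q.support ∧ Q'.IsPath :=
    ⟨Q.copy rfl (hy.period a), by simp, by simpa using hQp (by omega)⟩
  have hA : (P₂.append Q').IsPath := by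
    refine isPath_append hP₂p hQ'p fun w hw hw' => ?_
    rw [hP₂, List.mem_map] at hw
    obtain ⟨t, ht, rfl⟩ := hw
    rw [hQ', hQ] at hw'
    obtain ⟨r, hr1, hr2, h⟩ := hw'
    have htm := hm2 t ht
    rcases hr2.lt_or_eq with hr2 | rfl
    · have := hinj _ _ (by omega) (by omega) (by omega) (by omega) h
      congr 1
      omega
    · rw [hy.period] at h
      have := hinj _ _ (by omega) (by omega) (by omega) (by omega) h
      exact absurd this.symm (hdis a (by simp) t ht)
  have hB : ((P₂.append Q').append P₁).IsPath := by
    refine isPath_append hA hP₁p fun w hw hw' => ?_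
    rw [hP₁, List.mem_map] at hw'
    obtain ⟨t, ht, rfl⟩ := hw'
    have htm := hm1 t ht
    rw [SimpleGraph.Walk.mem_support_append_iff, hP₂, hQ', hQ, List.mem_map] at hw
    rcases hw with ⟨r, hr, h⟩ | ⟨r, hr1, hr2, h⟩
    · have hrm := hm2 r hr
      have := hinj _ _ (by omega) (by omega) (by omega) (by omega) h
      exact absurd this.symm (hdis t ht r hr)
    · rcases hr2.lt_or_eq with hr2 | rfl
      · have := hinj _ _ (by omega) (by omega) (by omega) (by omega) h
        exact absurd (by omega) (hdis t ht b hbm)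
      · rw [hy.period] at h
        exact h
  have hmem' : ∀ w, w ∈ ((P₂.append Q').append P₁).support → w ∈ C.support := by
    intro w hw
    rw [SimpleGraph.Walk.mem_support_append_iff, SimpleGraph.Walk.mem_support_append_iff, hP₁, hP₂,
      hQ', hQ, List.mem_map, List.mem_map] at hw
    rw [hy.mem_support]
    rcases hw with (⟨t, -, rfl⟩ | ⟨t, -, -, rfl⟩) | ⟨t, -, rfl⟩ <;> exact ⟨t, rfl⟩
  have hne : y q ≠ y p := by
    intro h
    have h1 := hm1 p hpm
    have := hinj _ _ (by omega) (by omega) (by omega) (by omega) h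
    exact hdis p hpm q (by simp) this.symm
  obtain ⟨z, W, hW, hWE⟩ := IsCycleSet.of_paths hB (isPath_twoPath huq.symm hpu.symm hne) hne
    (by
      refine disjoint_left.2 fun e he he' => ?_
      rw [wEdges_twoPath] at he'
      have hue : u ∈ e := by rcases he' with rfl | rfl <;> simp
      exact hu (hmem' u (mem_support_of_wEdges ⟨e, he, hue⟩)))
    (by
      intro w hw hw'
      rcases (support_twoPath _ _).1 hw' with h | rfl | h
      · exact Or.inl h
      · exact absurd (hmem' _ hw) hu
      · exact Or.inr h)
  have hsup : ∀ w, (∃ e ∈ wEdges W, w ∈ e) → w ∈ W.support := fun w => mem_support_of_wEdges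
  refine not_isCycle_of_support F.long hW (fun w hw => hsup w ?_) hu (hsup u ?_)
  · rw [← hWE]
    obtain ⟨i, rfl⟩ := (hy.mem_support w).1 hw
    have hmm : y i ∈ ((P₂.append Q').append P₁).support := by
      have hcpos : (0 : ℤ) < C.length := by have := F.len; omega
      obtain ⟨j, hj1, hj2, hj⟩ : ∃ j, a ≤ j ∧ j < a + C.length ∧ y i = y j := by
        refine ⟨a + (i - a) % C.length, by have := Int.emod_nonneg (i - a) hcpos.ne'; omega,
          by have := Int.emod_lt_of_pos (i - a) hcpos; omega, ?_⟩
        rw [hy.eq_iff]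
        have : i - (a + (i - a) % C.length) = C.length * ((i - a) / C.length) := by
          have := Int.emod_add_mul_ediv (i - a) C.length
          omega
        exact ⟨_, this⟩
      rw [hj, SimpleGraph.Walk.mem_support_append_iff, SimpleGraph.Walk.mem_support_append_iff,
        hP₁, hP₂, hQ', hQ]
      by_cases hjb : j ≤ b
      · rcases List.mem_append.1 ((hmem j).2 ⟨hj1, hjb⟩) with h | h
        · exact Or.inr (List.mem_map_of_mem h)
        · exact Or.inl (Or.inl (List.mem_map_of_mem h))
      · exact Or.inl (Or.inr ⟨j, by omega, by omega, rfl⟩)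
    obtain ⟨e, he, h⟩ := (mem_support_iff_wEdges (SimpleGraph.Walk.not_nil_of_ne hne)).1 hmm
    exact ⟨e, Or.inl he, h⟩
  · rw [← hWE, wEdges_twoPath]
    exact ⟨s(y q, u), Or.inr (by simp), by simp⟩

end Extension

section Neighbours

variable {V : Type*} {G : SimpleGraph V} {emb : PlaneEmbedding G}
variable {y : ℤ → V} {f : Set (ℝ × ℝ)}

/-- The chord between two vertices of the cycle exists and is drawn inside `f`. -/
def ChordIn (emb : PlaneEmbedding G) (y : ℤ → V) (f : Set (ℝ × ℝ)) (i j : ℤ) : Prop :=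
  G.Adj (y i) (y j) ∧ inner emb s(y i, y j) ⊆ f

theorem ChordIn.symm {i j : ℤ} (h : ChordIn emb y f i j) : ChordIn emb y f j i :=
  ⟨h.1.symm, by rw [Sym2.eq_swap]; exact h.2⟩

theorem ChordIn.adj {i j : ℤ} (h : ChordIn emb y f i j) : G.Adj (y i) (y j) := h.1

variable [Fintype V] {x : V} {C : G.Walk x x}
variable {g h : Set (ℝ × ℝ)} {s k s' k' s'' k'' : ℤ} {u v w : V}

theorem Frame.shift (F : Frame C y) (a : ℤ) : Frame C (fun i => y (a + i)) where
  long := F.long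
  conn := F.conn
  len := F.len
  enum :=
    { adj := fun i => by simpa [add_assoc] using F.enum.adj (a + i)
      eq_iff := fun i j => by simpa using F.enum.eq_iff (a + i) (a + j)
      mem_support := fun v => by
        rw [F.enum.mem_support]
        exact ⟨fun ⟨i, h⟩ => ⟨i - a, by simp [h]⟩, fun ⟨i, h⟩ => ⟨_, h⟩⟩
      mem_edges := fun e => by
        rw [F.enum.mem_edges]
        refine ⟨fun ⟨i, h⟩ => ⟨i - a, ?_⟩, fun ⟨i, h⟩ => ⟨_, by rw [h, add_assoc]⟩⟩
        rw [h]
        rw [show a + (i - a) = i by ring, show a + (i - a + 1) = i + 1 by ring] }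

theorem Frame.mirror (F : Frame C y) (a : ℤ) : Frame C (fun i => y (a - i)) where
  long := F.long
  conn := F.conn
  len := F.len
  enum :=
    { adj := fun i => by
        have := (F.enum.adj (a - (i + 1))).symm
        rwa [show a - (i + 1) + 1 = a - i by ring] at this
      eq_iff := fun i j => by
        rw [F.enum.eq_iff, show a - i - (a - j) = -(i - j) by ring, dvd_neg]
      mem_support := fun v => by
        rw [F.enum.mem_support]
        exact ⟨fun ⟨i, h⟩ => ⟨a - i, by simp [h]⟩, fun ⟨i, h⟩ => ⟨_, h⟩⟩
      mem_edges := fun e => by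
        rw [F.enum.mem_edges]
        refine ⟨fun ⟨i, h⟩ => ⟨a - i - 1, ?_⟩, fun ⟨i, h⟩ => ⟨a - i - 1, ?_⟩⟩
        · rw [h, Sym2.eq_swap]
          rw [show a - (a - i - 1) = i + 1 by ring, show a - (a - i - 1 + 1) = i by ring]
        · rw [h, Sym2.eq_swap]
          rw [show a - i - 1 + 1 = a - i by ring, show a - (i + 1) = a - i - 1 by ring] }

theorem IsSeg.shift (hf : IsSeg emb C y f s k v) (a : ℤ) :
    IsSeg emb C (fun i => y (a + i)) f (s - a) k v where
  face := hf.face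
  off := hf.off
  k_pos := hf.k_pos
  k_lt := hf.k_lt
  adj_left := by simpa using hf.adj_left
  adj_right := by simpa [← add_assoc] using hf.adj_right
  frontier_eq := by
    rw [hf.frontier_eq]
    congr 2
    · ext e
      constructor
      · rintro ⟨t, h1, h2, rfl⟩
        exact ⟨t - a, by omega, by omega, by simp [← add_assoc]⟩
      · rintro ⟨t, h1, h2, rfl⟩
        exact ⟨a + t, by omega, by omega, by simp [← add_assoc]⟩
    · simp [← add_assoc]

theorem IsSeg.mirror (hf : IsSeg emb C y f s k v) (a : ℤ) :
    IsSeg emb C (fun i => y (a - i)) f (a - s - k) k v where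
  face := hf.face
  off := hf.off
  k_pos := hf.k_pos
  k_lt := hf.k_lt
  adj_left := by
    have := hf.adj_right.symm
    simpa [show a - (a - s - k) = s + k by ring] using this
  adj_right := by
    have := hf.adj_left.symm
    simpa [show a - (a - s - k + k) = s by ring] using this
  frontier_eq := by
    rw [hf.frontier_eq]
    congr 2
    · ext e
      constructor
      · rintro ⟨t, h1, h2, rfl⟩
        refine ⟨a - t - 1, by omega, by omega, ?_⟩
        rw [Sym2.eq_swap]
        beta_reduce
        rw [show a - (a - t - 1) = t + 1 by ring, show a - (a - t - 1 + 1) = t by ring]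
      · rintro ⟨t, h1, h2, rfl⟩
        refine ⟨a - t - 1, by omega, by omega, ?_⟩
        rw [Sym2.eq_swap]
        beta_reduce
        rw [show a - t - 1 + 1 = a - t by ring, show a - (t + 1) = a - t - 1 by ring]
    · rw [show a - (a - s - k) = s + k by ring, show a - (a - s - k + k) = s by ring,
        Sym2.eq_swap (a := y (s + k)), Sym2.eq_swap (a := v), Sym2.eq_swap (b := v),
        Set.pair_comm]

/-- Moving the segment of a face once around the cycle. -/
theorem IsSeg.rotate (hf : IsSeg emb C y f s k v) (hy : CyclicEnum C y) (m : ℤ) :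
    IsSeg emb C y f (s + m * C.length) k v := by
  have := hf.shift (-(m * C.length))
  rw [show (fun i => y (-(m * C.length) + i)) = y by
    funext i
    rw [hy.eq_iff]
    exact ⟨-m, by ring⟩] at this
  rwa [sub_neg_eq_add] at this

theorem IsSeg.not_cross (hf : IsSeg emb C y f s k v) (F : Frame C y) {a b c d : ℤ}
    (hac : ChordIn emb y f a c) (hbd : ChordIn emb y f b d) (h1 : s ≤ a) (h2 : a < b) (h3 : b < c)
    (h4 : c < d) (h5 : d ≤ s + k) : False :=
  hf.not_crossing F.enum (by have := F.len; omega) h1 h2 h3 h4 h5 hac.1 hbd.1 hac.2 hbd.2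

/-- A vertex in the interior of the segments of two faces has, apart from its neighbours on
the cycle, only neighbours along chords inside these two faces. -/
theorem IsSeg.nbr (hf : IsSeg emb C y f s k v) (hg : IsSeg emb C y g s' k' u) (F : Frame C y)
    (hne : f ≠ g) {i : ℤ} (h1 : s < i) (h2 : i < s + k) (h3 : s' < i) (h4 : i < s' + k') {w : V}
    (hw : G.Adj (y i) w) : w = y (i - 1) ∨ w = y (i + 1) ∨
      (∃ j, s ≤ j ∧ j ≤ s + k ∧ (j < i - 1 ∨ i + 1 < j) ∧ w = y j ∧ ChordIn emb y f i j) ∨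
      ∃ j, s' ≤ j ∧ j ≤ s' + k' ∧ (j < i - 1 ∨ i + 1 < j) ∧ w = y j ∧ ChordIn emb y g i j := by
  have hy := F.enum
  have hlen := F.len
  have hc : 3 ≤ C.length := by omega
  have he : s(y i, w) ∈ G.edgeSet := hw
  have hcy := F.long.1
  have hI := F.long.2.1
  by_cases heC : s(y i, w) ∈ C.edges
  · obtain ⟨t, ht⟩ := (hy.mem_edges _).1 heC
    rcases Sym2.eq_iff.1 ht with ⟨h, rfl⟩ | ⟨h, rfl⟩
    · right; left
      rw [hy.eq_iff] at h ⊢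
      simpa using (dvd_neg.2 h)
    · left
      rw [hy.eq_iff] at h ⊢
      rw [show t - (i - 1) = -(i - (t + 1)) by ring]
      exact dvd_neg.2 h
  obtain ⟨O, hO, hfO⟩ := exists_side hf.face
  obtain ⟨O', hO', hgO'⟩ := exists_side hg.face
  have hee : s(y i, y (i + 1)) ∈ C.edges := (hy.mem_edges _).2 ⟨i, rfl⟩
  have hOO := hf.side_ne hg.face hy hc hne hO hfO hgO' hee
    ((hf.incEdge_iff hy hee).2 ⟨i, by omega, by omega, rfl⟩)
    ((hg.incEdge_iff hy hee).2 ⟨i, by omega, by omega, rfl⟩)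
  obtain ⟨O'', hO'', hne'', -, -, hall⟩ := IsCycleSet.exists_other_side ⟨x, C, hcy, rfl⟩ hO
  obtain rfl : O' = O'' := (hall O' hO').resolve_left (Ne.symm hOO)
  have hsub : inner emb s(y i, w) ⊆ (drawE emb (wEdges C))ᶜ := fun z hz hz' =>
    heC (mem_of_inner emb hw (wEdges_subset C) hz hz')
  obtain ⟨W, hW, hWs⟩ := exists_face (isPreconnected_inner emb hw) (inner_nonempty emb he) hsub
  have key : ∀ {f : Set (ℝ × ℝ)} {s k : ℤ} {v : V}, IsSeg emb C y f s k v → s < i → i < s + k →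
      inner emb s(y i, w) ⊆ f →
      (∃ j, s ≤ j ∧ j ≤ s + k ∧ w = y j ∧ ChordIn emb y f i j) := by
    intro f s k v hf h1 h2 hin
    obtain ⟨-, j, hj1, hj2, rfl⟩ := hf.mem_seg_of_inner_subset hcy hI hy he hin (w := w) (by simp)
    exact ⟨j, hj1, hj2, rfl, hw, hin⟩
  by_cases hw1 : w = y (i - 1)
  · exact Or.inl hw1
  by_cases hw2 : w = y (i + 1)
  · exact Or.inr (Or.inl hw2)
  have hfar : ∀ j, w = y j → j < i - 1 ∨ i + 1 < j := by
    rintro j rfl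
    by_contra hcon
    have : j = i - 1 ∨ j = i ∨ j = i + 1 := by omega
    rcases this with rfl | rfl | rfl
    exacts [hw1 rfl, hw.ne rfl, hw2 rfl]
  right; right
  rcases hall W hW with rfl | rfl
  · obtain ⟨j, a, b, c, d⟩ := key hf h1 h2 (hf.inner_subset hy hc hO hfO he hWs (by simp) h1 h2)
    exact Or.inl ⟨j, a, b, hfar j c, c, d⟩
  · obtain ⟨j, a, b, c, d⟩ := key hg h3 h4 (hg.inner_subset hy hc hO' hgO' he hWs (by simp) h3 h4)
    exact Or.inr ⟨j, a, b, hfar j c, c, d⟩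

/-- At most one face is opposite to a given face at an edge of the cycle. -/
theorem IsSeg.opposite_unique (hf : IsSeg emb C y f s k v) (hg : IsSeg emb C y g s' k' u)
    (hh : IsFaceOf (drawE emb (hEdges C)) h) (F : Frame C y) (hfg : f ≠ g) (hfh : f ≠ h)
    {e : Sym2 V} (he : e ∈ C.edges) (h1 : incEdge emb f e) (h2 : incEdge emb g e)
    (h3 : incEdge emb h e) : g = h := by
  by_contra hne
  have hy := F.enum
  have hlen := F.len
  have hc : 3 ≤ C.length := by omega
  obtain ⟨O, hO, hfO⟩ := exists_side hf.face
  obtain ⟨O₁, hO₁, hgO₁⟩ := exists_side hg.face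
  obtain ⟨O₂, hO₂, hhO₂⟩ := exists_side hh
  obtain ⟨O'', hO'', hne'', -, -, hall⟩ := IsCycleSet.exists_other_side ⟨x, C, F.long.1, rfl⟩ hO
  have a := hf.side_ne hg.face hy hc hfg hO hfO hgO₁ he h1 h2
  have b := hf.side_ne hh hy hc hfh hO hfO hhO₂ he h1 h3
  have c := hg.side_ne hh hy hc hne hO₁ hgO₁ hhO₂ he h2 h3
  exact c (((hall O₁ hO₁).resolve_left a.symm).trans ((hall O₂ hO₂).resolve_left b.symm).symm)

theorem IsSeg.two_le (hf : IsSeg emb C y f s k v) (F : Frame C y) : 2 ≤ k := by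
  by_contra h
  have hk := hf.k_pos
  obtain rfl : k = 1 := by omega
  have hlen := F.len
  exact F.not_reroute (a := s) (b := s + 1) (p := s) (q := s + 1) (l₁ := []) (l₂ := []) hf.off
    (by omega) rfl rfl (by simp) (by simp) hf.adj_left hf.adj_right (by simp)
    (by intro t; simp; omega)

theorem IsSeg.two_not_adj_right (hg : IsSeg emb C y g s 2 u) (F : Frame C y) :
    ¬ G.Adj (y (s + 1)) (y (s + 3)) := by
  intro h
  have hlen := F.len
  exact F.not_reroute (a := s) (b := s + 3) (p := s) (q := s + 2) (l₁ := []) (l₂ := [s + 1, s + 3])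
    hg.off (by omega) rfl rfl (by simp)
    (by simpa [h] using (by simpa [add_assoc] using (F.enum.adj (s + 1)).symm))
    hg.adj_left hg.adj_right (by simp) (by intro t; simp; omega)

theorem IsSeg.two_not_adj_left (hg : IsSeg emb C y g s 2 u) (F : Frame C y) :
    ¬ G.Adj (y (s + 1)) (y (s - 1)) := by
  have := (hg.mirror (s + s + 2)).two_not_adj_right (F.mirror (s + s + 2))
  convert this using 3 <;> ring_nf

end Neighbours

section Reducible

variable {V : Type*} [Fintype V] {G : SimpleGraph V} {emb : PlaneEmbedding G}
variable {x : V} {C : G.Walk x x} {y : ℤ → V}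
variable {f g g' h h' : Set (ℝ × ℝ)} {s k : ℤ} {u u' v w z : V}

theorem Frame.exists_nbr (F : Frame C y) (i : ℤ) :
    ∃ w, G.Adj (y i) w ∧ w ≠ y (i - 1) ∧ w ≠ y (i + 1) := by
  by_contra! hcon
  have hlen := F.len
  have hne : ∀ j, j < i + 8 → i - 8 < j → j ≠ i → y i ≠ y j := fun j h1 h2 h3 h =>
    h3 (F.enum.eq_of_lt h (by omega) (by omega)).symm
  refine not_cutOff F.conn (S := {y (i - 1), y (i + 1)}) Finset.card_le_two (T := {y i})
    (a := y i) (b := y (i + 2)) rfl ?_ ?_ ?_ ?_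
  · simp [hne]
  · simpa using (hne _ (by omega) (by omega) (by omega)).symm
  · have := F.enum.eq_iff (i + 2)
    simp only [Finset.mem_insert, Finset.mem_singleton, not_or]
    refine ⟨fun h => ?_, fun h => ?_⟩
    all_goals
      have := F.enum.eq_of_lt h (by omega) (by omega)
      omega
  · rintro _ rfl w hw
    right
    by_cases h1 : w = y (i - 1)
    · simp [h1]
    · simp [hcon w hw h1]

theorem Frame.not_cut (F : Frame C y) (i : ℤ)
    (h1 : ∀ w, G.Adj (y i) w → w = y (i - 1) ∨ w = y (i + 1) ∨ w = y (i + 2))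
    (h2 : ∀ w, G.Adj (y (i + 1)) w → w = y (i - 1) ∨ w = y i ∨ w = y (i + 2)) : False := by
  have hlen := F.len
  have hne : ∀ j l, j < i + 4 → i - 4 < j → l < i + 4 → i - 4 < l → j ≠ l → y j ≠ y l :=
    fun j l h1 h2 h3 h4 h5 h => h5 (F.enum.eq_of_lt h (by omega) (by omega))
  refine not_cutOff F.conn (S := {y (i - 1), y (i + 2)}) Finset.card_le_two
    (T := {y i, y (i + 1)}) (a := y i) (b := y (i + 3)) (by simp) ?_ ?_ ?_ ?_
  · simp only [Finset.mem_insert, Finset.mem_singleton, not_or]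
    constructor <;> apply hne <;> omega
  · simp only [mem_insert_iff, mem_singleton_iff, not_or]
    constructor <;> apply hne <;> omega
  · simp only [Finset.mem_insert, Finset.mem_singleton, not_or]
    constructor <;> apply hne <;> omega
  · simp only [mem_insert_iff, mem_singleton_iff, Finset.mem_insert, Finset.mem_singleton]
    rintro v (rfl | rfl) w hw
    · rcases h1 w hw with h | h | h <;> simp [h]
    · rcases h2 w hw with h | h | h <;> simp [h]

theorem IsSeg.three_not_adj_left (hg : IsSeg emb C y g s 3 u) (F : Frame C y) :
    ¬ G.Adj (y (s - 1)) (y (s + 2)) := by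
  intro h
  have hlen := F.len
  have h1 := (F.enum.adj (s + 1)).symm
  have h2 := (F.enum.adj s).symm
  rw [show s + 1 + 1 = s + 2 by ring] at h1
  exact F.not_reroute (a := s - 1) (b := s + 3) (p := s) (q := s + 3) (l₁ := [s + 2, s + 1, s])
    (l₂ := []) hg.off (by omega) rfl rfl (by simp [h, h1, h2]) (by simp)
    hg.adj_left hg.adj_right (by simp; omega) (by intro t; simp; omega)

theorem IsSeg.three_not_adj_right (hg : IsSeg emb C y g s 3 u) (F : Frame C y) :
    ¬ G.Adj (y (s + 1)) (y (s + 4)) := by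
  have := (hg.mirror (s + s + 3)).three_not_adj_left (F.mirror (s + s + 3))
  contrapose! this
  convert this.symm using 2 <;> ring

/-- The middle vertex of a 2-face is the end of a long chord in the opposite face. -/
theorem IsSeg.two_chord (hf : IsSeg emb C y f s k v) {i : ℤ} (hg : IsSeg emb C y g (i - 1) 2 u)
    (F : Frame C y) (hne : f ≠ g) (h1 : s < i) (h2 : i < s + k) :
    ∃ j, s ≤ j ∧ j ≤ s + k ∧ (j ≤ i - 3 ∨ i + 3 ≤ j) ∧ ChordIn emb y f i j := by
  obtain ⟨w, hw, hw1, hw2⟩ := F.exists_nbr i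
  rcases hf.nbr hg F hne h1 h2 (by omega) (by omega) hw with h | h | ⟨j, a, b, c, rfl, d⟩ |
    ⟨j, a, b, c, -, -⟩
  · exact absurd h hw1
  · exact absurd h hw2
  · refine ⟨j, a, b, ?_, d⟩
    by_contra hcon
    have : j = i - 2 ∨ j = i + 2 := by omega
    rcases this with rfl | rfl
    · have := hg.two_not_adj_left F
      rw [show i - 1 + 1 = i by ring, show i - 1 - 1 = i - 2 by ring] at this
      exact this hw
    · have := hg.two_not_adj_right F
      rw [show i - 1 + 1 = i by ring, show i - 1 + 3 = i + 2 by ring] at this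
      exact this hw
  · omega

theorem not_two_two (F : Frame C y) (hf : IsSeg emb C y f 0 6 v) (hg : IsSeg emb C y g 1 2 u)
    (hg' : IsSeg emb C y g' 3 2 u') (hne : f ≠ g) (hne' : f ≠ g') : False := by
  obtain ⟨j, h1, h2, h3, h⟩ := hf.two_chord (i := 2) hg F hne (by norm_num) (by norm_num)
  obtain ⟨j', h1', h2', h3', h'⟩ := hf.two_chord (i := 4) hg' F hne' (by norm_num) (by norm_num)
  exact hf.not_cross F h'.symm h (by omega) (by omega) (by omega) (by omega) (by omega)

theorem chord_of_two_two (F : Frame C y) (hf : IsSeg emb C y f 0 6 v)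
    (hg : IsSeg emb C y g 0 2 u) (hg' : IsSeg emb C y g' 2 2 u') (hne : f ≠ g) (hne' : f ≠ g') :
    ChordIn emb y f 3 6 := by
  obtain ⟨j, h1, h2, h3, h⟩ := hf.two_chord (i := 1) hg F hne (by norm_num) (by norm_num)
  obtain ⟨j', h1', h2', h3', h'⟩ := hf.two_chord (i := 3) hg' F hne' (by norm_num) (by norm_num)
  have : j' = 0 ∨ j' = 6 := by omega
  rcases this with rfl | rfl
  · exact (hf.not_cross F h'.symm h (by omega) (by omega) (by omega) (by omega) (by omega)).elim
  · exact h'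

theorem not_two_two_two (F : Frame C y) (hf : IsSeg emb C y f 0 6 v)
    (hc : ChordIn emb y f 3 6) (hh : IsSeg emb C y h 4 2 w) (hne : f ≠ h) : False := by
  obtain ⟨j, h1, h2, h3, h⟩ := hf.two_chord (i := 5) hh F hne (by norm_num) (by norm_num)
  exact hf.not_cross F h.symm hc (by omega) (by omega) (by omega) (by omega) (by omega)

theorem not_two_four (F : Frame C y) (hf : IsSeg emb C y f 0 6 v)
    (hc : ChordIn emb y f 3 6) (hg : IsSeg emb C y g 2 2 u) (hh : IsSeg emb C y h 4 4 w)
    (hfh : f ≠ h) (hh' : IsSeg emb C y h' 6 k z) (hk : k = 2 ∨ k = 3) (hne : h ≠ h') : False := by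
  have hlen := F.len
  have h54 := (F.enum.adj 4).symm
  have h67 := F.enum.adj 6
  norm_num at h54 h67
  obtain ⟨t, ht, ht1, ht2⟩ := F.exists_nbr 5
  rcases hf.nbr hh F hfh (i := 5) (by omega) (by omega) (by omega) (by omega) ht with
    h | h | ⟨j, a, b, c, rfl, d⟩ | ⟨j, a, b, c, rfl, d⟩
  · exact ht1 h
  · exact ht2 h
  · have : j = 3 ∨ j ≤ 2 := by omega
    rcases this with rfl | hj
    · exact hg.two_not_adj_right F ht.symm
    · exact hf.not_cross F d.symm hc (by omega) (by omega) (by omega) (by omega) (by omega)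
  · have : j = 7 ∨ j = 8 := by omega
    rcases this with rfl | rfl
    · exact F.not_reroute (a := 3) (b := 8) (p := 4) (q := 8) (l₁ := [6, 7, 5, 4])
        (l₂ := []) hh.off (by omega) rfl rfl (by simp [hc.adj, h67, ht.symm, h54]) (by simp)
        hh.adj_left hh.adj_right (by simp) (by intro t; simp; omega)
    · rcases hk with rfl | rfl
      · obtain ⟨j, h1, h2, h3, h⟩ := hh.two_chord (i := 7) hh' F hne (by norm_num) (by norm_num)
        obtain rfl : j = 4 := by omega
        exact hh.not_cross F h.symm d (by omega) (by omega) (by omega) (by omega) (by omega)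
      · exact hh'.three_not_adj_left F ht

theorem not_two_five (F : Frame C y) (hf : IsSeg emb C y f 0 6 v)
    (hc : ChordIn emb y f 3 6) (hg : IsSeg emb C y g 2 2 u) (hh : IsSeg emb C y h 4 5 w)
    (hfh : f ≠ h) (hh' : IsSeg emb C y h' 6 2 z) (hne : h ≠ h') : False := by
  obtain ⟨i, h1, h2, h3, hi⟩ := hh.two_chord (i := 7) hh' F hne (by norm_num) (by norm_num)
  obtain rfl : i = 4 := by omega
  obtain ⟨t, ht, ht1, ht2⟩ := F.exists_nbr 5
  rcases hf.nbr hh F hfh (i := 5) (by omega) (by omega) (by omega) (by omega) ht with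
    h | h | ⟨j, a, b, c, rfl, d⟩ | ⟨j, a, b, c, rfl, d⟩
  · exact ht1 h
  · exact ht2 h
  · have : j = 3 ∨ j ≤ 2 := by omega
    rcases this with rfl | hj
    · exact hg.two_not_adj_right F ht.symm
    · exact hf.not_cross F d.symm hc (by omega) (by omega) (by omega) (by omega) (by omega)
  · have : j = 7 ∨ 8 ≤ j := by omega
    rcases this with rfl | hj
    · exact hh'.two_not_adj_left F ht.symm
    · exact hh.not_cross F hi.symm d (by omega) (by omega) (by omega) (by omega) (by omega)

theorem not_three_two (F : Frame C y) (hf : IsSeg emb C y f 0 6 v) (hg : IsSeg emb C y g 0 3 u)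
    (hg' : IsSeg emb C y g' 3 2 u') (hne : f ≠ g) (hne' : f ≠ g') : False := by
  obtain ⟨j, h1, h2, h3, hj⟩ := hf.two_chord (i := 4) hg' F hne' (by norm_num) (by norm_num)
  have h14 : ¬ G.Adj (y 1) (y 4) := hg.three_not_adj_right F
  have h42 : ¬ G.Adj (y 4) (y 2) := hg'.two_not_adj_left F
  have : j = 0 ∨ j = 1 := by omega
  rcases this with rfl | rfl
  · refine F.not_cut 1 (fun w hw => ?_) fun w hw => ?_
    · rcases hf.nbr hg F hne (i := 1) (by omega) (by omega) (by omega) (by omega) hw with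
        h | h | ⟨i, a, b, c, rfl, d⟩ | ⟨i, a, b, c, rfl, d⟩
      · exact Or.inl h
      · exact Or.inr (Or.inl h)
      · have : i = 3 ∨ i = 4 ∨ 5 ≤ i := by omega
        rcases this with rfl | rfl | hi
        · exact Or.inr (Or.inr rfl)
        · exact absurd hw h14
        · exact (hf.not_cross F hj.symm d (by omega) (by omega) (by omega) (by omega)
            (by omega)).elim
      · obtain rfl : i = 3 := by omega
        exact Or.inr (Or.inr rfl)
    · rcases hf.nbr hg F hne (i := 2) (by omega) (by omega) (by omega) (by omega) hw with
        h | h | ⟨i, a, b, c, rfl, d⟩ | ⟨i, a, b, c, rfl, d⟩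
      · exact Or.inr (Or.inl h)
      · exact Or.inr (Or.inr h)
      · have : i = 0 ∨ i = 4 ∨ 5 ≤ i := by omega
        rcases this with rfl | rfl | hi
        · exact Or.inl rfl
        · exact absurd hw.symm h42
        · exact (hf.not_cross F hj.symm d (by omega) (by omega) (by omega) (by omega)
            (by omega)).elim
      · obtain rfl : i = 0 := by omega
        exact Or.inl rfl
  · exact h14 hj.adj.symm

theorem not_two_three_two (F : Frame C y) (hf : IsSeg emb C y f 0 6 v)
    (hg : IsSeg emb C y g 0 2 u) (hh : IsSeg emb C y h 2 3 w) (hg' : IsSeg emb C y g' 5 2 u')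
    (hne : f ≠ g) (hfh : f ≠ h) : False := by
  have hlen := F.len
  obtain ⟨j, h1, h2, h3, hj⟩ := hf.two_chord (i := 1) hg F hne (by norm_num) (by norm_num)
  have h14 : ¬ G.Adj (y 1) (y 4) := hh.three_not_adj_left F
  have h13 : ¬ G.Adj (y 1) (y 3) := hg.two_not_adj_right F
  have h64 : ¬ G.Adj (y 6) (y 4) := hg'.two_not_adj_left F
  have h4ne : j ≠ 4 := by
    rintro rfl
    exact h14 hj.adj
  have n3 : ∀ w, G.Adj (y 3) w → w = y 2 ∨ w = y 4 ∨ w = y 5 ∨ (w = y 6 ∧ j = 6) := by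
    intro w hw
    rcases hf.nbr hh F hfh (i := 3) (by omega) (by omega) (by omega) (by omega) hw with
        h | h | ⟨i, a, b, c, rfl, d⟩ | ⟨i, a, b, c, rfl, d⟩
    · exact Or.inl h
    · exact Or.inr (Or.inl h)
    · have : i = 0 ∨ i = 1 ∨ i = 5 ∨ i = 6 := by omega
      rcases this with rfl | rfl | rfl | rfl
      · exact (hf.not_cross F d.symm hj (by omega) (by omega) (by omega) (by omega)
            (by omega)).elim
      · exact absurd hw.symm h13
      · exact Or.inr (Or.inr (Or.inl rfl))
      · refine Or.inr (Or.inr (Or.inr ⟨rfl, ?_⟩))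
        by_contra hj6
        exact hf.not_cross F hj d (by omega) (by omega) (by omega) (by omega) (by omega)
    · obtain rfl : i = 5 := by omega
      exact Or.inr (Or.inr (Or.inl rfl))
  have n4 : ∀ w, G.Adj (y 4) w → w = y 2 ∨ w = y 3 ∨ w = y 5 := by
    intro w hw
    rcases hf.nbr hh F hfh (i := 4) (by omega) (by omega) (by omega) (by omega) hw with
        h | h | ⟨i, a, b, c, rfl, d⟩ | ⟨i, a, b, c, rfl, d⟩
    · exact Or.inr (Or.inl h)
    · exact Or.inr (Or.inr h)
    · have : i = 0 ∨ i = 1 ∨ i = 2 ∨ i = 6 := by omega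
      rcases this with rfl | rfl | rfl | rfl
      · exact (hf.not_cross F d.symm hj (by omega) (by omega) (by omega) (by omega)
            (by omega)).elim
      · exact absurd hw.symm h14
      · exact Or.inl rfl
      · exact absurd hw.symm h64
    · obtain rfl : i = 2 := by omega
      exact Or.inl rfl
  by_cases h36 : G.Adj (y 3) (y 6)
  · obtain ⟨t, ht, ht1, ht2⟩ := F.exists_nbr 4
    have h42 : G.Adj (y 4) (y 2) := by
      rcases n4 t ht with rfl | rfl | rfl
      · exact ht
      · exact absurd rfl ht1
      · exact absurd rfl ht2
    have h34 := F.enum.adj 3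
    have h56 := F.enum.adj 5
    norm_num at h34 h56
    exact F.not_reroute (a := 2) (b := 7) (p := 5) (q := 7) (l₁ := [4, 3, 6, 5])
      (l₂ := []) hg'.off (by omega) rfl rfl (by simp [h42.symm, h34.symm, h36, h56.symm]) (by simp)
      hg'.adj_left hg'.adj_right (by simp) (by intro t; simp; omega)
  · refine F.not_cut 3 (fun w hw => ?_) fun w hw => n4 w hw
    rcases n3 w hw with h | h | h | ⟨rfl, -⟩
    · exact Or.inl h
    · exact Or.inr (Or.inl h)
    · exact Or.inr (Or.inr h)
    · exact absurd hw h36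

end Reducible

/-- The bound on the weight sent by a 6-face, from a decomposition of its six `C`-edges into
the segments of the opposite faces.  The predicates `P` and `Q` stand for 2-faces and 3-faces
with a given first edge, `R`, `M` and `R'`, `M'` for 4- and 5-faces at the two ends. -/
theorem sum_rate_le {t : ℤ → ℤ} {P Q Fr : ℤ → Prop} {R M R' M' : Prop}
    (le_six : ∀ i, t i ≤ 6)
    (first : Fr 0 ∨ (t 0 ≤ 2 ∧ Fr 1) ∨ (P (-1) ∧ t 0 ≤ 4 ∧ Fr 1) ∨
      (Q (-1) ∧ t 1 ≤ 0 ∧ Fr 2) ∨ (R' ∧ t 0 ≤ 2 ∧ t 1 ≤ 2 ∧ Fr 2) ∨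
      (M' ∧ t 0 ≤ 1 ∧ t 1 ≤ 1 ∧ Fr 2) ∨ (t 0 ≤ 0 ∧ t 1 ≤ 0 ∧ (Fr 2 ∨ t 2 ≤ 0 ∧ Fr 3)) ∨
      (t 0 ≤ 0 ∧ t 1 ≤ 0 ∧ t 2 ≤ 0 ∧ t 3 ≤ 0))
    (step : ∀ i, 0 ≤ i → i ≤ 5 → Fr i → (t i ≤ -6 ∧ Fr (i + 1)) ∨
      (P i ∧ t i ≤ 4 ∧ (i ≤ 4 → t (i + 1) ≤ 4 ∧ Fr (i + 2))) ∨
      (Q i ∧ t i ≤ 0 ∧ (i ≤ 3 → t (i + 2) ≤ 0 ∧ Fr (i + 3))) ∨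
      (t i ≤ 0 ∧ (i ≤ 4 → t (i + 1) ≤ 0) ∧ (i ≤ 3 → t (i + 2) ≤ 0) ∧ (i ≤ 2 → t (i + 3) ≤ 0)) ∨
      (i = 4 ∧ R ∧ t 4 ≤ 2 ∧ t 5 ≤ 2) ∨ (i = 4 ∧ M ∧ t 4 ≤ 1 ∧ t 5 ≤ 1) ∨ (i = 5 ∧ t 5 ≤ 2))
    (F₁ : P 1 → P 3 → False) (F₂ : P 0 → P 2 → P 4 → False)
    (F₃ : P 0 → P 2 → Q 4 → False) (F₃' : P 4 → P 2 → Q (-1) → False)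
    (F₄ : P 0 → P 2 → R → False) (F₄' : P 4 → P 2 → R' → False)
    (F₅ : P 0 → P 2 → M → False) (F₅' : P 4 → P 2 → M' → False)
    (F₆ : Q 0 → P 3 → False) (F₆' : Q 3 → P 1 → False)
    (F₇ : P 0 → Q 2 → P 5 → False) (F₇' : P 4 → Q 1 → P (-1) → False)
    (F₈ : P 2 → Q (-1) → Q 4 → False)
    (F₉ : P 2 → Q (-1) → R → False) (F₉' : P 2 → Q 4 → R' → False) :
    t 0 + t 1 + t 2 + t 3 + t 4 + t 5 ≤ 16 := by
  have s0 := step 0 (by norm_num) (by norm_num)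
  have s1 := step 1 (by norm_num) (by norm_num)
  have s2 := step 2 (by norm_num) (by norm_num)
  have s3 := step 3 (by norm_num) (by norm_num)
  have s4 := step 4 (by norm_num) (by norm_num)
  have s5 := step 5 (by norm_num) (by norm_num)
  have l0 := le_six 0
  have l1 := le_six 1
  have l2 := le_six 2
  have l3 := le_six 3
  have l4 := le_six 4
  have l5 := le_six 5
  clear step le_six
  norm_num at s0 s1 s2 s3 s4 s5
  by_contra hcon
  rcases first with f0 | ⟨_, f1⟩ | ⟨p', _, f1⟩ | ⟨q', _, f2⟩ | ⟨r', _, _, f2⟩ | ⟨m', _, _, f2⟩ |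
    ⟨_, _, f2 | ⟨_, f3⟩⟩ | ⟨_, _, _, _⟩
  on_goal 1 => rcases s0 f0 with ⟨_, f1⟩ | ⟨p0, _, _, f2⟩ | ⟨q0, _, _, f3⟩ | ⟨_, _, _, _⟩
  all_goals try (specialize s1 f1
                 rcases s1 with ⟨_, f2⟩ | ⟨p1, _, _, f3⟩ | ⟨q1, _, _, f4⟩ | ⟨_, _, _, _⟩)
  all_goals try (specialize s2 f2
                 rcases s2 with ⟨_, f3⟩ | ⟨p2, _, _, f4⟩ | ⟨q2, _, _, f5⟩ | ⟨_, _, _, _⟩)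
  all_goals try (specialize s3 f3
                 rcases s3 with ⟨_, f4⟩ | ⟨p3, _, _, f5⟩ | ⟨q3, _, _⟩ | ⟨_, _, _⟩)
  all_goals try (specialize s4 f4
                 rcases s4 with ⟨_, f5⟩ | ⟨p4, _, _⟩ | ⟨q4, _⟩ | ⟨_, _⟩ | ⟨r, _, _⟩ | ⟨m, _, _⟩)
  all_goals try (specialize s5 f5; rcases s5 with _ | ⟨p5, _⟩ | _ | _ | _)
  all_goals first
    | omega
    | exact F₁ p1 p3
    | exact F₂ p0 p2 p4
    | exact F₃ p0 p2 q4
    | exact F₃' p4 p2 q'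
    | exact F₄ p0 p2 r
    | exact F₄' p4 p2 r'
    | exact F₅ p0 p2 m
    | exact F₅' p4 p2 m'
    | exact F₆ q0 p3
    | exact F₆' q3 p1
    | exact F₇ p0 q2 p5
    | exact F₇' p4 q1 p'
    | exact F₈ p2 q' q4
    | exact F₉ p2 q' r
    | exact F₉' p2 q4 r'

section Rates

variable {V : Type*} {G : SimpleGraph V} {emb : PlaneEmbedding G}
variable {x : V} {C : G.Walk x x} {y : ℤ → V}
variable {f g h : Set (ℝ × ℝ)} {s k i : ℤ} {u v : V}

theorem CyclicEnum.edge_mem (hy : CyclicEnum C y) (i : ℤ) : s(y i, y (i + 1)) ∈ C.edges :=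
  (hy.mem_edges _).2 ⟨i, rfl⟩

variable [Fintype V]

theorem IsSeg.incEdge_of_mem (hg : IsSeg emb C y g s k u) (F : Frame C y) (h1 : s ≤ i)
    (h2 : i < s + k) : incEdge emb g s(y i, y (i + 1)) :=
  (hg.incEdge_iff F.enum (F.enum.edge_mem i)).2 ⟨i, h1, h2, rfl⟩

theorem IsSeg.not_incEdge (hg : IsSeg emb C y g s k u) (F : Frame C y) (h1 : s + k ≤ i)
    (h2 : i < s + C.length) : ¬ incEdge emb g s(y i, y (i + 1)) := by
  have hlen := F.len
  rw [hg.incEdge_iff F.enum (F.enum.edge_mem i)]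
  rintro ⟨t, h3, h4, h5⟩
  have h6 := (F.enum.edge_eq_iff (by omega) i t).1 h5
  have := Int.eq_zero_of_abs_lt_dvd h6 (abs_lt.2 ⟨by omega, by omega⟩)
  omega

theorem IsSeg.exists_rotate (hg : IsSeg emb C y g s k u) (F : Frame C y)
    (h : incEdge emb g s(y i, y (i + 1))) :
    ∃ s', IsSeg emb C y g s' k u ∧ s' ≤ i ∧ i < s' + k := by
  have hlen := F.len
  obtain ⟨t, h1, h2, h3⟩ := (hg.incEdge_iff F.enum (F.enum.edge_mem i)).1 h
  obtain ⟨m, hm⟩ := (F.enum.edge_eq_iff (by omega) i t).1 h3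
  refine ⟨s + m * C.length, hg.rotate F.enum m, ?_, ?_⟩ <;> linarith

theorem Frame.edge_injOn (F : Frame C y) {a b : ℤ} (h : b - a ≤ C.length) :
    Set.InjOn (fun t => s(y t, y (t + 1))) (Finset.Ico a b) := by
  intro p hp q hq hpq
  have hlen := F.len
  simp only [Finset.coe_Ico, mem_Ico] at hp hq
  have := Int.eq_zero_of_abs_lt_dvd ((F.enum.edge_eq_iff (by omega) p q).1 hpq)
    (abs_lt.2 ⟨by omega, by omega⟩)
  omega

theorem IsSeg.filter_incEdge (hg : IsSeg emb C y g s k u) (F : Frame C y) :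
    C.edges.toFinset.filter (fun e => incEdge emb g e) =
      (Finset.Ico s (s + k)).image fun t => s(y t, y (t + 1)) := by
  ext e
  simp only [Finset.mem_filter, List.mem_toFinset, Finset.mem_image, Finset.mem_Ico]
  constructor
  · rintro ⟨h1, h2⟩
    obtain ⟨t, h3, h4, rfl⟩ := (hg.incEdge_iff F.enum h1).1 h2
    exact ⟨t, ⟨h3, h4⟩, rfl⟩
  · rintro ⟨t, ⟨h3, h4⟩, rfl⟩
    exact ⟨F.enum.edge_mem t, hg.incEdge_of_mem F h3 h4⟩

theorem IsSeg.numCEdges_eq (hg : IsSeg emb C y g s k u) (F : Frame C y) :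
    (numCEdges emb C g : ℤ) = k := by
  have h1 := hg.k_lt
  have h2 := hg.k_pos
  rw [numCEdges, hg.filter_incEdge F, Finset.card_image_of_injOn (F.edge_injOn (by omega))]
  simp
  omega

theorem IsSeg.three_le_mEdges (hg : IsSeg emb C y g s k u) {s' k' : ℤ}
    (hf : IsSeg emb C y f s' k' v) (F : Frame C y) (h1 : s ≤ i) (h2 : i + 3 ≤ s + k)
    (h3 : s' ≤ i) (h4 : i + 3 ≤ s' + k') : 3 ≤ mEdges emb C g f := by
  have hlen := F.len
  have : ((Finset.Ico i (i + 3)).image fun t => s(y t, y (t + 1))).card = 3 := by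
    rw [Finset.card_image_of_injOn (F.edge_injOn (by omega))]
    simp
  rw [← this]
  refine Finset.card_le_card fun e he => ?_
  simp only [Finset.mem_image, Finset.mem_Ico] at he
  obtain ⟨t, ⟨h5, h6⟩, rfl⟩ := he
  simp only [Finset.mem_filter, List.mem_toFinset]
  exact ⟨F.enum.edge_mem t, hg.incEdge_of_mem F (by omega) (by omega),
    hf.incEdge_of_mem F (by omega) (by omega)⟩

theorem IsSeg.eq_of_isMiddleCEdge (hg : IsSeg emb C y g s 3 u) (F : Frame C y) (h1 : s ≤ i)
    (h2 : i < s + 3) (h : IsMiddleCEdge emb C g s(y i, y (i + 1))) : i = s + 1 := by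
  have hlen := F.len
  have key : ∀ j, s ≤ j → j < s + 3 → j ≠ i → j = i + 1 ∨ j = i - 1 := by
    intro j h3 h4 h5
    obtain ⟨w, hw, hw'⟩ := h.2.2 _ (F.enum.edge_mem j) (hg.incEdge_of_mem F h3 h4) (by
      rintro h6
      have := F.edge_injOn (a := s) (b := s + 3) (by omega) (by simp; omega) (by simp; omega) h6
      exact h5 this)
    rcases Sym2.mem_iff.1 hw with rfl | rfl <;> rcases Sym2.mem_iff.1 hw' with h6 | h6 <;>
    · have := F.enum.eq_of_lt h6 (by omega) (by omega)
      omega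
  by_contra hne
  have : i = s ∨ i = s + 2 := by omega
  rcases this with rfl | rfl
  · have := key (i + 2) (by omega) (by omega) (by omega)
    omega
  · have := key s (by omega) (by omega) (by omega)
    omega

/-- The face `f` sends weight to `g` by rule R4. -/
def ActiveFour (emb : PlaneEmbedding G) (C : G.Walk x x) (f g : Set (ℝ × ℝ)) : Prop :=
  MinorFaceH emb C f ∧ 4 ≤ numCEdges emb C f ∧ MinorFaceH emb C g ∧
    numCEdges emb C g = 4 ∧ OppositeFaces emb C g f ∧ mEdges emb C g f = 2 ∧
    ∃ f₂ : Set (ℝ × ℝ), MinorFaceH emb C f₂ ∧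
      (numCEdges emb C f₂ = 2 ∨ numCEdges emb C f₂ = 3) ∧
      OppositeFaces emb C g f₂ ∧ mEdges emb C g f₂ = 2

/-- The face `f` sends weight to `g` by rule R5. -/
def ActiveFive (emb : PlaneEmbedding G) (C : G.Walk x x) (f g : Set (ℝ × ℝ)) : Prop :=
  MinorFaceH emb C f ∧ 4 ≤ numCEdges emb C f ∧ MinorFaceH emb C g ∧
    numCEdges emb C g = 5 ∧ OppositeFaces emb C g f ∧ mEdges emb C g f = 2 ∧
    ∃ g₁ g₂ : Set (ℝ × ℝ), g₁ ≠ g₂ ∧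
      MinorFaceH emb C g₁ ∧ numCEdges emb C g₁ = 2 ∧ OppositeFaces emb C g g₁ ∧
      MinorFaceH emb C g₂ ∧ numCEdges emb C g₂ = 2 ∧ OppositeFaces emb C g g₂

/-- Six times the weight that `f` loses to the opposite face `g` along the common edge `e`. -/
def rate (emb : PlaneEmbedding G) (C : G.Walk x x) (f g : Set (ℝ × ℝ)) (e : Sym2 V) : ℤ :=
  if MajorFaceH emb C g then -6
  else if numCEdges emb C g = 2 then 4
  else if numCEdges emb C g = 3 ∧ IsMiddleCEdge emb C g e then 6
  else if ActiveFour emb C f g then 2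
  else if ActiveFive emb C f g then 1
  else 0

theorem rate_le_six (e : Sym2 V) : rate emb C f g e ≤ 6 := by
  unfold rate
  split_ifs <;> norm_num

theorem rate_of_major (hg : MajorFaceH emb C g) (e : Sym2 V) : rate emb C f g e = -6 := by
  simp [rate, hg]

theorem rate_le_of_two (hg : numCEdges emb C g = 2) (e : Sym2 V) : rate emb C f g e ≤ 4 := by
  unfold rate
  split_ifs <;> norm_num

theorem rate_le_of_not_middle (hg : numCEdges emb C g = 3) {e : Sym2 V}
    (he : ¬ IsMiddleCEdge emb C g e) : rate emb C f g e ≤ 0 := by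
  have h4 : ¬ ActiveFour emb C f g := fun h => by have := h.2.2.2.1; omega
  have h5 : ¬ ActiveFive emb C f g := fun h => by have := h.2.2.2.1; omega
  simp only [rate, hg, he, h4, h5]
  split_ifs <;> simp_all

theorem rate_le_of_four_le (hg : 4 ≤ numCEdges emb C g) (e : Sym2 V) : rate emb C f g e ≤ 2 := by
  unfold rate
  split_ifs <;> omega

theorem rate_le_of_not_four (hg : 4 ≤ numCEdges emb C g) (h4 : ¬ ActiveFour emb C f g)
    (e : Sym2 V) : rate emb C f g e ≤ 1 := by
  unfold rate
  split_ifs <;> omega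

theorem rate_le_of_not_active (hg : 4 ≤ numCEdges emb C g) (h4 : ¬ ActiveFour emb C f g)
    (h5 : ¬ ActiveFive emb C f g) (e : Sym2 V) : rate emb C f g e ≤ 0 := by
  unfold rate
  split_ifs <;> omega

/-- The 4-face `g` along the last two edges of the 6-face `f` is active. -/
theorem IsSeg.exists_of_activeFour (hf : IsSeg emb C y f 0 6 v) (hg : IsSeg emb C y g 4 4 u)
    (F : Frame C y) (hact : ActiveFour emb C f g) :
    ∃ h k w, IsSeg emb C y h 6 k w ∧ (k = 2 ∨ k = 3) ∧ g ≠ h := by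
  obtain ⟨-, -, -, -, ⟨hne, -⟩, -, h, hm, hk, ⟨hgh, -⟩, h2⟩ := hact
  obtain ⟨s, k, w, hh⟩ := exists_isSeg emb F.long.1 F.long.2.1 F.enum hm
  have hhk := hh.numCEdges_eq F
  have hfh : f ≠ h := by
    rintro rfl
    have := hf.numCEdges_eq F
    omega
  have hno : ∀ i, 4 ≤ i → i < 6 → ¬ incEdge emb h s(y i, y (i + 1)) := fun i h3 h4 h5 =>
    hfh (hg.opposite_unique hf hh.face F hne hgh (F.enum.edge_mem i)
      (hg.incEdge_of_mem F h3 (by omega)) (hf.incEdge_of_mem F (by omega) (by omega)) h5)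
  have h6 : incEdge emb h s(y 6, y (6 + 1)) := by
    by_contra hcon
    have : mEdges emb C g h ≤ ({s(y 7, y (7 + 1))} : Finset (Sym2 V)).card := by
      refine Finset.card_le_card fun e he => ?_
      simp only [Finset.mem_filter, List.mem_toFinset] at he
      obtain ⟨t, h3, h4, rfl⟩ := (hg.incEdge_iff F.enum he.1).1 he.2.1
      have h5 : t = 4 ∨ t = 5 ∨ t = 6 ∨ t = 7 := by omega
      rcases h5 with rfl | rfl | rfl | rfl
      · exact (hno _ (by norm_num) (by norm_num) he.2.2).elim
      · exact (hno _ (by norm_num) (by norm_num) he.2.2).elim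
      · exact (hcon he.2.2).elim
      · simp
    rw [Finset.card_singleton] at this
    omega
  obtain ⟨s', hs, h3, h4⟩ := hh.exists_rotate F h6
  obtain rfl : s' = 6 := by
    by_contra hs'
    exact hno 5 (by norm_num) (by norm_num) (hs.incEdge_of_mem F (by omega) (by omega))
  exact ⟨h, k, w, hs, by omega, hgh⟩

/-- The 5-face `g` along the last two edges of the 6-face `f` is active. -/
theorem IsSeg.exists_of_activeFive (hf : IsSeg emb C y f 0 6 v) (hg : IsSeg emb C y g 4 5 u)
    (F : Frame C y) (hact : ActiveFive emb C f g) :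
    ∃ h w, IsSeg emb C y h 6 2 w ∧ g ≠ h := by
  obtain ⟨-, -, -, -, ⟨hne, -⟩, -, g₁, g₂, h12, hm₁, hk₁, ho₁, hm₂, hk₂, ho₂⟩ := hact
  have key : ∀ h, MinorFaceH emb C h → numCEdges emb C h = 2 → OppositeFaces emb C g h →
      ∃ s w, IsSeg emb C y h s 2 w ∧ 6 ≤ s ∧ s ≤ 8 := by
    intro h hm hk ⟨hgh, e, he, h1, h2⟩
    obtain ⟨s, k, w, hh⟩ := exists_isSeg emb F.long.1 F.long.2.1 F.enum hm
    have hhk := hh.numCEdges_eq F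
    obtain rfl : k = 2 := by omega
    have hfh : f ≠ h := by
      rintro rfl
      have := hf.numCEdges_eq F
      omega
    have hno : ∀ i, 4 ≤ i → i < 6 → ¬ incEdge emb h s(y i, y (i + 1)) := fun i h3 h4 h5 =>
      hfh (hg.opposite_unique hf hh.face F hne hgh (F.enum.edge_mem i)
        (hg.incEdge_of_mem F h3 (by omega)) (hf.incEdge_of_mem F (by omega) (by omega)) h5)
    obtain ⟨t, h3, h4, rfl⟩ := (hg.incEdge_iff F.enum he).1 h1
    obtain ⟨s', hs, h5, h6⟩ := hh.exists_rotate F h2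
    have h7 : ¬ t < 6 := fun h7 => hno t h3 h7 h2
    refine ⟨s', w, hs, ?_, by omega⟩
    by_contra h8
    exact hno 5 (by norm_num) (by norm_num) (hs.incEdge_of_mem F (by omega) (by omega))
  obtain ⟨s₁, w₁, h₁, a, b⟩ := key g₁ hm₁ hk₁ ho₁
  obtain ⟨s₂, w₂, h₂, a', b'⟩ := key g₂ hm₂ hk₂ ho₂
  by_cases hs₁ : s₁ = 6
  · exact ⟨g₁, w₁, hs₁ ▸ h₁, ho₁.1⟩
  by_cases hs₂ : s₂ = 6
  · exact ⟨g₂, w₂, hs₂ ▸ h₂, ho₂.1⟩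
  exact (h12 (hg.opposite_unique h₁ h₂.face F ho₁.1 ho₂.1 (F.enum.edge_mem 8)
    (hg.incEdge_of_mem F (by omega) (by omega)) (h₁.incEdge_of_mem F (by omega) (by omega))
    (h₂.incEdge_of_mem F (by omega) (by omega)))).elim

end Rates

section SixFace

variable {V : Type*} [Fintype V] {G : SimpleGraph V} {emb : PlaneEmbedding G}
variable {x : V} {C : G.Walk x x} {y : ℤ → V}
variable {f g h : Set (ℝ × ℝ)} {s k i j : ℤ} {u v : V}

/-- A face different from `f` has exactly `k` edges of `C`, starting with the edge `i`. -/
def HasSeg (emb : PlaneEmbedding G) (C : G.Walk x x) (f : Set (ℝ × ℝ)) (k : ℤ) (y : ℤ → V)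
    (i : ℤ) : Prop :=
  ∃ g u, IsSeg emb C y g i k u ∧ f ≠ g

/-- A face with `k` edges along the last two edges of the 6-face `f`, together with a further
2- or 3-face next to `f`. -/
def HasEnd (emb : PlaneEmbedding G) (C : G.Walk x x) (f : Set (ℝ × ℝ)) (k : ℤ) (y : ℤ → V) :
    Prop :=
  ∃ g u h l w, IsSeg emb C y g 4 k u ∧ f ≠ g ∧ IsSeg emb C y h 6 l w ∧ (l = 2 ∨ l = 3 ∧ k = 4) ∧
    g ≠ h

/-- No minor face different from `f` contains both edges of `C` at the vertex `y i`. -/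
def Free (emb : PlaneEmbedding G) (C : G.Walk x x) (f : Set (ℝ × ℝ)) (y : ℤ → V) (i : ℤ) :
    Prop :=
  ∀ g s k u, IsSeg emb C y g s k u → MinorFaceH emb C g → f ≠ g → s < i → i < s + k → False

/-- A choice of opposite faces for the edges of `C`. -/
def IsOpposite (emb : PlaneEmbedding G) (C : G.Walk x x) (f : Set (ℝ × ℝ)) (y : ℤ → V)
    (O : ℤ → Set (ℝ × ℝ)) : Prop :=
  ∀ i, IsFaceOf (drawE emb (hEdges C)) (O i) ∧ f ≠ O i ∧ incEdge emb (O i) s(y i, y (i + 1))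

theorem HasSeg.mirror (hs : HasSeg emb C f k y i) (hj : j = 6 - i - k) :
    HasSeg emb C f k (fun i => y (6 - i)) j := by
  obtain ⟨g, u, hg, hne⟩ := hs
  exact ⟨g, u, hj ▸ hg.mirror 6, hne⟩

theorem IsSeg.mirror_six (hf : IsSeg emb C y f 0 6 v) :
    IsSeg emb C (fun i => y (6 - i)) f 0 6 v := by
  simpa using hf.mirror 6

variable {O : ℤ → Set (ℝ × ℝ)}

theorem IsOpposite.eq (hO : IsOpposite emb C f y O) (F : Frame C y) (hf : IsSeg emb C y f 0 6 v)
    (hg : IsSeg emb C y g s k u) (hne : f ≠ g) (h1 : s ≤ i) (h2 : i < s + k) (h3 : 0 ≤ i)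
    (h4 : i < 6) : O i = g :=
  (hf.opposite_unique hg (hO i).1 F hne (hO i).2.1 (F.enum.edge_mem i)
    (hf.incEdge_of_mem F h3 (by omega)) (hg.incEdge_of_mem F h1 h2) (hO i).2.2).symm

theorem IsOpposite.major_or (hO : IsOpposite emb C f y O) (F : Frame C y) (i : ℤ) :
    MajorFaceH emb C (O i) ∨ MinorFaceH emb C (O i) ∧ ∃ s k u, IsSeg emb C y (O i) s k u ∧
      s ≤ i ∧ i < s + k ∧ 2 ≤ k ∧ (numCEdges emb C (O i) : ℤ) = k := by
  by_cases hm : MinorFaceH emb C (O i)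
  · obtain ⟨s, k, u, hs⟩ := exists_isSeg emb F.long.1 F.long.2.1 F.enum hm
    obtain ⟨s', hs', h1, h2⟩ := hs.exists_rotate F (hO i).2.2
    exact Or.inr ⟨hm, s', k, u, hs', h1, h2, hs.two_le F, hs.numCEdges_eq F⟩
  · refine Or.inl ⟨?_, hm⟩
    rw [drawingH_eq emb F.long.1 F.long.2.1]
    exact (hO i).1

theorem IsSeg.free (hf : IsSeg emb C y f 0 6 v) (F : Frame C y) (hg : IsSeg emb C y g s k u)
    (hne : f ≠ g) (h1 : 0 < s + k) (h2 : s + k ≤ 6) : Free emb C f y (s + k) := by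
  intro g' s' k' u' hg' _ hne' h3 h4
  have hk := hg.k_pos
  have hk' := hg.k_lt
  obtain rfl : g = g' := hf.opposite_unique hg hg'.face F hne hne' (F.enum.edge_mem (s + k - 1))
    (hf.incEdge_of_mem F (by omega) (by omega)) (hg.incEdge_of_mem F (by omega) (by omega))
    (hg'.incEdge_of_mem F (by omega) (by omega))
  exact hg.not_incEdge F le_rfl (by omega) (hg'.incEdge_of_mem F (by omega) (by omega))

theorem IsOpposite.free_of_major (hO : IsOpposite emb C f y O) (F : Frame C y)
    (hf : IsSeg emb C y f 0 6 v) (hm : MajorFaceH emb C (O i)) (h1 : 0 ≤ i) (h2 : i < 6) :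
    Free emb C f y (i + 1) := by
  intro g s k u hg hgm hne h3 h4
  have := hO.eq F hf hg hne (i := i) (by omega) (by omega) h1 h2
  exact hm.2 (this ▸ hgm)

theorem IsSeg.not_active (hf : IsSeg emb C y f 0 6 v) (F : Frame C y)
    (hg : IsSeg emb C y g s k u) (h1 : s ≤ i) (h2 : i + 3 ≤ s + k) (h3 : 0 ≤ i) (h4 : i ≤ 3) :
    ¬ ActiveFour emb C f g ∧ ¬ ActiveFive emb C f g := by
  have := hg.three_le_mEdges hf F h1 h2 h3 (by omega)
  constructor <;>
  · intro h
    have := h.2.2.2.2.2.1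
    omega

theorem IsOpposite.step (hO : IsOpposite emb C f y O) (F : Frame C y)
    (hf : IsSeg emb C y f 0 6 v) {t : ℤ → ℤ}
    (ht : ∀ i, t i = rate emb C f (O i) s(y i, y (i + 1))) (i : ℤ) (h0 : 0 ≤ i) (h5 : i ≤ 5)
    (hi : Free emb C f y i) : (t i ≤ -6 ∧ Free emb C f y (i + 1)) ∨
      (HasSeg emb C f 2 y i ∧ t i ≤ 4 ∧ (i ≤ 4 → t (i + 1) ≤ 4 ∧ Free emb C f y (i + 2))) ∨
      (HasSeg emb C f 3 y i ∧ t i ≤ 0 ∧ (i ≤ 3 → t (i + 2) ≤ 0 ∧ Free emb C f y (i + 3))) ∨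
      (t i ≤ 0 ∧ (i ≤ 4 → t (i + 1) ≤ 0) ∧ (i ≤ 3 → t (i + 2) ≤ 0) ∧
        (i ≤ 2 → t (i + 3) ≤ 0)) ∨
      (i = 4 ∧ HasEnd emb C f 4 y ∧ t 4 ≤ 2 ∧ t 5 ≤ 2) ∨
      (i = 4 ∧ HasEnd emb C f 5 y ∧ t 4 ≤ 1 ∧ t 5 ≤ 1) ∨ (i = 5 ∧ t 5 ≤ 2) := by
  rcases hO.major_or F i with hm | ⟨hm, s, k, u, hg, h1, h2, hk, hn⟩
  · exact Or.inl ⟨(ht i).le.trans (rate_of_major hm _).le, hO.free_of_major F hf hm h0 (by omega)⟩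
  have hne := (hO i).2.1
  obtain rfl : s = i := by
    by_contra hs
    exact hi _ s k u hg hm hne (by omega) h2
  have hOj : ∀ j, s ≤ j → j < s + k → j ≤ 5 → t j = rate emb C f (O s) s(y j, y (j + 1)) :=
    fun j a b c => by rw [ht, hO.eq F hf hg hne a b (by omega) (by omega)]
  have hfree : s + k ≤ 6 → Free emb C f y (s + k) := fun h => hf.free F hg hne (by omega) h
  generalize hgo : O s = g at *
  have hk' : k = 2 ∨ k = 3 ∨ 4 ≤ k := by omega
  rcases hk' with rfl | rfl | hk4
  · have h4 : ∀ j, s ≤ j → j < s + 2 → j ≤ 5 → t j ≤ 4 := fun j a b c =>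
      (hOj j a b c).le.trans (rate_le_of_two (by omega) _)
    exact Or.inr (Or.inl ⟨⟨g, u, hg, hne⟩, h4 _ (by omega) (by omega) (by omega), fun h =>
      ⟨h4 _ (by omega) (by omega) (by omega), hfree (by omega)⟩⟩)
  · have h4 : ∀ j, s ≤ j → j < s + 3 → j ≤ 5 → j ≠ s + 1 → t j ≤ 0 := fun j a b c d =>
      (hOj j a b c).le.trans (rate_le_of_not_middle (by omega)
        fun h => d (hg.eq_of_isMiddleCEdge F a b h))
    exact Or.inr (Or.inr (Or.inl ⟨⟨g, u, hg, hne⟩, h4 _ (by omega) (by omega) (by omega)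
      (by omega), fun h => ⟨h4 _ (by omega) (by omega) (by omega) (by omega), hfree (by omega)⟩⟩))
  have hn4 : 4 ≤ numCEdges emb C g := by omega
  have h2' : ∀ j, s ≤ j → j < s + k → j ≤ 5 → t j ≤ 2 := fun j a b c =>
    (hOj j a b c).le.trans (rate_le_of_four_le hn4 _)
  by_cases hs5 : s = 5
  · subst hs5
    exact Or.inr (Or.inr (Or.inr (Or.inr (Or.inr (Or.inr
      ⟨rfl, h2' 5 (by omega) (by omega) (by omega)⟩)))))
  by_cases ha4 : ActiveFour emb C f g
  · obtain rfl : s = 4 := by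
      by_contra hs4
      exact (hf.not_active F hg le_rfl (by omega) h0 (by omega)).1 ha4
    have := ha4.2.2.2.1
    obtain rfl : k = 4 := by omega
    obtain ⟨h, l, w, hh, hl, hgh⟩ := hf.exists_of_activeFour hg F ha4
    exact Or.inr (Or.inr (Or.inr (Or.inr (Or.inl ⟨rfl, ⟨g, u, h, l, w, hg, hne, hh,
      by omega, hgh⟩, h2' 4 (by omega) (by omega) (by omega),
      h2' 5 (by omega) (by omega) (by omega)⟩))))
  by_cases ha5 : ActiveFive emb C f g
  · obtain rfl : s = 4 := by
      by_contra hs4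
      exact (hf.not_active F hg le_rfl (by omega) h0 (by omega)).2 ha5
    have := ha5.2.2.2.1
    obtain rfl : k = 5 := by omega
    obtain ⟨h, w, hh, hgh⟩ := hf.exists_of_activeFive hg F ha5
    have h1' : ∀ j, 4 ≤ j → j < 4 + 5 → j ≤ 5 → t j ≤ 1 := fun j a b c =>
      (hOj j a b c).le.trans (rate_le_of_not_four hn4 ha4 _)
    exact Or.inr (Or.inr (Or.inr (Or.inr (Or.inr (Or.inl ⟨rfl, ⟨g, u, h, 2, w, hg, hne, hh,
      by omega, hgh⟩, h1' 4 (by omega) (by omega) (by omega),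
      h1' 5 (by omega) (by omega) (by omega)⟩)))))
  have h0' : ∀ j, s ≤ j → j < s + k → j ≤ 5 → t j ≤ 0 := fun j a b c =>
    (hOj j a b c).le.trans (rate_le_of_not_active hn4 ha4 ha5 _)
  refine Or.inr (Or.inr (Or.inr (Or.inl ⟨?_, fun h => ?_, fun h => ?_, fun h => ?_⟩))) <;>
  · apply h0' <;> omega

theorem IsOpposite.first (hO : IsOpposite emb C f y O) (F : Frame C y)
    (hf : IsSeg emb C y f 0 6 v) {t : ℤ → ℤ}
    (ht : ∀ i, t i = rate emb C f (O i) s(y i, y (i + 1))) :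
    Free emb C f y 0 ∨ (t 0 ≤ 2 ∧ Free emb C f y 1) ∨
      (HasSeg emb C f 2 y (-1) ∧ t 0 ≤ 4 ∧ Free emb C f y 1) ∨
      (HasSeg emb C f 3 y (-1) ∧ t 1 ≤ 0 ∧ Free emb C f y 2) ∨
      (HasEnd emb C f 4 (fun i => y (6 - i)) ∧ t 0 ≤ 2 ∧ t 1 ≤ 2 ∧ Free emb C f y 2) ∨
      (HasEnd emb C f 5 (fun i => y (6 - i)) ∧ t 0 ≤ 1 ∧ t 1 ≤ 1 ∧ Free emb C f y 2) ∨
      (t 0 ≤ 0 ∧ t 1 ≤ 0 ∧ (Free emb C f y 2 ∨ t 2 ≤ 0 ∧ Free emb C f y 3)) ∨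
      (t 0 ≤ 0 ∧ t 1 ≤ 0 ∧ t 2 ≤ 0 ∧ t 3 ≤ 0) := by
  by_cases hF0 : Free emb C f y 0
  · exact Or.inl hF0
  simp only [Free, not_forall] at hF0
  obtain ⟨g, s, k, u, hg, hm, hne, h1, h2, -⟩ := hF0
  refine Or.inr ?_
  have hn := hg.numCEdges_eq F
  have hOj : ∀ j, 0 ≤ j → j < s + k → j ≤ 5 → t j = rate emb C f g s(y j, y (j + 1)) :=
    fun j a b c => by rw [ht, hO.eq F hf hg hne (by omega) b (by omega) (by omega)]
  have hfree : ∀ j, j = s + k → j ≤ 6 → Free emb C f y j := fun j hj h =>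
    hj ▸ hf.free F hg hne (by omega) (by omega)
  have hk' : k = 2 ∨ k = 3 ∨ 4 ≤ k := by omega
  rcases hk' with rfl | rfl | hk4
  · obtain rfl : s = -1 := by omega
    exact Or.inr (Or.inl ⟨⟨g, u, hg, hne⟩, (hOj 0 le_rfl (by norm_num) (by norm_num)).le.trans
      (rate_le_of_two (by omega) _), hfree 1 (by norm_num) (by norm_num)⟩)
  · have h4 : ∀ j, 0 ≤ j → j < s + 3 → j ≤ 5 → j ≠ s + 1 → t j ≤ 0 := fun j a b c d =>
      (hOj j a b c).le.trans (rate_le_of_not_middle (by omega)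
        fun h => d (hg.eq_of_isMiddleCEdge F (by omega) b h))
    have : s = -2 ∨ s = -1 := by omega
    rcases this with rfl | rfl
    · exact Or.inl ⟨(h4 0 (by omega) (by omega) (by omega) (by omega)).trans (by norm_num),
        hfree 1 (by norm_num) (by norm_num)⟩
    · exact Or.inr (Or.inr (Or.inl ⟨⟨g, u, hg, hne⟩,
        h4 1 (by omega) (by omega) (by omega) (by omega), hfree 2 (by norm_num) (by norm_num)⟩))
  have hn4 : 4 ≤ numCEdges emb C g := by omega
  have h2' : ∀ j, 0 ≤ j → j < s + k → j ≤ 5 → t j ≤ 2 := fun j a b c =>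
    (hOj j a b c).le.trans (rate_le_of_four_le hn4 _)
  by_cases hs1 : s + k = 1
  · exact Or.inl ⟨h2' 0 (by omega) (by omega) (by omega), hfree 1 (by omega) (by norm_num)⟩
  by_cases ha4 : ActiveFour emb C f g
  · have hs2 : s + k = 2 := by
      by_contra hs2
      exact (hf.not_active F hg (i := 0) h1.le (by omega) le_rfl (by omega)).1 ha4
    have := ha4.2.2.2.1
    obtain rfl : k = 4 := by omega
    obtain rfl : s = -2 := by omega
    obtain ⟨h, l, w, hh, hl, hgh⟩ := hf.mirror_six.exists_of_activeFour
      (by simpa using hg.mirror 6) (F.mirror 6) ha4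
    exact Or.inr (Or.inr (Or.inr (Or.inl ⟨⟨g, u, h, l, w, by simpa using hg.mirror 6, hne, hh,
      by omega, hgh⟩, h2' 0 (by omega) (by omega) (by omega),
      h2' 1 (by omega) (by omega) (by omega), hfree 2 (by norm_num) (by norm_num)⟩)))
  by_cases ha5 : ActiveFive emb C f g
  · have hs2 : s + k = 2 := by
      by_contra hs2
      exact (hf.not_active F hg (i := 0) h1.le (by omega) le_rfl (by omega)).2 ha5
    have := ha5.2.2.2.1
    obtain rfl : k = 5 := by omega
    obtain rfl : s = -3 := by omega
    obtain ⟨h, w, hh, hgh⟩ := hf.mirror_six.exists_of_activeFive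
      (by simpa using hg.mirror 6) (F.mirror 6) ha5
    have h1' : ∀ j, 0 ≤ j → j < -3 + 5 → j ≤ 5 → t j ≤ 1 := fun j a b c =>
      (hOj j a b c).le.trans (rate_le_of_not_four hn4 ha4 _)
    exact Or.inr (Or.inr (Or.inr (Or.inr (Or.inl ⟨⟨g, u, h, 2, w, by simpa using hg.mirror 6,
      hne, hh, by omega, hgh⟩, h1' 0 (by omega) (by omega) (by omega),
      h1' 1 (by omega) (by omega) (by omega), hfree 2 (by norm_num) (by norm_num)⟩))))
  have h0' : ∀ j, 0 ≤ j → j < s + k → j ≤ 5 → t j ≤ 0 := fun j a b c =>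
    (hOj j a b c).le.trans (rate_le_of_not_active hn4 ha4 ha5 _)
  refine Or.inr (Or.inr (Or.inr (Or.inr (Or.inr ?_))))
  have h00 := h0' 0 (by omega) (by omega) (by omega)
  have h01 := h0' 1 (by omega) (by omega) (by omega)
  by_cases hs2 : s + k = 2
  · exact Or.inl ⟨h00, h01, Or.inl (hfree 2 (by omega) (by omega))⟩
  have h02 := h0' 2 (by omega) (by omega) (by omega)
  by_cases hs3 : s + k = 3
  · exact Or.inl ⟨h00, h01, Or.inr ⟨h02, hfree 3 (by omega) (by omega)⟩⟩
  exact Or.inr ⟨h00, h01, h02, h0' 3 (by omega) (by omega) (by omega)⟩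

end SixFace

section SixFace

variable {V : Type*} [Fintype V] {G : SimpleGraph V} {emb : PlaneEmbedding G}
variable {x : V} {C : G.Walk x x} {y : ℤ → V}
variable {f : Set (ℝ × ℝ)} {v : V} {O : ℤ → Set (ℝ × ℝ)}

theorem HasSeg.not_two_two (p1 : HasSeg emb C f 2 y 1) (p3 : HasSeg emb C f 2 y 3)
    (F : Frame C y) (hf : IsSeg emb C y f 0 6 v) : False := by
  obtain ⟨g, u, hg, hne⟩ := p1
  obtain ⟨g', u', hg', hne'⟩ := p3
  exact PlaneTopology.not_two_two F hf hg hg' hne hne'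

theorem HasSeg.chord_of_two_two (p0 : HasSeg emb C f 2 y 0) (p2 : HasSeg emb C f 2 y 2)
    (F : Frame C y) (hf : IsSeg emb C y f 0 6 v) : ChordIn emb y f 3 6 := by
  obtain ⟨g, u, hg, hne⟩ := p0
  obtain ⟨g', u', hg', hne'⟩ := p2
  exact PlaneTopology.chord_of_two_two F hf hg hg' hne hne'

theorem HasSeg.chord_of_two_three (p2 : HasSeg emb C f 2 y 2) (q : HasSeg emb C f 3 y (-1))
    (F : Frame C y) (hf : IsSeg emb C y f 0 6 v) : ChordIn emb y f 3 6 := by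
  obtain ⟨g, u, hg, hne⟩ := p2
  obtain ⟨g', u', hg', -⟩ := q
  obtain ⟨j, h1, h2, h3, hc⟩ := hf.two_chord (i := 3) hg F hne (by norm_num) (by norm_num)
  have : j = 0 ∨ j = 6 := by omega
  rcases this with rfl | rfl
  · exact absurd hc.adj.symm (hg'.three_not_adj_right F)
  · exact hc

theorem HasSeg.not_chord_two (p4 : HasSeg emb C f 2 y 4) (hc : ChordIn emb y f 3 6)
    (F : Frame C y) (hf : IsSeg emb C y f 0 6 v) : False := by
  obtain ⟨g, u, hg, hne⟩ := p4
  exact not_two_two_two F hf hc hg hne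

theorem HasSeg.not_chord_three (q4 : HasSeg emb C f 3 y 4) (hc : ChordIn emb y f 3 6)
    (F : Frame C y) : False := by
  obtain ⟨g, u, hg, -⟩ := q4
  exact hg.three_not_adj_left F hc.adj

theorem HasEnd.not_four (hr : HasEnd emb C f 4 y) (p2 : HasSeg emb C f 2 y 2)
    (hc : ChordIn emb y f 3 6) (F : Frame C y) (hf : IsSeg emb C y f 0 6 v) : False := by
  obtain ⟨g, u, hg, -⟩ := p2
  obtain ⟨h, u', h', l, w, hh, hne, hh', hl, hne'⟩ := hr
  exact not_two_four F hf hc hg hh hne hh' (by omega) hne'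

theorem HasEnd.not_five (hr : HasEnd emb C f 5 y) (p2 : HasSeg emb C f 2 y 2)
    (hc : ChordIn emb y f 3 6) (F : Frame C y) (hf : IsSeg emb C y f 0 6 v) : False := by
  obtain ⟨g, u, hg, -⟩ := p2
  obtain ⟨h, u', h', l, w, hh, hne, hh', hl, hne'⟩ := hr
  obtain rfl : l = 2 := by omega
  exact not_two_five F hf hc hg hh hne hh' hne'

theorem HasSeg.not_three_two (q0 : HasSeg emb C f 3 y 0) (p3 : HasSeg emb C f 2 y 3)
    (F : Frame C y) (hf : IsSeg emb C y f 0 6 v) : False := by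
  obtain ⟨g, u, hg, hne⟩ := q0
  obtain ⟨g', u', hg', hne'⟩ := p3
  exact PlaneTopology.not_three_two F hf hg hg' hne hne'

theorem HasSeg.not_two_three_two (p0 : HasSeg emb C f 2 y 0) (q2 : HasSeg emb C f 3 y 2)
    (p5 : HasSeg emb C f 2 y 5) (F : Frame C y) (hf : IsSeg emb C y f 0 6 v) : False := by
  obtain ⟨g, u, hg, hne⟩ := p0
  obtain ⟨h, w, hh, hfh⟩ := q2
  obtain ⟨g', u', hg', -⟩ := p5
  exact PlaneTopology.not_two_three_two F hf hg hh hg' hne hfh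

/-- A 6-face loses weight at most `16/6` to the opposite faces. -/
theorem IsOpposite.sum_rate_le (hO : IsOpposite emb C f y O) (F : Frame C y)
    (hf : IsSeg emb C y f 0 6 v) {t : ℤ → ℤ}
    (ht : ∀ i, t i = rate emb C f (O i) s(y i, y (i + 1))) :
    t 0 + t 1 + t 2 + t 3 + t 4 + t 5 ≤ 16 := by
  have F' := F.mirror 6
  have hf' := hf.mirror_six
  refine PlaneTopology.sum_rate_le (fun i => (ht i).le.trans (rate_le_six _)) (hO.first F hf ht)
    (hO.step F hf ht) ?_ ?_ ?_ ?_ ?_ ?_ ?_ ?_ ?_ ?_ ?_ ?_ ?_ ?_ ?_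
  · exact fun p1 p3 => p1.not_two_two p3 F hf
  · exact fun p0 p2 p4 => p4.not_chord_two (p0.chord_of_two_two p2 F hf) F hf
  · exact fun p0 p2 q4 => q4.not_chord_three (p0.chord_of_two_two p2 F hf) F
  · exact fun p4 p2 q => (q.mirror (j := 4) (by norm_num)).not_chord_three
      ((p4.mirror (by norm_num)).chord_of_two_two (p2.mirror (by norm_num)) F' hf') F'
  · exact fun p0 p2 r => r.not_four p2 (p0.chord_of_two_two p2 F hf) F hf
  · exact fun p4 p2 r => r.not_four (p2.mirror (by norm_num))
      ((p4.mirror (by norm_num)).chord_of_two_two (p2.mirror (by norm_num)) F' hf') F' hf'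
  · exact fun p0 p2 m => m.not_five p2 (p0.chord_of_two_two p2 F hf) F hf
  · exact fun p4 p2 m => m.not_five (p2.mirror (by norm_num))
      ((p4.mirror (by norm_num)).chord_of_two_two (p2.mirror (by norm_num)) F' hf') F' hf'
  · exact fun q0 p3 => q0.not_three_two p3 F hf
  · exact fun q3 p1 => (q3.mirror (j := 0) (by norm_num)).not_three_two
      (p1.mirror (by norm_num)) F' hf'
  · exact fun p0 q2 p5 => p0.not_two_three_two q2 p5 F hf
  · exact fun p4 q1 p => (p4.mirror (j := 0) (by norm_num)).not_two_three_two
      (q1.mirror (by norm_num)) (p.mirror (by norm_num)) F' hf'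
  · exact fun p2 q q4 => q4.not_chord_three (p2.chord_of_two_three q F hf) F
  · exact fun p2 q r => r.not_four p2 (p2.chord_of_two_three q F hf) F hf
  · exact fun p2 q4 r => r.not_four (p2.mirror (by norm_num))
      ((p2.mirror (by norm_num)).chord_of_two_three (q4.mirror (by norm_num)) F' hf') F' hf'

end SixFace

section Discharging

variable {V : Type*} {G : SimpleGraph V} {emb : PlaneEmbedding G}
variable {x : V} {C : G.Walk x x} {y : ℤ → V}
variable {f g : Set (ℝ × ℝ)} {v : V} {O : ℤ → Set (ℝ × ℝ)}

theorem mEdges_comm : mEdges emb C f g = mEdges emb C g f := by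
  simp only [mEdges, and_comm]

theorem mEdges_eq_zero (hne : f ≠ g) (h : ¬ OppositeFaces emb C f g) : mEdges emb C f g = 0 := by
  rw [mEdges, Finset.card_eq_zero, Finset.filter_eq_empty_iff]
  exact fun e he hfg => h ⟨hne, e, by simpa using he, hfg⟩

variable [Fintype V]

theorem sendWeight_nonneg : 0 ≤ sendWeight emb C f g := by
  unfold sendWeight
  positivity

theorem sendWeight_self : sendWeight emb C f f = 0 := by
  simp [sendWeight, OppositeFaces]

theorem sendWeight_of_not_minor (h : ¬ MinorFaceH emb C g) : sendWeight emb C f g = 0 := by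
  simp [sendWeight, h]

theorem sendWeight_of_not_face (h : ¬ IsFaceOf (drawingH emb C) f) :
    sendWeight emb C f g = 0 := by
  have h1 : ¬ MinorFaceH emb C f := fun h' => h h'.1
  have h2 : ¬ MajorFaceH emb C f := fun h' => h h'.1
  simp [sendWeight, h1, h2]

theorem mEdges_le_sendWeight (hg : MajorFaceH emb C g) (hf : MinorFaceH emb C f) :
    (mEdges emb C f g : ℚ) ≤ sendWeight emb C g f := by
  have hne : f ≠ g := fun h => hg.2 (h ▸ hf)
  by_cases ho : OppositeFaces emb C g f
  · simp [sendWeight, hg, hg.2, hf, ho, mEdges_comm (f := f)]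
  · rw [mEdges_comm, mEdges_eq_zero hne.symm ho]
    simpa using sendWeight_nonneg

theorem sendWeight_le_rate (hf : MinorFaceH emb C f) (hg : MinorFaceH emb C g) :
    sendWeight emb C f g ≤ 1 / 6 * ((∑ e ∈ C.edges.toFinset.filter
      (fun e => incEdge emb f e ∧ incEdge emb g e), rate emb C f g e : ℤ) : ℚ) := by
  have hM : ¬ MajorFaceH emb C f := fun h => h.2 hf
  have hM' : ¬ MajorFaceH emb C g := fun h => h.2 hg
  by_cases h2 : numCEdges emb C g = 2
  · have : ∑ e ∈ C.edges.toFinset.filter (fun e => incEdge emb f e ∧ incEdge emb g e),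
        rate emb C f g e = mEdges emb C f g * 4 := by
      simp [rate, hM', h2, mEdges]
    rw [this]
    simp only [sendWeight, hM, h2]
    push_cast
    norm_num
    split_ifs <;> linarith [(mEdges emb C f g).cast_nonneg (α := ℚ)]
  by_cases h3 : numCEdges emb C g = 3
  · have h4 : ¬ ActiveFour emb C f g := fun h => by have := h.2.2.2.1; omega
    have h5 : ¬ ActiveFive emb C f g := fun h => by have := h.2.2.2.1; omega
    have hr : ∀ e, 0 ≤ rate emb C f g e := fun e => by
      simp only [rate, hM', h2, h4, h5]
      split_ifs <;> simp_all
    simp only [sendWeight, hM, h3]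
    norm_num
    split_ifs with h
    · obtain ⟨-, -, -, e, he, hfe⟩ := h
      have : rate emb C f g e ≤ ∑ e ∈ C.edges.toFinset.filter
          (fun e => incEdge emb f e ∧ incEdge emb g e), rate emb C f g e :=
        Finset.single_le_sum (fun e _ => hr e) (by simpa using ⟨he.1, hfe, he.2.1⟩)
      have h6 : rate emb C f g e = 6 := by simp [rate, hM', h3, he]
      rw [h6] at this
      have : (6 : ℚ) ≤ ∑ e ∈ C.edges.toFinset.filter
          (fun e => incEdge emb f e ∧ incEdge emb g e), (rate emb C f g e : ℚ) := by
        exact_mod_cast this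
      linarith
    · have : (0 : ℚ) ≤ ∑ e ∈ C.edges.toFinset.filter
          (fun e => incEdge emb f e ∧ incEdge emb g e), (rate emb C f g e : ℚ) :=
        Finset.sum_nonneg fun e _ => by exact_mod_cast hr e
      linarith
  have hs : sendWeight emb C f g =
      (if ActiveFour emb C f g then 2 / 3 else 0) + if ActiveFive emb C f g then 1 / 3 else 0 := by
    simp only [sendWeight, hM, h2, h3, false_and, and_false, if_false, zero_add, ActiveFour,
      ActiveFive]
    congr
  have hr : ∀ e, rate emb C f g e =
      if ActiveFour emb C f g then 2 else if ActiveFive emb C f g then 1 else 0 := fun e => by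
    simp [rate, hM', h2, h3]
  simp only [hs, hr, Finset.sum_const]
  change _ ≤ 1 / 6 * ((mEdges emb C f g • _ : ℤ) : ℚ)
  by_cases h4 : ActiveFour emb C f g
  · have h5 : ¬ ActiveFive emb C f g := fun h => by
      have := h.2.2.2.1
      have := h4.2.2.2.1
      omega
    have h6 := h4.2.2.2.2.2.1
    rw [mEdges_comm] at h6
    simp only [h4, h5, h6]
    norm_num
  by_cases h5 : ActiveFive emb C f g
  · have h6 := h5.2.2.2.2.2.1
    rw [mEdges_comm] at h6
    simp only [h4, h5, h6]
    norm_num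
  simp [h4, h5]

/-- The net weight sent from a minor face `f` to a face `g` is bounded by the rates along their
common edges. -/
theorem net_le_rate (hf : MinorFaceH emb C f) (hg : IsFaceOf (drawingH emb C) g) :
    sendWeight emb C f g - sendWeight emb C g f ≤ 1 / 6 * ((∑ e ∈ C.edges.toFinset.filter
      (fun e => incEdge emb f e ∧ incEdge emb g e), rate emb C f g e : ℤ) : ℚ) := by
  by_cases hm : MinorFaceH emb C g
  · linarith [sendWeight_le_rate hf hm, sendWeight_nonneg (emb := emb) (C := C) (f := g)
      (g := f)]
  have hM : MajorFaceH emb C g := ⟨hg, hm⟩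
  have : ∑ e ∈ C.edges.toFinset.filter (fun e => incEdge emb f e ∧ incEdge emb g e),
      rate emb C f g e = mEdges emb C f g * (-6) := by
    simp only [rate_of_major hM, Finset.sum_const, mEdges, nsmul_eq_mul]
  rw [this, sendWeight_of_not_minor hm]
  have := mEdges_le_sendWeight hM hf
  push_cast
  linarith

theorem IsOpposite.sum_rate_le_rate (hO : IsOpposite emb C f y O) (F : Frame C y)
    (hf : IsSeg emb C y f 0 6 v) {S : Finset (Set (ℝ × ℝ))}
    (hS : ∀ g, g ∈ S ↔ IsFaceOf (drawingH emb C) g) {i : ℤ} (h0 : 0 ≤ i) (h5 : i < 6) :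
    ∑ g ∈ S with f ≠ g ∧ incEdge emb g s(y i, y (i + 1)), rate emb C f g s(y i, y (i + 1)) ≤
      rate emb C f (O i) s(y i, y (i + 1)) := by
  have hD := drawingH_eq emb F.long.1 F.long.2.1
  have hmem : O i ∈ S.filter fun g => f ≠ g ∧ incEdge emb g s(y i, y (i + 1)) := by
    rw [Finset.mem_filter, hS, hD]
    exact ⟨(hO i).1, (hO i).2⟩
  have hmaj : ∀ g ∈ S.filter fun g => f ≠ g ∧ incEdge emb g s(y i, y (i + 1)), g ≠ O i →
      MajorFaceH emb C g := by
    intro g hg hgo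
    rw [Finset.mem_filter, hS] at hg
    refine ⟨hg.1, fun hm => hgo ?_⟩
    obtain ⟨s, k, u, hs⟩ := exists_isSeg emb F.long.1 F.long.2.1 F.enum hm
    obtain ⟨s', hs', h1, h2⟩ := hs.exists_rotate F hg.2.2
    exact (hO.eq F hf hs' hg.2.1 h1 h2 h0 h5).symm
  rw [← Finset.add_sum_erase _ _ hmem]
  have : ∑ g ∈ (S.filter fun g => f ≠ g ∧ incEdge emb g s(y i, y (i + 1))).erase (O i),
      rate emb C f g s(y i, y (i + 1)) ≤ 0 := by
    refine Finset.sum_nonpos fun g hg => ?_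
    rw [Finset.mem_erase] at hg
    rw [rate_of_major (hmaj g hg.2 hg.1)]
    norm_num
  linarith

theorem wFace_eq_sum {S : Finset (Set (ℝ × ℝ))} (hS : ∀ g, g ∈ S ↔ IsFaceOf (drawingH emb C) g) :
    wFace emb C f = numCEdges emb C f -
      ∑ g ∈ S with f ≠ g, (sendWeight emb C f g - sendWeight emb C g f) := by
  have h1 : ∑ᶠ g, sendWeight emb C f g = ∑ g ∈ S with f ≠ g, sendWeight emb C f g := by
    refine finsum_eq_sum_of_support_subset _ fun g hg => ?_
    rw [Finset.coe_filter]
    refine ⟨(hS g).2 ?_, ?_⟩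
    · by_contra h
      exact hg (sendWeight_of_not_minor fun h' => h h'.1)
    · rintro rfl
      exact hg sendWeight_self
  have h2 : ∑ᶠ g, sendWeight emb C g f = ∑ g ∈ S with f ≠ g, sendWeight emb C g f := by
    refine finsum_eq_sum_of_support_subset _ fun g hg => ?_
    rw [Finset.coe_filter]
    refine ⟨(hS g).2 ?_, ?_⟩
    · by_contra h
      exact hg (sendWeight_of_not_face h)
    · rintro rfl
      exact hg sendWeight_self
  rw [wFace, h1, h2, Finset.sum_sub_distrib]
  ring

theorem IsOpposite.ten_thirds_le_wFace (hO : IsOpposite emb C f y O) (F : Frame C y)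
    (hf : IsSeg emb C y f 0 6 v) (hm : MinorFaceH emb C f) : 10 / 3 ≤ wFace emb C f := by
  have hD := drawingH_eq emb F.long.1 F.long.2.1
  have hfin := (cycleBounded_hEdges emb F.long.1 F.long.2.1).2.1
  rw [← hD] at hfin
  have hS : ∀ g, g ∈ hfin.toFinset ↔ IsFaceOf (drawingH emb C) g := fun g => by simp
  have hn : (numCEdges emb C f : ℤ) = 6 := hf.numCEdges_eq F
  have hn' : (numCEdges emb C f : ℚ) = 6 := by exact_mod_cast hn
  rw [wFace_eq_sum hS, hn']
  set S := hfin.toFinset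
  have h1 : ∑ g ∈ S with f ≠ g, (sendWeight emb C f g - sendWeight emb C g f) ≤
      ∑ g ∈ S with f ≠ g, 1 / 6 * ((∑ e ∈ C.edges.toFinset.filter
        (fun e => incEdge emb f e ∧ incEdge emb g e), rate emb C f g e : ℤ) : ℚ) := by
    refine Finset.sum_le_sum fun g hg => ?_
    rw [Finset.mem_filter, hS] at hg
    exact net_le_rate hm hg.1
  have h2 : ∑ g ∈ S with f ≠ g, ∑ e ∈ C.edges.toFinset.filter
      (fun e => incEdge emb f e ∧ incEdge emb g e), rate emb C f g e =
      ∑ i ∈ Finset.Ico (0 : ℤ) 6, ∑ g ∈ S with f ≠ g ∧ incEdge emb g s(y i, y (i + 1)),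
        rate emb C f g s(y i, y (i + 1)) := by
    simp only [← Finset.filter_filter, hf.filter_incEdge F, zero_add]
    simp only [Finset.sum_filter (p := fun e => incEdge emb _ e)]
    rw [Finset.sum_comm, Finset.sum_image (F.edge_injOn (by have := F.len; omega))]
    refine Finset.sum_congr rfl fun i _ => ?_
    rw [Finset.sum_filter, Finset.sum_filter, Finset.sum_filter]
  have h3 : ∑ i ∈ Finset.Ico (0 : ℤ) 6, ∑ g ∈ S with f ≠ g ∧ incEdge emb g s(y i, y (i + 1)),
      rate emb C f g s(y i, y (i + 1)) ≤ 16 := by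
    refine (Finset.sum_le_sum fun i hi => ?_).trans (b := ∑ i ∈ Finset.Ico (0 : ℤ) 6,
      rate emb C f (O i) s(y i, y (i + 1))) ?_
    · rw [Finset.mem_Ico] at hi
      exact hO.sum_rate_le_rate F hf hS hi.1 hi.2
    · have := hO.sum_rate_le F hf (t := fun i => rate emb C f (O i) s(y i, y (i + 1))) fun _ => rfl
      simpa [show Finset.Ico (0 : ℤ) 6 = {0, 1, 2, 3, 4, 5} from rfl, add_assoc] using this
  rw [← Finset.mul_sum, ← Int.cast_sum, h2] at h1
  have h4 : ((∑ i ∈ Finset.Ico (0 : ℤ) 6,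
      ∑ g ∈ S with f ≠ g ∧ incEdge emb g s(y i, y (i + 1)),
        rate emb C f g s(y i, y (i + 1)) : ℤ) : ℚ) ≤ 16 := by exact_mod_cast h3
  linarith

end Discharging

end PlaneTopology

/-- After discharging by rules R1–R5, every minor 6-face of `H` has weight `≥ 10/3`. -/
theorem stmt12_minor_6face
    {V : Type*} [Fintype V] {G : SimpleGraph V}
    (hn : 11 ≤ Fintype.card V) (h4 : EssentiallyFourConnected G)
    (emb : PlaneEmbedding G) {x : V} (C : G.Walk x x)
    (hC : IsLongestIsolatingCycle G C) (hc : 8 ≤ C.length)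
    (hVm : (Vminus emb C).Nonempty) (hVp : (Vplus emb C).Nonempty) :
    ∀ f : Set (ℝ × ℝ), MinorFaceH emb C f → numCEdges emb C f = 6 →
      (10 : ℚ) / 3 ≤ wFace emb C f := by
  open PlaneTopology in
  intro f hm hn
  obtain ⟨y, hy⟩ := exists_cyclicEnum hC.1
  obtain ⟨s, k, v, hs⟩ := exists_isSeg emb hC.1 hC.2.1 hy hm
  have F : Frame C y := ⟨hC, h4.1, hc, hy⟩
  have hk := hs.numCEdges_eq F
  obtain rfl : k = 6 := by omega
  have hf := hs.shift s
  rw [sub_self] at hf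
  have F' := F.shift s
  have hO := fun i => exists_opposite_face (emb := emb) hC.1 hC.2.1 hs.face (F'.enum.edge_mem i)
  choose O hO using hO
  exact IsOpposite.ten_thirds_le_wFace (fun i => ⟨(hO i).1, (hO i).2.1.symm, (hO i).2.2⟩) F' hf hm

end
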